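/- Let W be the Weyl group of a Kac–Moody group (a Coxeter group with Bruhat order and Demazure product), n ≥ 1, and let Q = {(v, w̲) ∈ W × Wⁿ : v ≤ m_∗(w̲)} with partial order (v', w̲') ≤ (v, w̲) iff v ≤ v' and w̲' ≤ w̲, and let Q̂ = Q ⊔ {0̂} be its augmentation by a minimum 0̂. Then: (i) Q̂ is pure; (ii) Q̂ is thin, i.e. every interval of length 2 in Q̂ has exactly 4 elements; (iii) for every x ∈ Q̂, the closed interval [0̂, x] is shellable. -/

import Mathlib

open Pointwise Topology

noncomputable section

namespace TotPos

/-! ### Coxeter combinatorics: Bruhat order (subword property) and Demazure product -/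

section Coxeter

variable {B W : Type} [Group W] {M : CoxeterMatrix B}

/-- The Bruhat order on a Coxeter group, via the subword property. -/
def BruhatLE (cs : CoxeterSystem M W) (v w : W) : Prop :=
  ∃ ω : List B, cs.IsReduced ω ∧ cs.wordProd ω = w ∧
    ∃ ω' : List B, ω'.Sublist ω ∧ cs.wordProd ω' = v

def BruhatLT (cs : CoxeterSystem M W) (v w : W) : Prop :=
  BruhatLE cs v w ∧ v ≠ w

/-- `dem` is the Demazure (star) product of the Coxeter system `cs`:
the associative monoid operation determined by `x ∗ y = x y` when lengths add and
`s ∗ w = w` when `s w < w` for a simple reflection `s`. -/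
structure IsDemazure (cs : CoxeterSystem M W) (dem : W → W → W) : Prop where
  assoc : ∀ x y z, dem (dem x y) z = dem x (dem y z)
  eq_mul : ∀ x y, cs.length (x * y) = cs.length x + cs.length y → dem x y = x * y
  absorb : ∀ (i : B) (w : W), cs.length (cs.simple i * w) < cs.length w →
    dem (cs.simple i) w = w

/-- `m_∗(w_1, …, w_n) = w_1 ∗ w_2 ∗ ⋯ ∗ w_n`. -/
def demProd {n : ℕ} (dem : W → W → W) (w : Fin n → W) : W :=
  (List.ofFn w).foldr dem 1

/-- `m_•(w_1, …, w_n) = w_1 w_2 ⋯ w_n`. -/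
def seqProd {n : ℕ} (w : Fin n → W) : W := (List.ofFn w).prod

/-- componentwise Bruhat order on `Wⁿ` -/
def seqLE (cs : CoxeterSystem M W) {n : ℕ} (v w : Fin n → W) : Prop :=
  ∀ i, BruhatLE cs (v i) (w i)

/-- `v̲` is positive in `w̲`. -/
def IsPositiveSeq (cs : CoxeterSystem M W) {n : ℕ} (v w : Fin n → W) : Prop :=
  seqLE cs v w ∧
  ∀ (i : Fin n) (v' : Fin n → W),
    (∀ j, j < i → BruhatLE cs (v' j) (v j)) →
    BruhatLE cs (v' i) (w i) →
    ((List.ofFn v').take ((i : ℕ) + 1)).prod = ((List.ofFn v).take ((i : ℕ) + 1)).prod →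
    ∀ j, j ≤ i → v' j = v j

/-- the product of the first `k` letters of the subexpression `ε` of the word `ω`. -/
def subwordProd (cs : CoxeterSystem M W) (ω : List B) (ε : Fin ω.length → Bool)
    (k : ℕ) : W :=
  ((List.ofFn fun j => if ε j then cs.simple (ω.get j) else 1).take k).prod

/-- `ε` is a positive subexpression of the reduced word `ω`, with total product `v`
(Marsh–Rietsch). -/
def IsPositiveSubexpr (cs : CoxeterSystem M W) (ω : List B)
    (ε : Fin ω.length → Bool) (v : W) : Prop :=
  subwordProd cs ω ε ω.length = v ∧
  ∀ j : Fin ω.length,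
    BruhatLT cs (subwordProd cs ω ε (j : ℕ))
      (subwordProd cs ω ε (j : ℕ) * cs.simple (ω.get j))

end Coxeter

/-! ### Poset combinatorics, relative to a relation -/

section Posets

variable {α : Type*}

/-- covering relation of the partial order `r` -/
def CovR (r : α → α → Prop) (x y : α) : Prop :=
  r x y ∧ x ≠ y ∧ ∀ z, r x z → r z y → z = x ∨ z = y

/-- `l` is a maximal (saturated) chain from `x` to `y` -/
def IsMaxChainList (r : α → α → Prop) (x y : α) (l : List α) : Prop :=
  l.Chain' (CovR r) ∧ l.head? = some x ∧ l.getLast? = some y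

/-- the poset `r` is pure: maximal chains between comparable elements exist and all
have the same length. -/
def PureR (r : α → α → Prop) : Prop :=
  ∀ x y, r x y → (∃ l, IsMaxChainList r x y l) ∧
    ∀ l l', IsMaxChainList r x y l → IsMaxChainList r x y l' → l.length = l'.length

/-- the poset `r` is thin: every interval of length 2 has exactly four elements. -/
def ThinR (r : α → α → Prop) : Prop :=
  ∀ x y, (∃ z, CovR r x z ∧ CovR r z y) → {z | r x z ∧ r z y}.ncard = 4

/-- `c` is a maximal chain of the subposet `s` of `r`; maximal chains are the maximal
faces of the order complex. -/
def IsMaxChainFinset (r : α → α → Prop) (s : Set α) (c : Finset α) : Prop :=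
  ↑c ⊆ s ∧ IsChain r ↑c ∧
    ∀ c' : Finset α, ↑c' ⊆ s → IsChain r ↑c' → c ⊆ c' → c = c'

/-- The (finite) subposet `s` of `r` is shellable: its maximal chains can be
enumerated `F 0, F 1, …` so that each `F k ∩ (F 0 ∪ ⋯ ∪ F (k-1))` is a nonempty union
of maximal proper faces of the simplex `F k`.  (Faces of the order complex contained
in a chain `F k` are just the subsets of `F k`.) -/
def ShellableR (r : α → α → Prop) (s : Set α) : Prop :=
  ∃ (N : ℕ) (F : Fin N → Finset α), Function.Injective F ∧
    (∀ c, IsMaxChainFinset r s c ↔ ∃ k, F k = c) ∧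
    ∀ k : Fin N, 0 < (k : ℕ) →
      ∃ S : Finset α, S.Nonempty ∧ S ⊆ F k ∧
        ∀ c : Finset α, (c ⊆ F k ∧ ∃ i, i < k ∧ c ⊆ F i) ↔
          ∃ a ∈ S, (c : Set α) ⊆ ↑(F k) \ {a}

end Posets

/-! ### Regular CW complexes -/

section CW

/-- `X = ⊔ strata i` is a regular CW complex: finitely many strata, the closure of each
stratum is the homeomorphic image of a closed ball with the stratum corresponding to the
open ball, and the closure of each stratum is a union of strata. -/
def IsRegularCW {X ι : Type} [TopologicalSpace X] (strata : ι → Set X) : Prop :=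
  Finite ι ∧
  (Pairwise fun i j => Disjoint (strata i) (strata j)) ∧
  (∀ i : ι, ∃ (d : ℕ)
    (e : ↥(Metric.closedBall (0 : EuclideanSpace ℝ (Fin d)) 1) ≃ₜ ↥(closure (strata i))),
    ∀ x, ((e x : X) ∈ strata i ↔ ‖(x : EuclideanSpace ℝ (Fin d))‖ < 1)) ∧
  (∀ i : ι, ∃ s : Set ι, closure (strata i) = ⋃ j ∈ s, strata j)

/-- `X` is homeomorphic to a closed ball of dimension `d`. -/
def HomeoToClosedBall (X : Type) [TopologicalSpace X] (d : ℕ) : Prop :=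
  Nonempty (X ≃ₜ ↥(Metric.closedBall (0 : EuclideanSpace ℝ (Fin d)) 1))

end CW

/-! ### The group-theoretic setting: pinned Kac–Moody-type group, flag variety,
twisted products, total positivity -/

section Grp

variable {B W G : Type} [Group W] {M : CoxeterMatrix B} [Group G] [TopologicalSpace G]

/-- `U⁻_{≥0}` (resp. `U⁺_{≥0}`): the submonoid generated by the `y i (a)` (resp `x i a`)
for real `a > 0`. -/
def Unn (y : B → ℂ → G) : Set G :=
  (Submonoid.closure {g : G | ∃ (i : B) (a : ℝ), 0 < a ∧ g = y i (a : ℂ)} : Set G)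

/-- double coset `A g C` -/
def dcos (A C : Subgroup G) (g : G) : Set G := (A : Set G) * {g} * (C : Set G)

/-- the defining relation of the twisted product
`𝓩 = G ×^{B⁺} G ×^{B⁺} ⋯ ×^{B⁺} G/B⁺`. -/
def twistRel (Bp : Subgroup G) (n : ℕ) (g h : Fin n → G) : Prop :=
  ∃ b : Fin n → G, (∀ i, b i ∈ Bp) ∧
    ∀ i : Fin n, h i = (if (i : ℕ) = 0 then (1 : G)
      else b ⟨(i : ℕ) - 1, lt_of_le_of_lt (Nat.sub_le _ _) i.isLt⟩)⁻¹ * g i * b i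

/-- the twisted product `𝓩 = G ×^{B⁺} ⋯ ×^{B⁺} G/B⁺` (`n` factors), as a quotient
topological space. -/
def Zspace (Bp : Subgroup G) (n : ℕ) : Type := Quot (twistRel Bp n)

instance (Bp : Subgroup G) (n : ℕ) : TopologicalSpace (Zspace Bp n) :=
  instTopologicalSpaceQuot

def mkZ (Bp : Subgroup G) (n : ℕ) (g : Fin n → G) : Zspace Bp n := Quot.mk _ g

/-- the Schubert cell `𝓩̊_{w̲} = B⁺ẇ_1B⁺ ×^{B⁺} ⋯ ×^{B⁺} B⁺ẇ_nB⁺/B⁺` -/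
def schubertZ (Bp : Subgroup G) (dot : W → G) {n : ℕ} (w : Fin n → W) :
    Set (Zspace Bp n) :=
  {z | ∃ g : Fin n → G, z = mkZ Bp n g ∧ ∀ i, g i ∈ dcos Bp Bp (dot (w i))}

/-- the opposite Schubert cell `𝓩̊ᵛ = m⁻¹(B⁻v̇B⁺/B⁺)`, `m` the convolution product -/
def oppSchubertZ (Bp Bm : Subgroup G) (dot : W → G) {n : ℕ} (v : W) :
    Set (Zspace Bp n) :=
  {z | ∃ g : Fin n → G, z = mkZ Bp n g ∧ (List.ofFn g).prod ∈ dcos Bm Bp (dot v)}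

/-- the open Richardson variety `𝓩̊_{v,w̲} = 𝓩̊_{w̲} ∩ 𝓩̊ᵛ` -/
def openRichZ (Bp Bm : Subgroup G) (dot : W → G) {n : ℕ} (v : W) (w : Fin n → W) :
    Set (Zspace Bp n) :=
  schubertZ Bp dot w ∩ oppSchubertZ Bp Bm dot v

/-- the totally nonnegative part `𝓩_{≥0}`: the Hausdorff closure of
`(U⁻_{≥0}, …, U⁻_{≥0}B⁺/B⁺)`. -/
def Znn (Bp : Subgroup G) (y : B → ℂ → G) (n : ℕ) : Set (Zspace Bp n) :=
  closure (mkZ Bp n '' {g | ∀ i, g i ∈ Unn y})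

/-- the totally positive stratum `𝓩_{v,w̲,>0} = 𝓩_{≥0} ∩ 𝓩̊_{v,w̲}` -/
def posZ (Bp Bm : Subgroup G) (y : B → ℂ → G) (dot : W → G) {n : ℕ}
    (v : W) (w : Fin n → W) : Set (Zspace Bp n) :=
  Znn Bp y n ∩ openRichZ Bp Bm dot v w

/-- the Marsh–Rietsch set `G_{𝐯₊,𝐰,>0}` attached to a reduced word `ω` and a
(positive) subexpression `ε`. -/
def MRCell (cs : CoxeterSystem M W) (y : B → ℂ → G) (dot : W → G)
    (ω : List B) (ε : Fin ω.length → Bool) : Set G :=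
  {g | ∃ c : Fin ω.length → ℝ, (∀ j, 0 < c j) ∧
    g = (List.ofFn fun j =>
      if ε j then dot (cs.simple (ω.get j)) else y (ω.get j) ((c j : ℝ) : ℂ)).prod}

end Grp


/-! ### Flag varieties, double Bruhat cells, duality -/

section Flag

variable {B W G : Type} [Group W] {M : CoxeterMatrix B} [Group G] [TopologicalSpace G]

def flagMk (Bp : Subgroup G) (g : G) : G ⧸ Bp := QuotientGroup.mk g

/-- the Schubert cell `𝓑̊_w = B⁺ẇB⁺/B⁺` -/
def schubertF (Bp : Subgroup G) (dot : W → G) (w : W) : Set (G ⧸ Bp) :=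
  flagMk Bp '' dcos Bp Bp (dot w)

/-- the opposite Schubert cell `𝓑̊ᵛ = B⁻v̇B⁺/B⁺` -/
def oppSchubertF (Bp Bm : Subgroup G) (dot : W → G) (v : W) : Set (G ⧸ Bp) :=
  flagMk Bp '' dcos Bm Bp (dot v)

/-- the open Richardson variety `𝓑̊_{v,w} = 𝓑̊_w ∩ 𝓑̊ᵛ` -/
def richF (Bp Bm : Subgroup G) (dot : W → G) (v w : W) : Set (G ⧸ Bp) :=
  schubertF Bp dot w ∩ oppSchubertF Bp Bm dot v

/-- the totally nonnegative flag variety `𝓑_{≥0}`, the Hausdorff closure of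
`U⁻_{≥0} B⁺/B⁺` -/
def flagNN (Bp : Subgroup G) (y : B → ℂ → G) : Set (G ⧸ Bp) :=
  closure (flagMk Bp '' Unn y)

/-- the totally positive Richardson stratum `𝓑_{v,w,>0} = 𝓑_{≥0} ∩ 𝓑̊_{v,w}` -/
def posF (Bp Bm : Subgroup G) (y : B → ℂ → G) (dot : W → G) (v w : W) :
    Set (G ⧸ Bp) :=
  flagNN Bp y ∩ richF Bp Bm dot v w

/-- the totally nonnegative monoid `G_{≥0}`, generated by `U⁺_{≥0}`, `U⁻_{≥0}` and
`T_{>0}` -/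
def Gnn (x y : B → ℂ → G) (Tpos : Set G) : Set G :=
  (Submonoid.closure ({g : G | ∃ (i : B) (a : ℝ), 0 < a ∧ g = x i (a : ℂ)} ∪
    {g : G | ∃ (i : B) (a : ℝ), 0 < a ∧ g = y i (a : ℂ)} ∪ Tpos) : Set G)

/-- the double Bruhat cell `G^{v,w} = B⁺ẇB⁺ ∩ B⁻v̇B⁻` -/
def dBruhatCell (Bp Bm : Subgroup G) (dot : W → G) (v w : W) : Set G :=
  dcos Bp Bp (dot w) ∩ dcos Bm Bm (dot v)

/-- the image of a subset of `𝓩` under the duality map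
`Φ(g_1, …, g_n) = (ι(ẇ_0⁻¹g_1⋯g_n), ι(g_n⁻¹), …, ι(g_2⁻¹))`. -/
def PhiSet (Bp : Subgroup G) (ι : G →* G) (dot : W → G) (w0 : W) (n : ℕ)
    (S : Set (Zspace Bp n)) : Set (Zspace Bp n) :=
  {z | ∃ g : Fin n → G, mkZ Bp n g ∈ S ∧
    z = mkZ Bp n (fun j => if h : (j : ℕ) = 0
      then ι ((dot w0)⁻¹ * (List.ofFn g).prod)
      else ι (g ⟨n - (j : ℕ), Nat.sub_lt j.pos (Nat.pos_of_ne_zero h)⟩)⁻¹)}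

end Flag

/-- the augmented poset `Q̂ = Q ⊔ {0̂}`, `Q = {(v, w̲) ∈ W × Wⁿ : v ≤ m_∗(w̲)}`,
ordered by `(v', w̲') ≤ (v, w̲)` iff `v ≤ v'` and `w̲' ≤ w̲`, with added minimum
`0̂ = none`. -/
def QhatLE {B W : Type} [Group W] {M : CoxeterMatrix B}
    (cs : CoxeterSystem M W) (dem : W → W → W) {n : ℕ}
    (a b : Option {p : W × (Fin n → W) // BruhatLE cs p.1 (demProd dem p.2)}) :
    Prop :=
  match a, b with
  | none, _ => True
  | some _, none => False
  | some p, some q => BruhatLE cs q.1.1 p.1.1 ∧ seqLE cs p.1.2 q.1.2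

section Roots

variable {B W : Type} [Group W] {M : CoxeterMatrix B}

/-- Gram matrix of the simple roots, extended by one extra vector pairing to `1/2` with each. -/
def gram (M : CoxeterMatrix B) : Option B → Option B → ℝ
  | some i, some j => -Real.cos (Real.pi / M i j)
  | none, none => 0
  | _, _ => 1 / 2

lemma gram_symm (a b : Option B) : gram M a b = gram M b a := by
  cases a <;> cases b <;> simp [gram, M.symmetric _ _]

def form (M : CoxeterMatrix B) : (Option B →₀ ℝ) →ₗ[ℝ] (Option B →₀ ℝ) →ₗ[ℝ] ℝ :=
  Finsupp.linearCombination ℝ fun a => Finsupp.linearCombination ℝ (gram M a)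

abbrev sroot (i : B) : Option B →₀ ℝ := Finsupp.single (some i) 1

abbrev rhoVec : Option B →₀ ℝ := Finsupp.single none 1

lemma form_single (a b : Option B) (x y : ℝ) :
    form M (Finsupp.single a x) (Finsupp.single b y) = x * y * gram M a b := by
  simp [form, mul_assoc]

lemma form_symm (v w : Option B →₀ ℝ) : form M v w = form M w v := by
  induction v using Finsupp.induction_linear with
  | zero => simp
  | add f g hf hg => simp [hf, hg]
  | single a x =>
    induction w using Finsupp.induction_linear with
    | zero => simp
    | add f g hf hg => simp [hf, hg]
    | single b y => rw [form_single, form_single, gram_symm]; ring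

lemma form_sroot_self (i : B) : form M (sroot i) (sroot i) = 1 := by
  simp [form_single, gram]

/-- The reflection attached to a vector. -/
def refl (M : CoxeterMatrix B) (β : Option B →₀ ℝ) : Module.End ℝ (Option B →₀ ℝ) :=
  LinearMap.id - ((2 : ℝ) • form M β).smulRight β

lemma refl_apply (β v : Option B →₀ ℝ) : refl M β v = v - (2 * form M β v) • β := by
  simp [refl]

lemma form_refl {β : Option B →₀ ℝ} (h : form M β β = 1) (v w : Option B →₀ ℝ) :
    form M (refl M β v) (refl M β w) = form M v w := by
  simp only [refl_apply, map_sub, map_smul, LinearMap.sub_apply, LinearMap.smul_apply, smul_eq_mul,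
    h, form_symm v β]
  ring

/-- The sequence `sin (kθ) / sin θ` with `2 cos θ = c`. -/
def cheb (c : ℝ) : ℕ → ℝ
  | 0 => 0
  | 1 => 1
  | k + 2 => c * cheb c (k + 1) - cheb c k

lemma cheb_mul_sin (θ : ℝ) (k : ℕ) :
    cheb (2 * Real.cos θ) k * Real.sin θ = Real.sin (k * θ) := by
  induction k using Nat.twoStepInduction with
  | zero => simp [cheb]
  | one => simp [cheb]
  | more k h1 h2 =>
    have e1 : ((k + 2 : ℕ) : ℝ) * θ = (k + 1 : ℕ) * θ + θ := by push_cast; ring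
    have e2 : (k : ℝ) * θ = (k + 1 : ℕ) * θ - θ := by push_cast; ring
    rw [e2, Real.sin_sub] at h1
    rw [e1, Real.sin_add, ← h2, cheb]
    have : cheb (2 * Real.cos θ) (k + 2) = 2 * Real.cos θ * cheb (2 * Real.cos θ) (k + 1) -
      cheb (2 * Real.cos θ) k := rfl
    rw [sub_mul, h1, ← h2]
    ring

lemma cheb_two (k : ℕ) : cheb 2 k = k := by
  induction k using Nat.twoStepInduction with
  | zero => simp [cheb]
  | one => simp [cheb]
  | more k h1 h2 => rw [cheb, h1, h2]; push_cast; ring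

lemma refl_sroot (i j : B) :
    refl M (sroot i) (sroot j) = sroot j + (2 * Real.cos (Real.pi / M i j)) • sroot i := by
  rw [refl_apply, form_single]; simp [gram, sub_eq_add_neg]

lemma refl_sroot_self (i : B) : refl M (sroot i) (sroot i) = - sroot i := by
  rw [refl_apply, form_sroot_self]; module

lemma refl_mul_refl_pow_sroot (i j : B) (k : ℕ) :
    ((refl M (sroot i) * refl M (sroot j)) ^ k) (sroot i) =
      cheb (2 * Real.cos (Real.pi / M i j)) (2 * k + 1) • sroot i +
      cheb (2 * Real.cos (Real.pi / M i j)) (2 * k) • sroot j := by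
  induction k with
  | zero => simp [cheb]
  | succ k ih =>
    rw [pow_succ', Module.End.mul_apply, ih, Module.End.mul_apply]
    rw [map_add, map_smul, map_smul, refl_sroot_self, refl_sroot, M.symmetric j i]
    rw [show 2 * (k + 1) + 1 = 2 * k + 3 from rfl, show 2 * (k + 1) = 2 * k + 2 from rfl, cheb, cheb]
    simp only [map_add, map_smul, map_neg, refl_sroot_self, refl_sroot i j]
    module

lemma two_le_of_ne {i j : B} (hij : i ≠ j) (h : M i j ≠ 0) : 2 ≤ M i j := by
  have := M.off_diagonal i j hij; omega

lemma sin_pos_of_ne {i j : B} (hij : i ≠ j) (h : M i j ≠ 0) : 0 < Real.sin (Real.pi / M i j) := by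
  have h2 : (2 : ℝ) ≤ M i j := by exact_mod_cast two_le_of_ne hij h
  apply Real.sin_pos_of_pos_of_lt_pi
  · positivity
  · rw [div_lt_iff₀ (by linarith)]; nlinarith [Real.pi_pos]

lemma refl_mul_refl_pow_sroot_eq {i j : B} (hij : i ≠ j) (h : M i j ≠ 0) :
    ((refl M (sroot i) * refl M (sroot j)) ^ M i j) (sroot i) = sroot i := by
  rw [refl_mul_refl_pow_sroot]
  have hs := sin_pos_of_ne hij h
  have hm : (M i j : ℝ) ≠ 0 := by exact_mod_cast h
  have h1 : cheb (2 * Real.cos (Real.pi / M i j)) (2 * M i j + 1) = 1 := by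
    have := cheb_mul_sin (Real.pi / M i j) (2 * M i j + 1)
    rw [show ((2 * M i j + 1 : ℕ) : ℝ) * (Real.pi / M i j) = Real.pi / M i j + 2 * Real.pi by
      push_cast; field_simp; ring, Real.sin_add_two_pi] at this
    exact mul_right_cancel₀ hs.ne' (by rw [this, one_mul])
  have h0 : cheb (2 * Real.cos (Real.pi / M i j)) (2 * M i j) = 0 := by
    have := cheb_mul_sin (Real.pi / M i j) (2 * M i j)
    rw [show ((2 * M i j : ℕ) : ℝ) * (Real.pi / M i j) = 2 * Real.pi by
      push_cast; field_simp, Real.sin_two_pi] at this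
    exact (mul_eq_zero.mp this).resolve_right hs.ne'
  rw [h1, h0]; simp

lemma refl_mul_self {β : Option B →₀ ℝ} (h : form M β β = 1) : refl M β * refl M β = 1 := by
  refine LinearMap.ext fun v => ?_
  simp only [Module.End.mul_apply, refl_apply, map_sub, map_smul, h, Module.End.one_apply]
  module

lemma refl_isLiftable : M.IsLiftable fun i => refl M (sroot i) := by
  intro i j
  by_cases hij : i = j
  · subst hij
    rw [refl_mul_self (form_sroot_self i), one_pow]
  by_cases h : M i j = 0
  · rw [h, pow_zero]
  have hi := refl_mul_refl_pow_sroot_eq hij h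
  have hj := refl_mul_refl_pow_sroot_eq (Ne.symm hij) (by rwa [M.symmetric j i])
  rw [M.symmetric j i] at hj
  have hinv : (refl M (sroot i) * refl M (sroot j)) ^ M i j *
      (refl M (sroot j) * refl M (sroot i)) ^ M i j = 1 := by
    have h1 : (refl M (sroot i) * refl M (sroot j)) * (refl M (sroot j) * refl M (sroot i)) = 1 := by
      rw [mul_assoc, ← mul_assoc (refl M (sroot j)), refl_mul_self (form_sroot_self j), one_mul,
        refl_mul_self (form_sroot_self i)]
    have h2 : (refl M (sroot j) * refl M (sroot i)) * (refl M (sroot i) * refl M (sroot j)) = 1 := by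
      rw [mul_assoc, ← mul_assoc (refl M (sroot i)), refl_mul_self (form_sroot_self i), one_mul,
        refl_mul_self (form_sroot_self j)]
    rw [← (show Commute _ _ from h1.trans h2.symm).mul_pow, h1, one_pow]
  have hj' : ((refl M (sroot i) * refl M (sroot j)) ^ M i j) (sroot j) = sroot j := by
    have := congrArg (fun f : Module.End ℝ (Option B →₀ ℝ) => f (sroot j)) hinv
    simp only [Module.End.mul_apply, hj, Module.End.one_apply] at this
    exact this
  refine LinearMap.ext fun v => ?_
  set c := Real.cos (Real.pi / M i j) with hc
  have hs := sin_pos_of_ne hij h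
  have hd : 1 - c ^ 2 ≠ 0 := by
    have := Real.sin_sq_add_cos_sq (Real.pi / M i j)
    rw [← hc] at this
    nlinarith
  have hg : form M (sroot i) (sroot j) = -c := by simp [form_single, gram, hc]
  have hg' : form M (sroot j) (sroot i) = -c := by rw [form_symm, hg]
  obtain ⟨a, ha⟩ : ∃ a, a = (form M (sroot i) v + c * form M (sroot j) v) / (1 - c ^ 2) := ⟨_, rfl⟩
  obtain ⟨b, hb⟩ : ∃ b, b = (form M (sroot j) v + c * form M (sroot i) v) / (1 - c ^ 2) := ⟨_, rfl⟩
  obtain ⟨u, hu⟩ : ∃ u, u = v - a • sroot i - b • sroot j := ⟨_, rfl⟩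
  have hui : form M (sroot i) u = 0 := by
    rw [hu, map_sub, map_sub, map_smul, map_smul, form_sroot_self, hg, ha, hb]
    simp only [smul_eq_mul]; field_simp; ring
  have huj : form M (sroot j) u = 0 := by
    rw [hu, map_sub, map_sub, map_smul, map_smul, form_sroot_self, hg', ha, hb]
    simp only [smul_eq_mul]; field_simp; ring
  have hfix : ∀ k : ℕ, ((refl M (sroot i) * refl M (sroot j)) ^ k) u = u := by
    intro k
    induction k with
    | zero => simp
    | succ k ih => rw [pow_succ', Module.End.mul_apply, ih, Module.End.mul_apply, refl_apply _ u, huj]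
                   simp [refl_apply, hui]
  have hv : v = u + a • sroot i + b • sroot j := by rw [hu]; module
  rw [hv, map_add, map_add, map_smul, map_smul, hfix, hi, hj']
  simp

variable (cs : CoxeterSystem M W)

/-- The geometric representation. -/
def rep : W →* Module.End ℝ (Option B →₀ ℝ) := cs.lift ⟨_, refl_isLiftable⟩

lemma rep_simple (i : B) : rep cs (cs.simple i) = refl M (sroot i) :=
  cs.lift_apply_simple refl_isLiftable i

lemma rep_mul_apply (x y : W) (v) : rep cs (x * y) v = rep cs x (rep cs y v) := by
  rw [map_mul, Module.End.mul_apply]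

@[simp] lemma rep_inv_rep (x : W) (v) : rep cs x⁻¹ (rep cs x v) = v := by
  rw [← rep_mul_apply]; simp

@[simp] lemma rep_rep_inv (x : W) (v) : rep cs x (rep cs x⁻¹ v) = v := by
  rw [← rep_mul_apply]; simp

lemma form_rep (w : W) (v v') : form M (rep cs w v) (rep cs w v') = form M v v' := by
  induction w using cs.simple_induction_left with
  | one => simp
  | mul_simple_left w i ih =>
    rw [rep_mul_apply, rep_mul_apply, rep_simple, form_refl (form_sroot_self i), ih]

lemma rep_apply_none (w : W) (v) : rep cs w v none = v none := by
  induction w using cs.simple_induction_left with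
  | one => simp
  | mul_simple_left w i ih =>
    rw [rep_mul_apply, rep_simple, refl_apply]
    simp [ih]

lemma rep_alternatingWord (i j : B) (k : ℕ) :
    rep cs (cs.wordProd (CoxeterSystem.alternatingWord i j k)) (sroot i) =
      if Even k then cheb (2 * Real.cos (Real.pi / M i j)) (k + 1) • sroot i +
        cheb (2 * Real.cos (Real.pi / M i j)) k • sroot j
      else cheb (2 * Real.cos (Real.pi / M i j)) k • sroot i +
        cheb (2 * Real.cos (Real.pi / M i j)) (k + 1) • sroot j := by
  induction k with
  | zero => simp [cheb, CoxeterSystem.alternatingWord]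
  | succ k ih =>
    rw [CoxeterSystem.alternatingWord_succ', cs.wordProd_cons, rep_mul_apply, ih, rep_simple]
    by_cases hk : Even k
    · have hk' : ¬ Even (k + 1) := by simpa [Nat.even_add_one] using hk
      simp only [hk, hk', if_true, if_false, map_add, map_smul, refl_sroot j i,
        refl_sroot_self, M.symmetric j i]
      rw [cheb]; module
    · have hk' : Even (k + 1) := by simpa [Nat.even_add_one] using hk
      simp only [hk, hk', if_true, if_false, map_add, map_smul, refl_sroot i j,
        refl_sroot_self]
      rw [cheb]; module

lemma cheb_nonneg {i j : B} (hij : i ≠ j) {k : ℕ} (hk : M i j = 0 ∨ k ≤ M i j) :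
    0 ≤ cheb (2 * Real.cos (Real.pi / M i j)) k := by
  by_cases h : M i j = 0
  · rw [h]; simp [cheb_two]
  have hk := hk.resolve_left h
  have hs := sin_pos_of_ne hij h
  have hm : (0 : ℝ) < M i j := by exact_mod_cast Nat.pos_of_ne_zero h
  refine nonneg_of_mul_nonneg_left ?_ hs
  rw [cheb_mul_sin]
  apply Real.sin_nonneg_of_nonneg_of_le_pi
  · positivity
  · rw [← mul_div_assoc, div_le_iff₀ hm, mul_comm]
    exact mul_le_mul_of_nonneg_left (by exact_mod_cast hk) Real.pi_pos.le

lemma sroot_nonneg (i : B) : (0 : Option B →₀ ℝ) ≤ sroot i :=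
  Finsupp.single_nonneg.mpr zero_le_one

/-- Factor off a maximal alternating word in two given letters. -/
lemma exists_alternating_factor {w : W} {i j : B} (hi : ¬ cs.IsRightDescent w i)
    (hj : cs.IsRightDescent w j) :
    ∃ v k, w = v * cs.wordProd (CoxeterSystem.alternatingWord i j k) ∧
      cs.length v < cs.length w ∧ ¬ cs.IsRightDescent v i ∧ ¬ cs.IsRightDescent v j ∧
      (M i j = 0 ∨ k + 1 ≤ M i j) := by
  classical
  let P : ℕ → Prop := fun k => ∃ v, w = v * cs.wordProd (CoxeterSystem.alternatingWord i j k) ∧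
    cs.length w = cs.length v + k
  have hP1 : P 1 := by
    refine ⟨w * cs.simple j, ?_, ?_⟩
    · simp [CoxeterSystem.alternatingWord]
    · rw [cs.isRightDescent_iff] at hj; omega
  have hb : ∀ k, P k → k ≤ cs.length w := by rintro k ⟨v, -, h⟩; omega
  set K := Nat.findGreatest P (cs.length w) with hK
  have hPK : P K := Nat.findGreatest_spec (hb 1 hP1) hP1
  have hK1 : 1 ≤ K := Nat.le_findGreatest (hb 1 hP1) hP1
  have hmax : ¬ P (K + 1) := fun h => by
    have := Nat.le_findGreatest (hb _ h) h
    omega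
  obtain ⟨v, hv, hl⟩ := hPK
  have hlen : ∀ a b : B, ∀ n, cs.length (cs.wordProd (CoxeterSystem.alternatingWord a b n)) ≤ n := by
    intro a b n
    have := cs.length_wordProd_le (CoxeterSystem.alternatingWord a b n)
    rwa [CoxeterSystem.length_alternatingWord] at this
  -- the next letter is not a descent, by maximality
  have hnext : ¬ cs.IsRightDescent v (if Even K then j else i) := by
    intro hd
    rw [cs.isRightDescent_iff] at hd
    refine hmax ⟨v * cs.simple (if Even K then j else i), ?_, by omega⟩
    rw [CoxeterSystem.alternatingWord_succ', cs.wordProd_cons, hv]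
    simp [mul_assoc]
  -- the first letter is not a descent, by length additivity
  have hfirst : ¬ cs.IsRightDescent v (if Even K then i else j) := by
    intro hd
    rw [cs.isRightDescent_iff] at hd
    obtain ⟨n, hn⟩ : ∃ n, K = n + 1 := ⟨K - 1, by omega⟩
    have e : (if Even K then i else j) = (if Even n then j else i) := by
      rw [hn]; by_cases h : Even n <;> simp [Nat.even_add_one, h]
    have : w = v * cs.simple (if Even K then i else j) *
        cs.wordProd (CoxeterSystem.alternatingWord i j n) := by
      rw [hv, hn, CoxeterSystem.alternatingWord_succ', cs.wordProd_cons, ← hn, e, mul_assoc]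
    have h2 := cs.length_mul_le (v * cs.simple (if Even K then i else j))
      (cs.wordProd (CoxeterSystem.alternatingWord i j n))
    rw [← this] at h2
    have := hlen i j n
    omega
  refine ⟨v, K, hv, by omega, ?_, ?_, ?_⟩
  · by_cases h : Even K
    · simpa [h] using hfirst
    · simpa [h] using hnext
  · by_cases h : Even K
    · simpa [h] using hnext
    · simpa [h] using hfirst
  · by_contra hcon
    push Not at hcon
    obtain ⟨hm, hlt⟩ := hcon
    have hKm : M i j ≤ K := by omega
    -- take the last `M i j` letters
    have hdrop : ∀ d n : ℕ, ∃ x : W, cs.length x ≤ d ∧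
        cs.wordProd (CoxeterSystem.alternatingWord i j (d + n)) =
          x * cs.wordProd (CoxeterSystem.alternatingWord i j n) := by
      intro d n
      induction d with
      | zero => exact ⟨1, by simp, by simp⟩
      | succ d ih =>
        obtain ⟨x, hx, he⟩ := ih
        refine ⟨cs.simple (if Even (d + n) then j else i) * x, ?_, ?_⟩
        · have := cs.length_mul_le (cs.simple (if Even (d + n) then j else i)) x
          rw [cs.length_simple] at this; omega
        · rw [show d + 1 + n = d + n + 1 by omega, CoxeterSystem.alternatingWord_succ',
            cs.wordProd_cons, he, mul_assoc]
    obtain ⟨x, hx, he⟩ := hdrop (K - M i j) (M i j)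
    rw [Nat.sub_add_cancel hKm] at he
    have hb := cs.wordProd_braidWord_eq i j
    rw [CoxeterSystem.braidWord, CoxeterSystem.braidWord, M.symmetric j i] at hb
    obtain ⟨n, hn⟩ : ∃ n, M i j = n + 1 := ⟨M i j - 1, by omega⟩
    apply hi
    have : w * cs.simple i = v * x * cs.wordProd (CoxeterSystem.alternatingWord i j n) := by
      rw [hv, he, hb, hn, CoxeterSystem.alternatingWord_succ, cs.wordProd_concat]
      simp [mul_assoc]
    rw [CoxeterSystem.IsRightDescent, this]
    have h1 := cs.length_mul_le (v * x) (cs.wordProd (CoxeterSystem.alternatingWord i j n))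
    have h2 := cs.length_mul_le v x
    have h3 := hlen i j n
    omega

theorem rep_sroot_nonneg {w : W} {i : B} (h : ¬ cs.IsRightDescent w i) :
    0 ≤ rep cs w (sroot i) := by
  induction hn : cs.length w using Nat.strong_induction_on generalizing w i with
  | _ n ih =>
    by_cases hw : w = 1
    · subst hw; simp
    obtain ⟨j, hj⟩ := cs.exists_rightDescent_of_ne_one hw
    have hij : i ≠ j := by rintro rfl; exact h hj
    obtain ⟨v, k, hv, hl, hvi, hvj, hk⟩ := exists_alternating_factor cs h hj
    have h1 := ih _ (hn ▸ hl) hvi rfl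
    have h2 := ih _ (hn ▸ hl) hvj rfl
    have c1 := cheb_nonneg hij hk
    have c2 : 0 ≤ cheb (2 * Real.cos (Real.pi / M i j)) k :=
      cheb_nonneg hij (hk.imp_right fun h => by omega)
    rw [hv, rep_mul_apply, rep_alternatingWord]
    split_ifs <;>
    · rw [map_add, map_smul, map_smul]
      exact add_nonneg (smul_nonneg (by assumption) h1) (smul_nonneg (by assumption) h2)

end Roots

section Roots2

variable {B W : Type} [Group W] {M : CoxeterMatrix B} (cs : CoxeterSystem M W)

def IsRoot (v : Option B →₀ ℝ) : Prop := ∃ w i, v = rep cs w (sroot i)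

variable {cs}

lemma IsRoot.rep {v} (h : IsRoot cs v) (w : W) : IsRoot cs (rep cs w v) := by
  obtain ⟨x, i, rfl⟩ := h
  exact ⟨w * x, i, by rw [rep_mul_apply]⟩

lemma IsRoot.form_self {v} (h : IsRoot cs v) : form M v v = 1 := by
  obtain ⟨x, i, rfl⟩ := h
  rw [form_rep, form_sroot_self]

lemma IsRoot.ne_zero {v} (h : IsRoot cs v) : v ≠ 0 := by
  rintro rfl
  simpa using h.form_self

lemma IsRoot.none_eq {v} (h : IsRoot cs v) : v none = 0 := by
  obtain ⟨x, i, rfl⟩ := h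
  rw [rep_apply_none]; simp

variable (cs)

lemma rep_sroot_nonpos {w : W} {i : B} (h : cs.IsRightDescent w i) :
    rep cs w (sroot i) ≤ 0 := by
  have := rep_sroot_nonneg cs (cs.isRightDescent_iff_not_isRightDescent_mul.mp h)
  rw [rep_mul_apply, rep_simple, refl_sroot_self, map_neg] at this
  simpa using this

variable {cs}

lemma IsRoot.nonneg_or {v} (h : IsRoot cs v) : 0 ≤ v ∨ v ≤ 0 := by
  obtain ⟨w, i, rfl⟩ := h
  by_cases hd : cs.IsRightDescent w i
  · exact Or.inr (rep_sroot_nonpos cs hd)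
  · exact Or.inl (rep_sroot_nonneg cs hd)

lemma IsRoot.not_nonpos {v} (h : IsRoot cs v) (h0 : 0 ≤ v) : ¬ v ≤ 0 :=
  fun h1 => h.ne_zero (le_antisymm h1 h0)

lemma IsRoot.not_nonneg_iff {v} (h : IsRoot cs v) : ¬ 0 ≤ v ↔ v ≤ 0 :=
  ⟨fun h1 => h.nonneg_or.resolve_left h1, fun h1 h0 => h.not_nonpos h0 h1⟩

lemma IsRoot.not_nonpos_iff {v} (h : IsRoot cs v) : ¬ v ≤ 0 ↔ 0 ≤ v :=
  ⟨fun h1 => h.nonneg_or.resolve_right h1, h.not_nonpos⟩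

lemma isRoot_sroot (i : B) : IsRoot cs (sroot i) := ⟨1, i, by simp⟩

variable (cs)

lemma rep_injective {x y : W} (h : rep cs x = rep cs y) : x = y := by
  rw [← inv_mul_eq_one]
  by_contra hne
  obtain ⟨i, hi⟩ := cs.exists_rightDescent_of_ne_one hne
  have h1 := rep_sroot_nonpos cs hi
  rw [rep_mul_apply, ← h, rep_inv_rep] at h1
  exact (isRoot_sroot (cs := cs) i).not_nonpos (sroot_nonneg i) h1

lemma form_rep_left (w : W) (v v') : form M (rep cs w v) v' = form M v (rep cs w⁻¹ v') := by
  rw [← form_rep cs w v, rep_rep_inv]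

lemma refl_rep (w : W) (v) : refl M (rep cs w v) = rep cs w * refl M v * rep cs w⁻¹ := by
  refine LinearMap.ext fun u => ?_
  simp only [Module.End.mul_apply, refl_apply, map_sub, map_smul, rep_rep_inv, form_rep_left]

lemma refl_rep_sroot (w : W) (i : B) :
    refl M (rep cs w (sroot i)) = rep cs (w * cs.simple i * w⁻¹) := by
  rw [refl_rep, map_mul, map_mul, rep_simple]

lemma refl_neg (v : Option B →₀ ℝ) : refl M (-v) = refl M v := by
  refine LinearMap.ext fun u => ?_
  simp [refl_apply]

@[simp] lemma rep_simple_simple (i : B) (v) :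
    rep cs (cs.simple i) (rep cs (cs.simple i) v) = v := by
  rw [← rep_mul_apply]; simp

lemma IsRoot.neg {v} (h : IsRoot cs v) : IsRoot cs (-v) := by
  obtain ⟨w, i, rfl⟩ := h
  refine ⟨w * cs.simple i, i, ?_⟩
  rw [rep_mul_apply, rep_simple, refl_sroot_self, map_neg]

lemma exists_rt {t : W} (ht : cs.IsReflection t) :
    ∃ β, IsRoot cs β ∧ 0 ≤ β ∧ rep cs t = refl M β := by
  obtain ⟨w, i, rfl⟩ := ht
  have h : IsRoot cs (rep cs w (sroot i)) := ⟨w, i, rfl⟩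
  rcases h.nonneg_or with h0 | h0
  · exact ⟨_, h, h0, (refl_rep_sroot cs w i).symm⟩
  · exact ⟨_, h.neg, by simpa using h0, by rw [refl_neg, refl_rep_sroot]⟩

open Classical in
/-- The positive root of a reflection. -/
def rt (t : W) : Option B →₀ ℝ := if h : cs.IsReflection t then (exists_rt cs h).choose else 0

variable {cs} {t : W} (ht : cs.IsReflection t)
include ht

lemma rt_spec : IsRoot cs (rt cs t) ∧ 0 ≤ rt cs t ∧ rep cs t = refl M (rt cs t) := by
  rw [rt, dif_pos ht]; exact (exists_rt cs ht).choose_spec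

lemma rt_isRoot : IsRoot cs (rt cs t) := (rt_spec ht).1
lemma rt_nonneg : 0 ≤ rt cs t := (rt_spec ht).2.1
lemma rep_refl_apply (v) : rep cs t v = v - (2 * form M (rt cs t) v) • rt cs t := by
  rw [(rt_spec ht).2.2, refl_apply]

lemma rep_rt_self : rep cs t (rt cs t) = - rt cs t := by
  rw [rep_refl_apply ht, (rt_isRoot ht).form_self]; module

omit ht

lemma eq_of_refl_eq {β γ : Option B →₀ ℝ} (hβ : IsRoot cs β) (hγ : IsRoot cs γ) (hβ0 : 0 ≤ β)
    (hγ0 : 0 ≤ γ) (h : refl M β = refl M γ) : β = γ := by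
  have h1 := congrArg (fun f : Module.End ℝ (Option B →₀ ℝ) => f β) h
  simp only [refl_apply, hβ.form_self] at h1
  have h2 : β = form M γ β • γ := by
    have : (2 : ℝ) • β = (2 : ℝ) • (form M γ β • γ) := by
      rw [smul_smul]
      have : (2 * 1 : ℝ) • β = (2 * form M γ β) • γ := sub_right_injective h1
      simpa using this
    exact smul_right_injective _ (two_ne_zero (α := ℝ)) this
  set c := form M γ β
  have h3 : c * c = 1 := by
    have := hβ.form_self
    rw [h2] at this
    simpa [hγ.form_self] using this
  rcases mul_self_eq_one_iff.mp h3 with h4 | h4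
  · rw [h2, h4, one_smul]
  · rw [h4] at h2
    exact absurd (by rw [h2]; simpa using hγ0) (hβ.not_nonpos hβ0)

lemma eq_rt {β} (hβ : IsRoot cs β) (h0 : 0 ≤ β) {t : W} (h : rep cs t = refl M β)
    (ht : cs.IsReflection t) : rt cs t = β :=
  eq_of_refl_eq (rt_isRoot ht) hβ (rt_nonneg ht) h0 (by rw [← (rt_spec ht).2.2, h])

lemma rt_injective {t u : W} (ht : cs.IsReflection t) (hu : cs.IsReflection u)
    (h : rt cs t = rt cs u) : t = u :=
  rep_injective cs (by rw [(rt_spec ht).2.2, (rt_spec hu).2.2, h])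

lemma rt_simple (i : B) : rt cs (cs.simple i) = sroot i :=
  eq_rt (isRoot_sroot i) (sroot_nonneg i) (rep_simple cs i) (cs.isReflection_simple i)

lemma rt_conj_of_nonneg {t : W} (ht : cs.IsReflection t) {w : W} (h : 0 ≤ rep cs w (rt cs t)) :
    rt cs (w * t * w⁻¹) = rep cs w (rt cs t) :=
  eq_rt ((rt_isRoot ht).rep w) h
    (by rw [refl_rep, map_mul, map_mul, (rt_spec ht).2.2]) (ht.conj w)

lemma rt_conj_of_nonpos {t : W} (ht : cs.IsReflection t) {w : W} (h : rep cs w (rt cs t) ≤ 0) :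
    rt cs (w * t * w⁻¹) = - rep cs w (rt cs t) :=
  eq_rt (((rt_isRoot ht).rep w).neg) (by simpa using h)
    (by rw [refl_neg, refl_rep, map_mul, map_mul, (rt_spec ht).2.2]) (ht.conj w)

lemma rep_simple_rt_nonneg {t : W} (ht : cs.IsReflection t) {i : B} (h : t ≠ cs.simple i) :
    0 ≤ rep cs (cs.simple i) (rt cs t) := by
  have hr := rt_isRoot ht
  by_contra hn
  rw [(hr.rep _).not_nonneg_iff, rep_simple, refl_apply] at hn
  have h0 := rt_nonneg ht
  set c := 2 * form M (sroot i) (rt cs t)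
  have hz : ∀ a, a ≠ some i → rt cs t a = 0 := by
    intro a ha
    have h1 := hn a
    have h2 := h0 a
    simp [Ne.symm ha] at h1 h2
    exact le_antisymm h1 h2
  have he : rt cs t = (rt cs t (some i)) • sroot i := by
    ext a
    by_cases ha : a = some i
    · subst ha; simp
    · rw [hz a ha]; simp [Ne.symm ha]
  have h1 := hr.form_self
  rw [he] at h1
  simp only [map_smul, LinearMap.smul_apply, form_sroot_self, smul_eq_mul, mul_one] at h1
  have h2 : rt cs t (some i) = 1 := by
    have := h0 (some i)
    simp only [Finsupp.coe_zero, Pi.zero_apply] at this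
    nlinarith
  rw [h2, one_smul] at he
  exact h (rt_injective ht (cs.isReflection_simple i) (he.trans (rt_simple i).symm))

lemma rt_simple_conj {t : W} (ht : cs.IsReflection t) {i : B} (h : t ≠ cs.simple i) :
    rt cs (cs.simple i * t * cs.simple i) = rep cs (cs.simple i) (rt cs t) := by
  have := rt_conj_of_nonneg ht (rep_simple_rt_nonneg ht h)
  rwa [cs.inv_simple] at this

lemma length_lt_of_rep_inv_nonpos {t : W} (ht : cs.IsReflection t) {w : W}
    (h : rep cs w⁻¹ (rt cs t) ≤ 0) : cs.length (t * w) < cs.length w := by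
  induction hn : cs.length w generalizing w t with
  | zero =>
    rw [cs.length_eq_zero_iff] at hn
    subst hn
    exact absurd (by simpa using h) ((rt_isRoot ht).not_nonpos (rt_nonneg ht))
  | succ n ih =>
    have hw : w ≠ 1 := by rintro rfl; simp at hn
    obtain ⟨i, hi⟩ := cs.exists_leftDescent_of_ne_one hw
    by_cases hti : t = cs.simple i
    · rw [hti, ← hn]; exact hi
    have hl : cs.length (cs.simple i * w) = n := by rw [cs.isLeftDescent_iff] at hi; omega
    have hc : cs.IsReflection (cs.simple i * t * cs.simple i) := by
      have := ht.conj (cs.simple i); rwa [cs.inv_simple] at this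
    have := ih (w := cs.simple i * w) hc (by
      rw [rt_simple_conj ht hti, mul_inv_rev, cs.inv_simple, rep_mul_apply, rep_simple_simple]
      exact h) hl
    have h2 := cs.length_mul_le (cs.simple i) (cs.simple i * t * cs.simple i * (cs.simple i * w))
    rw [cs.length_simple, show cs.simple i * (cs.simple i * t * cs.simple i * (cs.simple i * w)) =
      t * w by simp [mul_assoc]] at h2
    omega

lemma length_refl_mul_lt_iff {t : W} (ht : cs.IsReflection t) {w : W} :
    cs.length (t * w) < cs.length w ↔ rep cs w⁻¹ (rt cs t) ≤ 0 := by
  refine ⟨fun h => ?_, length_lt_of_rep_inv_nonpos ht⟩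
  by_contra hn
  rw [((rt_isRoot ht).rep _).not_nonpos_iff] at hn
  have := length_lt_of_rep_inv_nonpos ht (w := t * w) (by
    rw [mul_inv_rev, rep_mul_apply, ht.inv, rep_rt_self ht, map_neg]; simpa using hn)
  rw [← mul_assoc, ht.mul_self, one_mul] at this
  omega

lemma lt_length_refl_mul_iff {t : W} (ht : cs.IsReflection t) {w : W} :
    cs.length w < cs.length (t * w) ↔ 0 ≤ rep cs w⁻¹ (rt cs t) := by
  rw [← ((rt_isRoot ht).rep _).not_nonpos_iff, ← length_refl_mul_lt_iff ht]
  have := ht.length_mul_right_ne w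
  omega

end Roots2

section Height

variable {B W : Type} [Group W] {M : CoxeterMatrix B} {cs : CoxeterSystem M W}

variable (M) in
/-- Height: the functional with value `1` on each simple root. -/
def hgt (v : Option B →₀ ℝ) : ℝ := 2 * form M rhoVec v

lemma hgt_neg (v : Option B →₀ ℝ) : hgt M (-v) = - hgt M v := by simp [hgt]
lemma hgt_add (v w : Option B →₀ ℝ) : hgt M (v + w) = hgt M v + hgt M w := by simp [hgt, mul_add]
lemma hgt_smul (c : ℝ) (v : Option B →₀ ℝ) : hgt M (c • v) = c * hgt M v := by simp [hgt]; ring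

lemma hgt_nonneg {v : Option B →₀ ℝ} (h : 0 ≤ v) : 0 ≤ hgt M v := by
  have : form M rhoVec v = v.sum fun a x => x * gram M none a := by
    simp [form, Finsupp.linearCombination_apply, Finsupp.sum]
  rw [hgt, this]
  refine mul_nonneg zero_le_two (Finset.sum_nonneg fun a _ => mul_nonneg (h a) ?_)
  cases a <;> simp [gram]

lemma hgt_pos {v : Option B →₀ ℝ} (h : 0 ≤ v) (h0 : v none = 0) (hv : v ≠ 0) : 0 < hgt M v := by
  obtain ⟨a, ha⟩ := Finsupp.ne_iff.mp hv
  obtain ⟨i, rfl⟩ : ∃ i, a = some i := by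
    cases a with
    | none => exact absurd h0 ha
    | some i => exact ⟨i, rfl⟩
  have h1 : 0 < v (some i) := lt_of_le_of_ne (h _) (Ne.symm ha)
  have e : v = (v - v (some i) • sroot i) + v (some i) • sroot i := by module
  rw [e, hgt_add, hgt_smul]
  have : 0 ≤ hgt M (v - v (some i) • sroot i) := by
    apply hgt_nonneg
    intro b
    by_cases hb : b = some i
    · subst hb; simp
    · simpa [Finsupp.single_apply, Ne.symm hb] using h b
  have h2 : hgt M (sroot i) = 1 := by simp [hgt, form_single, gram]
  rw [h2]; linarith

lemma IsRoot.hgt_pos {v} (h : IsRoot cs v) (h0 : 0 ≤ v) : 0 < hgt M v :=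
  TotPos.hgt_pos h0 h.none_eq h.ne_zero

lemma rt_hgt_pos {t : W} (h : cs.IsReflection t) : 0 < hgt M (rt cs t) :=
  (rt_isRoot h).hgt_pos (rt_nonneg h)

/-- Going up along a reflection moves `ρ` by a positive multiple of the root. -/
lemma rep_rho_sub {t : W} (h : cs.IsReflection t) (x : W) :
    rep cs x rhoVec - rep cs (t * x) rhoVec = hgt M (rep cs x⁻¹ (rt cs t)) • rt cs t := by
  rw [rep_mul_apply, rep_refl_apply h, sub_sub_cancel, form_symm, form_rep_left, hgt]

end Height

section Bruhat

variable {B W : Type} [Group W] {M : CoxeterMatrix B} (cs : CoxeterSystem M W)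

/-- An edge of the Bruhat graph, going up. -/
def Edge (x y : W) : Prop := ∃ t, cs.IsReflection t ∧ y = t * x ∧ cs.length x < cs.length y

/-- The Bruhat order as the closure of the Bruhat graph. -/
def Br : W → W → Prop := Relation.ReflTransGen (Edge cs)

variable {cs}

lemma Br.refl (x : W) : Br cs x x := Relation.ReflTransGen.refl
lemma Br.trans {x y z : W} (h : Br cs x y) (h' : Br cs y z) : Br cs x z :=
  Relation.ReflTransGen.trans h h'
lemma Edge.br {x y : W} (h : Edge cs x y) : Br cs x y := Relation.ReflTransGen.single h

lemma Br.length_le {x y : W} (h : Br cs x y) : cs.length x ≤ cs.length y := by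
  induction h with
  | refl => rfl
  | tail _ h ih => obtain ⟨t, -, -, hl⟩ := h; omega

lemma Br.eq_of_length_le {x y : W} (h : Br cs x y) (hl : cs.length y ≤ cs.length x) : x = y := by
  cases h with
  | refl => rfl
  | tail h1 h2 =>
    have := Br.length_le h1
    obtain ⟨t, -, -, hl'⟩ := h2; omega

lemma Br.antisymm {x y : W} (h : Br cs x y) (h' : Br cs y x) : x = y :=
  h.eq_of_length_le h'.length_le

lemma Br.length_lt {x y : W} (h : Br cs x y) (hne : x ≠ y) : cs.length x < cs.length y := by
  by_contra hl
  exact hne (h.eq_of_length_le (not_lt.mp hl))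

lemma Br.one (w : W) : Br cs 1 w := by
  induction hn : cs.length w generalizing w with
  | zero => rw [cs.length_eq_zero_iff] at hn; rw [hn]; exact Br.refl _
  | succ n ih =>
    have hw : w ≠ 1 := by rintro rfl; simp at hn
    obtain ⟨i, hi⟩ := cs.exists_leftDescent_of_ne_one hw
    have hl := cs.isLeftDescent_iff.mp hi
    refine (ih (cs.simple i * w) (by omega)).trans (Edge.br ⟨cs.simple i, cs.isReflection_simple i, ?_, hi⟩)
    simp

lemma edge_simple_mul {x : W} {i : B} (h : cs.length x < cs.length (cs.simple i * x)) :
    Edge cs x (cs.simple i * x) := ⟨_, cs.isReflection_simple i, rfl, h⟩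

lemma edge_simple_mul' {x : W} {i : B} (h : cs.length (cs.simple i * x) < cs.length x) :
    Edge cs (cs.simple i * x) x := ⟨_, cs.isReflection_simple i, by simp, h⟩

lemma simple_conj_isReflection {t : W} (h : cs.IsReflection t) (i : B) :
    cs.IsReflection (cs.simple i * t * cs.simple i) := by
  have := h.conj (cs.simple i); rwa [cs.inv_simple] at this

/-- Left multiplication by `s` preserves edges with label different from `s`. -/
lemma length_simple_mul_lt {x t : W} (ht : cs.IsReflection t) {i : B} (hti : t ≠ cs.simple i)
    (h : cs.length x < cs.length (t * x)) :
    cs.length (cs.simple i * x) < cs.length (cs.simple i * (t * x)) := by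
  have e : cs.simple i * (t * x) = cs.simple i * t * cs.simple i * (cs.simple i * x) := by
    simp [mul_assoc]
  rw [e, lt_length_refl_mul_iff (simple_conj_isReflection ht i), rt_simple_conj ht hti,
    mul_inv_rev, cs.inv_simple, rep_mul_apply, rep_simple_simple]
  rwa [lt_length_refl_mul_iff ht] at h

lemma edge_simple_mul_of_ne {x t : W} (ht : cs.IsReflection t) {i : B} (hti : t ≠ cs.simple i)
    (h : cs.length x < cs.length (t * x)) :
    Edge cs (cs.simple i * x) (cs.simple i * (t * x)) :=
  ⟨_, simple_conj_isReflection ht i, by simp [mul_assoc], length_simple_mul_lt ht hti h⟩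

variable (cs)

open Classical in
/-- The smaller of `x` and `s x`. -/
def mn (i : B) (x : W) : W := if cs.IsLeftDescent x i then cs.simple i * x else x

open Classical in
/-- The larger of `x` and `s x`. -/
def mx (i : B) (x : W) : W := if cs.IsLeftDescent x i then x else cs.simple i * x

variable {cs}

lemma mn_of {i : B} {x : W} (h : cs.IsLeftDescent x i) : mn cs i x = cs.simple i * x := if_pos h
lemma mn_of_not {i : B} {x : W} (h : ¬ cs.IsLeftDescent x i) : mn cs i x = x := if_neg h
lemma mx_of {i : B} {x : W} (h : cs.IsLeftDescent x i) : mx cs i x = x := if_pos h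
lemma mx_of_not {i : B} {x : W} (h : ¬ cs.IsLeftDescent x i) : mx cs i x = cs.simple i * x :=
  if_neg h

lemma not_isLeftDescent_simple_mul {i : B} {x : W} (h : cs.IsLeftDescent x i) :
    ¬ cs.IsLeftDescent (cs.simple i * x) i := cs.isLeftDescent_iff_not_isLeftDescent_mul.mp h

lemma isLeftDescent_simple_mul {i : B} {x : W} (h : ¬ cs.IsLeftDescent x i) :
    cs.IsLeftDescent (cs.simple i * x) i := by
  by_contra h'
  exact h (cs.isLeftDescent_iff_not_isLeftDescent_mul.mpr h')

lemma lt_length_simple_mul {i : B} {x : W} (h : ¬ cs.IsLeftDescent x i) :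
    cs.length x < cs.length (cs.simple i * x) := by
  rw [cs.not_isLeftDescent_iff] at h; omega

lemma mn_br (i : B) (x : W) : Br cs (mn cs i x) x := by
  by_cases h : cs.IsLeftDescent x i
  · rw [mn_of h]; exact (edge_simple_mul' h).br
  · rw [mn_of_not h]; exact Br.refl _

lemma mn_br' (i : B) (x : W) : Br cs (mn cs i x) (cs.simple i * x) := by
  by_cases h : cs.IsLeftDescent x i
  · rw [mn_of h]; exact Br.refl _
  · rw [mn_of_not h]; exact (edge_simple_mul (lt_length_simple_mul h)).br

lemma br_mx (i : B) (x : W) : Br cs x (mx cs i x) := by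
  by_cases h : cs.IsLeftDescent x i
  · rw [mx_of h]; exact Br.refl _
  · rw [mx_of_not h]; exact (edge_simple_mul (lt_length_simple_mul h)).br

lemma br_mx' (i : B) (x : W) : Br cs (cs.simple i * x) (mx cs i x) := by
  by_cases h : cs.IsLeftDescent x i
  · rw [mx_of h]; exact (edge_simple_mul' h).br
  · rw [mx_of_not h]; exact Br.refl _

lemma mn_simple_mul (i : B) (x : W) : mn cs i (cs.simple i * x) = mn cs i x := by
  by_cases h : cs.IsLeftDescent x i
  · rw [mn_of h, mn_of_not (not_isLeftDescent_simple_mul h)]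
  · rw [mn_of_not h, mn_of (isLeftDescent_simple_mul h)]; simp

lemma mx_simple_mul (i : B) (x : W) : mx cs i (cs.simple i * x) = mx cs i x := by
  by_cases h : cs.IsLeftDescent x i
  · rw [mx_of h, mx_of_not (not_isLeftDescent_simple_mul h)]; simp
  · rw [mx_of_not h, mx_of (isLeftDescent_simple_mul h)]

lemma Br.mn {x y : W} (h : Br cs x y) (i : B) : Br cs (mn cs i x) (mn cs i y) := by
  induction h with
  | refl => exact Br.refl _
  | tail _ h ih =>
    refine ih.trans ?_
    rename_i y z _
    obtain ⟨t, ht, rfl, hl⟩ := h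
    by_cases hti : t = cs.simple i
    · rw [hti, mn_simple_mul]; exact Br.refl _
    by_cases hd : cs.IsLeftDescent (t * y) i
    · rw [mn_of hd]; exact (mn_br' i y).trans (edge_simple_mul_of_ne ht hti hl).br
    · rw [mn_of_not hd]; exact (mn_br i y).trans (Edge.br ⟨t, ht, rfl, hl⟩)

lemma Br.mx {x y : W} (h : Br cs x y) (i : B) : Br cs (mx cs i x) (mx cs i y) := by
  induction h with
  | refl => exact Br.refl _
  | tail _ h ih =>
    refine ih.trans ?_
    rename_i y z _
    obtain ⟨t, ht, rfl, hl⟩ := h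
    by_cases hti : t = cs.simple i
    · rw [hti, mx_simple_mul]; exact Br.refl _
    by_cases hd : cs.IsLeftDescent y i
    · rw [mx_of hd]; exact (Edge.br ⟨t, ht, rfl, hl⟩ : Br cs _ _).trans (br_mx i _)
    · rw [mx_of_not hd]; exact (edge_simple_mul_of_ne ht hti hl).br.trans (br_mx' i _)

lemma isReduced_cons {i : B} {ω : List B} (h : cs.IsReduced (i :: ω)) :
    cs.IsReduced ω ∧ ¬ cs.IsLeftDescent (cs.wordProd ω) i := by
  have h1 : cs.IsReduced ω := by simpa using h.drop 1
  refine ⟨h1, ?_⟩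
  rw [cs.not_isLeftDescent_iff, ← cs.wordProd_cons, h.eq, h1.eq, List.length_cons]

lemma isReduced_cons_of {i : B} {ω : List B} (h : cs.IsReduced ω)
    (h' : ¬ cs.IsLeftDescent (cs.wordProd ω) i) : cs.IsReduced (i :: ω) := by
  rw [cs.not_isLeftDescent_iff] at h'
  rw [CoxeterSystem.IsReduced, cs.wordProd_cons, h', h.eq, List.length_cons]

/-- The subword property. -/
lemma Br.exists_sublist {ω : List B} (hω : cs.IsReduced ω) {u : W} (h : Br cs u (cs.wordProd ω)) :
    ∃ σ : List B, σ.Sublist ω ∧ cs.IsReduced σ ∧ cs.wordProd σ = u := by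
  induction ω generalizing u with
  | nil =>
    have : u = 1 := h.antisymm (by simpa using Br.one u)
    exact ⟨[], List.Sublist.refl _, hω, by simp [this]⟩
  | cons i ω ih =>
    obtain ⟨h1, h2⟩ := isReduced_cons hω
    have h3 := h.mn i
    rw [cs.wordProd_cons, mn_simple_mul, mn_of_not h2] at h3
    obtain ⟨σ, hσ, hr, hp⟩ := ih h1 h3
    by_cases hd : cs.IsLeftDescent u i
    · rw [mn_of hd] at hp
      refine ⟨i :: σ, hσ.cons_cons i, isReduced_cons_of hr ?_, ?_⟩
      · rw [hp]; exact not_isLeftDescent_simple_mul hd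
      · rw [cs.wordProd_cons, hp]; simp
    · rw [mn_of_not hd] at hp
      exact ⟨σ, hσ.cons i, hr, hp⟩

lemma br_of_sublist {ω σ : List B} (hω : cs.IsReduced ω) (h : σ.Sublist ω) :
    Br cs (cs.wordProd σ) (cs.wordProd ω) := by
  induction h with
  | slnil => exact Br.refl _
  | cons i h ih =>
    obtain ⟨h1, -⟩ := isReduced_cons hω
    refine (ih h1).trans ?_
    rw [cs.wordProd_cons]
    exact (edge_simple_mul (lt_length_simple_mul (isReduced_cons hω).2)).br
  | cons_cons i h ih =>
    obtain ⟨h1, h2⟩ := isReduced_cons hω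
    rw [cs.wordProd_cons, cs.wordProd_cons, ← mx_of_not h2]
    exact (br_mx' i _).trans ((ih h1).mx i)

theorem bruhatLE_iff {v w : W} : BruhatLE cs v w ↔ Br cs v w := by
  constructor
  · rintro ⟨ω, hω, rfl, σ, hσ, rfl⟩
    exact br_of_sublist hω hσ
  · intro h
    obtain ⟨ω, hω, rfl⟩ := cs.exists_isReduced w
    obtain ⟨σ, hσ, -, hp⟩ := h.exists_sublist hω
    exact ⟨ω, hω, rfl, σ, hσ, hp⟩

end Bruhat

section Demazure

variable {B W : Type} [Group W] {M : CoxeterMatrix B} {cs : CoxeterSystem M W}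
  {dem : W → W → W} (hd : IsDemazure cs dem)
include hd

lemma IsDemazure.one_left (y : W) : dem 1 y = y := by
  rw [hd.eq_mul 1 y (by simp), one_mul]

lemma IsDemazure.one_right (x : W) : dem x 1 = x := by
  rw [hd.eq_mul x 1 (by simp), mul_one]

lemma IsDemazure.simple (i : B) (w : W) : dem (cs.simple i) w = mx cs i w := by
  by_cases h : cs.IsLeftDescent w i
  · rw [mx_of h]; exact hd.absorb i w h
  · rw [mx_of_not h]
    apply hd.eq_mul
    rw [cs.not_isLeftDescent_iff] at h
    rw [h, cs.length_simple, add_comm]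

lemma IsDemazure.wordProd {ω : List B} (hω : cs.IsReduced ω) (y : W) :
    dem (cs.wordProd ω) y = ω.foldr (mx cs) y := by
  induction ω with
  | nil => simp [hd.one_left]
  | cons i ω ih =>
    obtain ⟨h1, h2⟩ := isReduced_cons hω
    rw [List.foldr_cons, ← ih h1, ← hd.simple, ← hd.assoc, hd.simple, mx_of_not h2,
      cs.wordProd_cons]

omit hd in
lemma foldr_mx_br {ω σ : List B} (h : σ.Sublist ω) {y y' : W} (hy : Br cs y' y) :
    Br cs (σ.foldr (mx cs) y') (ω.foldr (mx cs) y) := by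
  induction h with
  | slnil => exact hy
  | cons i h ih => exact ih.trans (br_mx i _)
  | cons_cons i h ih => exact ih.mx i

lemma IsDemazure.mono {x x' y y' : W} (hx : Br cs x' x) (hy : Br cs y' y) :
    Br cs (dem x' y') (dem x y) := by
  obtain ⟨ω, hω, rfl⟩ := cs.exists_isReduced x
  obtain ⟨σ, hσ, hσr, rfl⟩ := hx.exists_sublist hω
  rw [hd.wordProd hω, hd.wordProd hσr]
  exact foldr_mx_br hσ hy

lemma IsDemazure.mul_br_dem (x y : W) : Br cs (x * y) (dem x y) := by
  obtain ⟨ω, hω, rfl⟩ := cs.exists_isReduced x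
  rw [hd.wordProd hω]
  clear hω
  induction ω with
  | nil => simpa using Br.refl y
  | cons i ω ih =>
    rw [cs.wordProd_cons, mul_assoc]
    exact (br_mx' i _).trans (ih.mx i)

/-- The Demazure product is a length-additive product with a smaller right factor. -/
lemma IsDemazure.exists_right (x y : W) : ∃ y', Br cs y' y ∧ dem x y = x * y' ∧
    cs.length (dem x y) = cs.length x + cs.length y' := by
  induction hn : cs.length x generalizing x with
  | zero =>
    rw [cs.length_eq_zero_iff] at hn
    subst hn
    exact ⟨y, Br.refl y, by simp [hd.one_left], by simp [hd.one_left]⟩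
  | succ n ih =>
    have hw : x ≠ 1 := by rintro rfl; simp at hn
    obtain ⟨i, hi⟩ := cs.exists_leftDescent_of_ne_one hw
    obtain ⟨x', rfl⟩ : ∃ x', x = cs.simple i * x' := ⟨cs.simple i * x, by simp⟩
    have hi' : ¬ cs.IsLeftDescent x' i := by
      have := not_isLeftDescent_simple_mul hi
      simpa using this
    have hl := cs.not_isLeftDescent_iff.mp hi'
    obtain ⟨y', hy', he, hlen⟩ := ih x' (by omega)
    have hdem : dem (cs.simple i * x') y = mx cs i (dem x' y) := by
      rw [← hd.simple, ← hd.assoc, hd.simple, mx_of_not hi']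
    rw [hdem]
    by_cases hc : cs.IsLeftDescent (dem x' y) i
    · rw [mx_of hc]
      have hr : cs.IsReflection (x'⁻¹ * cs.simple i * x'⁻¹⁻¹) := (cs.isReflection_simple i).conj _
      have hpos : 0 ≤ rep cs x'⁻¹ (sroot i) := by
        apply rep_sroot_nonneg
        rwa [← cs.isLeftDescent_inv_iff, inv_inv]
      have hrt : rt cs (x'⁻¹ * cs.simple i * x'⁻¹⁻¹) = rep cs x'⁻¹ (sroot i) := by
        rw [rt_conj_of_nonneg (cs.isReflection_simple i) (by rwa [rt_simple]), rt_simple]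
      have hlt : cs.length (x'⁻¹ * cs.simple i * x'⁻¹⁻¹ * y') < cs.length y' := by
        rw [length_refl_mul_lt_iff hr, hrt, ← rep_mul_apply, ← mul_inv_rev, ← he, ← rt_simple (cs := cs) i,
          ← length_refl_mul_lt_iff (cs.isReflection_simple i)]
        exact hc
      have hmul : dem x' y = cs.simple i * x' * (x'⁻¹ * cs.simple i * x'⁻¹⁻¹ * y') := by
        rw [he]; simp [mul_assoc]
      refine ⟨_, Br.trans (Edge.br ⟨_, hr, ?_, hlt⟩) hy', hmul, ?_⟩
      · rw [← mul_assoc, hr.mul_self, one_mul]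
      · have := cs.length_mul_le (cs.simple i * x') (x'⁻¹ * cs.simple i * x'⁻¹⁻¹ * y')
        rw [← hmul] at this
        omega
    · refine ⟨y', hy', by rw [mx_of_not hc, he, mul_assoc], ?_⟩
      rw [mx_of_not hc, cs.not_isLeftDescent_iff.mp hc]
      omega

end Demazure

section RefOrder

variable {B W : Type} [Group W] {M : CoxeterMatrix B} (cs : CoxeterSystem M W)

/-- A reflection order: a total order on reflections for which positive combinations of two
roots lie between them. -/
structure RefOrder (r : W → W → Prop) : Prop where
  irrefl : ∀ {t}, cs.IsReflection t → ¬ r t t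
  trans : ∀ {t u v}, cs.IsReflection t → cs.IsReflection u → cs.IsReflection v →
    r t u → r u v → r t v
  total : ∀ {t u}, cs.IsReflection t → cs.IsReflection u → t ≠ u → r t u ∨ r u t
  conv : ∀ {t u v}, cs.IsReflection t → cs.IsReflection u → cs.IsReflection v → r t v →
    ∀ {a b : ℝ}, 0 < a → 0 < b → rt cs u = a • rt cs t + b • rt cs v → r t u ∧ r u v

variable {cs} {r : W → W → Prop}

lemma RefOrder.asymm (hr : RefOrder cs r) {t u : W} (ht : cs.IsReflection t)
    (hu : cs.IsReflection u) (h : r t u) : ¬ r u t :=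
  fun h' => hr.irrefl ht (hr.trans ht hu ht h h')

lemma RefOrder.swap (hr : RefOrder cs r) : RefOrder cs (fun t u => r u t) where
  irrefl := hr.irrefl
  trans ht hu hv h h' := hr.trans hv hu ht h' h
  total ht hu hne := (hr.total ht hu hne).symm
  conv ht hu hv h _ _ ha hb he :=
    (hr.conv hv hu ht h hb ha (by rw [he, add_comm])).symm

lemma rt_simple_conj_eq {t : W} (ht : cs.IsReflection t) {i : B} (h : t ≠ cs.simple i) :
    rt cs (cs.simple i * t * cs.simple i) =
      rt cs t - (2 * form M (sroot i) (rt cs t)) • sroot i := by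
  rw [rt_simple_conj ht h, rep_simple, refl_apply]

lemma simple_conj_ne {t : W} {i : B} (h : t ≠ cs.simple i) :
    cs.simple i * t * cs.simple i ≠ cs.simple i := by
  intro h'
  apply h
  have := congrArg (fun x => cs.simple i * x * cs.simple i) h'
  simpa [mul_assoc] using this

lemma simple_conj_conj (t : W) (i : B) :
    cs.simple i * (cs.simple i * t * cs.simple i) * cs.simple i = t := by simp [mul_assoc]

/-- The initial segment below a simple reflection is stable under conjugation by it. -/
lemma RefOrder.conj_lt (hr : RefOrder cs r) {t : W} (ht : cs.IsReflection t) {i : B}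
    (h : r t (cs.simple i)) : r (cs.simple i * t * cs.simple i) (cs.simple i) := by
  have hs := cs.isReflection_simple i
  have hne : t ≠ cs.simple i := by rintro rfl; exact hr.irrefl hs h
  have ht' := simple_conj_isReflection ht i
  have he := rt_simple_conj_eq ht hne
  rcases lt_trichotomy (2 * form M (sroot i) (rt cs t)) 0 with hc | hc | hc
  · exact (hr.conv ht ht' hs h one_pos (neg_pos.mpr hc)
      (by rw [he, rt_simple]; module)).2
  · rw [hc, zero_smul, sub_zero] at he
    rwa [rt_injective ht' ht he]
  · by_contra hn
    have h1 := (hr.total ht' hs (simple_conj_ne hne)).resolve_left hn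
    have h2 := (hr.conv (t := cs.simple i) (u := t) hs ht ht' h1 hc one_pos
      (by rw [he, rt_simple]; module)).1
    exact hr.asymm ht hs h h2

lemma RefOrder.conj_gt (hr : RefOrder cs r) {t : W} (ht : cs.IsReflection t) {i : B}
    (h : r (cs.simple i) t) : r (cs.simple i) (cs.simple i * t * cs.simple i) :=
  hr.swap.conj_lt ht h

/-- The upper conjugate of an order by a simple reflection `s`: `s` is moved to the front and the
initial segment before `s` is conjugated. -/
def upperConj (r : W → W → Prop) (s t u : W) : Prop :=
  (t = s ∧ u ≠ s) ∨ (t ≠ s ∧ u ≠ s ∧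
    ((r t s ∧ r u s ∧ r (s * t * s) (s * u * s)) ∨ (r t s ∧ r s u) ∨ (r s t ∧ r s u ∧ r t u)))

lemma RefOrder.upperConj (hr : RefOrder cs r) (i : B) :
    RefOrder cs (upperConj r (cs.simple i)) := by
  have hs := cs.isReflection_simple i
  have hne1 : ∀ {t}, r t (cs.simple i) → t ≠ cs.simple i := by
    rintro t h rfl; exact hr.irrefl hs h
  have hne2 : ∀ {t}, r (cs.simple i) t → t ≠ cs.simple i := by
    rintro t h rfl; exact hr.irrefl hs h
  refine ⟨?_, ?_, ?_, ?_⟩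
  · rintro t ht (⟨h1, h2⟩ | ⟨h1, h2, (⟨h3, h4, h5⟩ | ⟨h3, h4⟩ | ⟨h3, h4, h5⟩)⟩)
    · exact h2 h1
    · exact hr.irrefl (simple_conj_isReflection ht i) h5
    · exact hr.asymm ht hs h3 h4
    · exact hr.irrefl ht h5
  · intro t u v ht hu hv
    have ht' := simple_conj_isReflection ht i
    have hu' := simple_conj_isReflection hu i
    have hv' := simple_conj_isReflection hv i
    rintro (⟨h1, h2⟩ | ⟨h1, h2, (⟨h3, h4, h5⟩ | ⟨h3, h4⟩ | ⟨h3, h4, h5⟩)⟩)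
      (⟨k1, k2⟩ | ⟨k1, k2, (⟨k3, k4, k5⟩ | ⟨k3, k4⟩ | ⟨k3, k4, k5⟩)⟩)
    · exact absurd k1 h2
    · exact Or.inl ⟨h1, k2⟩
    · exact Or.inl ⟨h1, k2⟩
    · exact Or.inl ⟨h1, k2⟩
    · exact absurd k1 h2
    · exact Or.inr ⟨h1, k2, Or.inl ⟨h3, k4, hr.trans ht' hu' hv' h5 k5⟩⟩
    · exact Or.inr ⟨h1, k2, Or.inr (Or.inl ⟨h3, k4⟩)⟩
    · exact absurd k3 (hr.asymm hu hs h4)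
    · exact absurd k1 h2
    · exact absurd k3 (hr.asymm hs hu h4)
    · exact absurd k3 (hr.asymm hs hu h4)
    · exact Or.inr ⟨h1, k2, Or.inr (Or.inl ⟨h3, k4⟩)⟩
    · exact absurd k1 h2
    · exact absurd k3 (hr.asymm hs hu h4)
    · exact absurd k3 (hr.asymm hs hu h4)
    · exact Or.inr ⟨h1, k2, Or.inr (Or.inr ⟨h3, k4, hr.trans ht hu hv h5 k5⟩)⟩
  · intro t u ht hu hne
    have ht' := simple_conj_isReflection ht i
    have hu' := simple_conj_isReflection hu i
    by_cases h1 : t = cs.simple i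
    · exact Or.inl (Or.inl ⟨h1, fun h2 => hne (h1.trans h2.symm)⟩)
    by_cases h2 : u = cs.simple i
    · exact Or.inr (Or.inl ⟨h2, h1⟩)
    rcases hr.total ht hs h1 with h3 | h3 <;> rcases hr.total hu hs h2 with h4 | h4
    · have : cs.simple i * t * cs.simple i ≠ cs.simple i * u * cs.simple i := by
        intro h; exact hne (by simpa using h)
      rcases hr.total ht' hu' this with h | h
      · exact Or.inl (Or.inr ⟨h1, h2, Or.inl ⟨h3, h4, h⟩⟩)
      · exact Or.inr (Or.inr ⟨h2, h1, Or.inl ⟨h4, h3, h⟩⟩)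
    · exact Or.inl (Or.inr ⟨h1, h2, Or.inr (Or.inl ⟨h3, h4⟩)⟩)
    · exact Or.inr (Or.inr ⟨h2, h1, Or.inr (Or.inl ⟨h4, h3⟩)⟩)
    · rcases hr.total ht hu hne with h | h
      · exact Or.inl (Or.inr ⟨h1, h2, Or.inr (Or.inr ⟨h3, h4, h⟩)⟩)
      · exact Or.inr (Or.inr ⟨h2, h1, Or.inr (Or.inr ⟨h4, h3, h⟩)⟩)
  · intro t u v ht hu hv
    have ht' := simple_conj_isReflection ht i
    have hu' := simple_conj_isReflection hu i
    have hv' := simple_conj_isReflection hv i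
    rintro (⟨h1, h2⟩ | ⟨h1, h2, h⟩) a b ha hb he
    · subst h1
      rcases hr.total hv hs h2 with h3 | h3
      · obtain ⟨h4, h5⟩ := hr.conv hv hu hs h3 hb ha (by rw [he, add_comm])
        refine ⟨Or.inl ⟨rfl, hne1 h5⟩, Or.inr ⟨hne1 h5, h2, Or.inl ⟨h5, h3, ?_⟩⟩⟩
        refine (hr.conv hu' hv' hs (hr.conj_lt hu h5) (a := b⁻¹) (b := b⁻¹ * a)
          (by positivity) (by positivity) ?_).1
        rw [rt_simple_conj hu (hne1 h5), rt_simple_conj hv h2, he, map_add, map_smul, map_smul,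
          rt_simple, rep_simple, refl_sroot_self, smul_add, smul_smul, smul_smul,
          inv_mul_cancel₀ hb.ne']
        module
      · obtain ⟨h4, h5⟩ := hr.conv hs hu hv h3 ha hb he
        exact ⟨Or.inl ⟨rfl, hne2 h4⟩, Or.inr ⟨hne2 h4, h2, Or.inr (Or.inr ⟨h4, h3, h5⟩)⟩⟩
    · have hus : u ≠ cs.simple i := by
        rintro rfl
        have h3 := rep_simple_rt_nonneg ht h1
        have h4 := rep_simple_rt_nonneg hv h2
        have h5 : 0 ≤ rep cs (cs.simple i) (rt cs (cs.simple i)) := by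
          rw [he, map_add, map_smul, map_smul]
          exact add_nonneg (smul_nonneg ha.le h3) (smul_nonneg hb.le h4)
        rw [rt_simple, rep_simple, refl_sroot_self] at h5
        exact (isRoot_sroot (cs := cs) i).not_nonpos (sroot_nonneg i) (by simpa using h5)
      have he' : rt cs (cs.simple i * u * cs.simple i) =
          a • rt cs (cs.simple i * t * cs.simple i) + b • rt cs (cs.simple i * v * cs.simple i) := by
        rw [rt_simple_conj hu hus, rt_simple_conj ht h1, rt_simple_conj hv h2, he, map_add,
          map_smul, map_smul]
      rcases h with ⟨h3, h4, h5⟩ | ⟨h3, h4⟩ | ⟨h3, h4, h5⟩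
      · obtain ⟨h6, h7⟩ := hr.conv ht' hu' hv' h5 ha hb he'
        have h8 : r u (cs.simple i) := by
          have := hr.conj_lt hu' (hr.trans hu' hv' hs h7 (hr.conj_lt hv h4))
          rwa [simple_conj_conj] at this
        exact ⟨Or.inr ⟨h1, hus, Or.inl ⟨h3, h8, h6⟩⟩, Or.inr ⟨hus, h2, Or.inl ⟨h8, h4, h7⟩⟩⟩
      · rcases hr.total hu hs hus with h8 | h8
        · have := hr.conv ht' hu' hv' (hr.trans ht' hs hv' (hr.conj_lt ht h3) (hr.conj_gt hv h4))
            ha hb he'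
          exact ⟨Or.inr ⟨h1, hus, Or.inl ⟨h3, h8, this.1⟩⟩, Or.inr ⟨hus, h2, Or.inr (Or.inl ⟨h8, h4⟩)⟩⟩
        · have := hr.conv ht hu hv (hr.trans ht hs hv h3 h4) ha hb he
          exact ⟨Or.inr ⟨h1, hus, Or.inr (Or.inl ⟨h3, h8⟩)⟩,
            Or.inr ⟨hus, h2, Or.inr (Or.inr ⟨h8, h4, this.2⟩)⟩⟩
      · obtain ⟨h6, h7⟩ := hr.conv ht hu hv h5 ha hb he
        have h8 : r (cs.simple i) u := hr.trans hs ht hu h3 h6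
        exact ⟨Or.inr ⟨h1, hus, Or.inr (Or.inr ⟨h3, h8, h6⟩)⟩,
          Or.inr ⟨hus, h2, Or.inr (Or.inr ⟨h8, h4, h7⟩)⟩⟩

/-- For an order with `s` first, conjugate by `s` and put `s` last. -/
lemma RefOrder.lowerConj (hr : RefOrder cs r) (i : B) :
    RefOrder cs (fun t u => TotPos.upperConj (fun x y => r y x) (cs.simple i) u t) :=
  (hr.swap.upperConj i).swap

end RefOrder

section Paths

variable {B W : Type} [Group W] {M : CoxeterMatrix B} (cs : CoxeterSystem M W)

/-- `L` is the label sequence of a saturated chain from `u` up to `w`. -/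
def Path : W → List W → W → Prop
  | u, [], w => u = w
  | u, t :: L, w => cs.IsReflection t ∧ cs.length (t * u) = cs.length u + 1 ∧ Path (t * u) L w

variable {cs}

lemma path_append {u w : W} {L L' : List W} :
    Path cs u (L ++ L') w ↔ ∃ x, Path cs u L x ∧ Path cs x L' w := by
  induction L generalizing u with
  | nil => simp [Path]
  | cons t L ih => simp [Path, ih, and_assoc]

lemma Path.length_eq {u w : W} {L : List W} (h : Path cs u L w) :
    cs.length w = cs.length u + L.length := by
  induction L generalizing u with
  | nil => simp [Path] at h; simp [h]
  | cons t L ih => have := ih h.2.2; have := h.2.1; simp; omega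

lemma Path.br {u w : W} {L : List W} (h : Path cs u L w) : Br cs u w := by
  induction L generalizing u with
  | nil => simp [Path] at h; rw [h]; exact Br.refl _
  | cons t L ih =>
    exact (Edge.br ⟨t, h.1, rfl, by rw [h.2.1]; omega⟩ : Br cs u (t * u)).trans (ih h.2.2)

lemma Path.isReflection {u w : W} {L : List W} (h : Path cs u L w) :
    ∀ t ∈ L, cs.IsReflection t := by
  induction L generalizing u with
  | nil => simp
  | cons t L ih => simp [h.1]; exact ih h.2.2

lemma Path.left_unique {u u' w : W} {L : List W} (h : Path cs u L w) (h' : Path cs u' L w) :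
    u = u' := by
  induction L generalizing u u' with
  | nil => simp [Path] at h h'; rw [h, h']
  | cons t L ih => exact mul_left_cancel (ih h.2.2 h'.2.2)

lemma Path.conj_le {u w : W} {L : List W} (h : Path cs u L w) {i : B} (hi : cs.simple i ∉ L) :
    cs.length (cs.simple i * u) + L.length ≤ cs.length (cs.simple i * w) := by
  induction L generalizing u with
  | nil => simp [Path] at h; simp [h]
  | cons t L ih =>
    simp only [List.mem_cons, not_or] at hi
    have h1 := ih h.2.2 hi.2
    have h2 := length_simple_mul_lt h.1 (Ne.symm hi.1) (x := u) (by rw [h.2.1]; omega)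
    simp; omega

/-- Conjugating a path by a simple reflection that does not occur in it. -/
lemma Path.conj {u w : W} {L : List W} (h : Path cs u L w) {i : B} (hi : cs.simple i ∉ L)
    (hl : cs.length (cs.simple i * u) + L.length = cs.length (cs.simple i * w)) :
    Path cs (cs.simple i * u) (L.map fun t => cs.simple i * t * cs.simple i)
      (cs.simple i * w) := by
  induction L generalizing u with
  | nil => simp [Path] at h ⊢; exact h
  | cons t L ih =>
    simp only [List.mem_cons, not_or] at hi
    have h1 := h.2.2.conj_le hi.2
    have h2 := length_simple_mul_lt h.1 (Ne.symm hi.1) (x := u) (by rw [h.2.1]; omega)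
    simp only [List.length_cons] at hl
    have e : cs.simple i * t * cs.simple i * (cs.simple i * u) = cs.simple i * (t * u) := by
      simp [mul_assoc]
    refine ⟨simple_conj_isReflection h.1 i, ?_, ?_⟩
    · rw [e]; omega
    · rw [e]; exact ih h.2.2 hi.2 (by omega)

lemma not_mem_map_conj {L : List W} {i : B} (h : cs.simple i ∉ L) :
    cs.simple i ∉ L.map fun t => cs.simple i * t * cs.simple i := by
  intro h'
  obtain ⟨t, ht, he⟩ := List.mem_map.mp h'
  have : t ≠ cs.simple i := by rintro rfl; exact h ht
  exact simple_conj_ne this he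

lemma map_conj_injective (i : B) :
    Function.Injective (List.map fun t => cs.simple i * t * cs.simple i) :=
  List.map_injective_iff.mpr fun a b h => by simpa using h

end Paths

section Uniqueness

variable {B W : Type} [Group W] {M : CoxeterMatrix B} (cs : CoxeterSystem M W)

/-- `L` is the label sequence of an `r`-increasing saturated chain from `u` to `w`. -/
def Inc (r : W → W → Prop) (u : W) (L : List W) (w : W) : Prop :=
  Path cs u L w ∧ L.Pairwise r

/-- Every element below `w` has a unique `r`-increasing saturated chain to `w`. -/
def Uniq (r : W → W → Prop) (w : W) : Prop := ∀ u, Br cs u w → ∃! L, Inc cs r u L w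

variable {cs}

lemma exists_split {p : W → Prop} {R : W → W → Prop}
    (h : ∀ {t u}, cs.IsReflection t → cs.IsReflection u → R t u → p u → p t)
    {L : List W} (hL : ∀ t ∈ L, cs.IsReflection t) (hp : L.Pairwise R) :
    ∃ L₁ L₂, L = L₁ ++ L₂ ∧ (∀ t ∈ L₁, p t) ∧ ∀ t ∈ L₂, ¬ p t := by
  induction L with
  | nil => exact ⟨[], [], by simp⟩
  | cons t L ih =>
    rw [List.pairwise_cons] at hp
    by_cases ht : p t
    · obtain ⟨L₁, L₂, rfl, h1, h2⟩ := ih (fun u hu => hL u (List.mem_cons_of_mem _ hu)) hp.2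
      refine ⟨t :: L₁, L₂, rfl, ?_, h2⟩
      intro u hu
      rcases List.mem_cons.mp hu with rfl | hu
      · exact ht
      · exact h1 u hu
    · refine ⟨[], t :: L, rfl, by simp, ?_⟩
      intro u hu
      rcases List.mem_cons.mp hu with rfl | hu'
      · exact ht
      · exact fun hpu => ht (h (hL t List.mem_cons_self) (hL u hu) (hp.1 u hu') hpu)

omit [Group W] in
lemma split_unique {p : W → Prop} {L₁ L₂ K₁ K₂ : List W} (h : L₁ ++ L₂ = K₁ ++ K₂)
    (h1 : ∀ t ∈ L₁, p t) (h2 : ∀ t ∈ L₂, ¬ p t) (k1 : ∀ t ∈ K₁, p t) (k2 : ∀ t ∈ K₂, ¬ p t) :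
    L₁ = K₁ ∧ L₂ = K₂ := by
  induction L₁ generalizing K₁ with
  | nil =>
    cases K₁ with
    | nil => exact ⟨rfl, h⟩
    | cons t K₁ =>
      refine absurd (k1 t List.mem_cons_self) (h2 t ?_)
      rw [List.nil_append] at h; rw [h]; simp
  | cons t L₁ ih =>
    cases K₁ with
    | nil =>
      refine absurd (h1 t List.mem_cons_self) (k2 t ?_)
      rw [List.nil_append] at h; rw [← h]; simp
    | cons t' K₁ =>
      simp only [List.cons_append, List.cons.injEq] at h
      obtain ⟨rfl, h⟩ := h
      obtain ⟨rfl, rfl⟩ := ih h (fun u hu => h1 u (List.mem_cons_of_mem _ hu))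
        (fun u hu => k1 u (List.mem_cons_of_mem _ hu))
      exact ⟨rfl, rfl⟩

lemma exists_of_agree {p : W → Prop} {R R' : W → W → Prop}
    (hsplit : ∀ {t u}, cs.IsReflection t → cs.IsReflection u → R' t u → p u → p t)
    (hcross : ∀ {t u}, cs.IsReflection t → cs.IsReflection u → p t → ¬ p u → R t u)
    (hagree : ∀ {t u}, cs.IsReflection t → cs.IsReflection u → ¬ p t → ¬ p u → R' t u → R t u)
    {u y : W} (hU : Uniq cs R y) (hU' : Uniq cs R' y)
    (ih : ∀ x, cs.length x < cs.length y →
      (∃ L, Inc cs R' u L x ∧ ∀ t ∈ L, p t) → ∃ L, Inc cs R u L x ∧ ∀ t ∈ L, p t)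
    (h : ∃ L, Inc cs R u L y ∧ ∀ t ∈ L, p t) : ∃ L, Inc cs R' u L y ∧ ∀ t ∈ L, p t := by
  obtain ⟨L, hL, hLp⟩ := h
  obtain ⟨K, hK, -⟩ := hU' u hL.1.br
  obtain ⟨K₁, K₂, rfl, h1, h2⟩ := exists_split (cs := cs) hsplit hK.1.isReflection hK.2
  obtain ⟨x, hx1, hx2⟩ := path_append.mp hK.1
  have hpw := List.pairwise_append.mp hK.2
  rcases K₂ with _ | ⟨t, K₂⟩
  · exact ⟨_, hK, by simpa using h1⟩
  · exfalso
    obtain ⟨J, hJ, hJp⟩ := ih x (by have := hx2.length_eq; simp at this; omega)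
      ⟨K₁, ⟨hx1, hpw.1⟩, h1⟩
    have hJL : Inc cs R u (J ++ t :: K₂) y := by
      refine ⟨path_append.mpr ⟨x, hJ.1, hx2⟩, List.pairwise_append.mpr ⟨hJ.2, ?_, ?_⟩⟩
      · exact hpw.2.1.imp_of_mem fun ha hb hab =>
          hagree (hx2.isReflection _ ha) (hx2.isReflection _ hb) (h2 _ ha) (h2 _ hb) hab
      · intro a ha b hb
        exact hcross (hJ.1.isReflection _ ha) (hx2.isReflection _ hb) (hJp a ha) (h2 b hb)
    have := (hU u hL.1.br).unique hL hJL
    subst this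
    exact h2 t List.mem_cons_self (hLp t (by simp))

lemma Path.simple_mem {u w : W} {L : List W} (h : Path cs u L w) {i : B}
    (hu : ¬ cs.IsLeftDescent u i) (hw : cs.IsLeftDescent w i) : cs.simple i ∈ L := by
  by_contra hi
  have h1 := h.conj_le hi
  have h2 := h.length_eq
  rw [cs.not_isLeftDescent_iff] at hu
  rw [cs.isLeftDescent_iff] at hw
  omega

lemma path_simple_cons {u w : W} {L : List W} {i : B} (h : Path cs u (cs.simple i :: L) w) :
    ¬ cs.IsLeftDescent u i ∧ cs.IsLeftDescent (cs.simple i * u) i := by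
  have h1 : ¬ cs.IsLeftDescent u i := by
    rw [cs.not_isLeftDescent_iff]; exact h.2.1
  exact ⟨h1, isLeftDescent_simple_mul h1⟩

lemma path_concat_simple {u w : W} {L : List W} {i : B} (h : Path cs u (L ++ [cs.simple i]) w) :
    Path cs u L (cs.simple i * w) ∧ cs.IsLeftDescent w i := by
  obtain ⟨x, h1, h2⟩ := path_append.mp h
  obtain rfl : cs.simple i * x = w := h2.2.2
  exact ⟨by simpa using h1, (path_simple_cons h2).2⟩

lemma path_concat_simple_of {u w : W} {L : List W} {i : B} (h : Path cs u L (cs.simple i * w))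
    (hw : cs.IsLeftDescent w i) : Path cs u (L ++ [cs.simple i]) w := by
  refine path_append.mpr ⟨_, h, cs.isReflection_simple i, ?_, by simp [Path]⟩
  have := cs.isLeftDescent_iff.mp hw
  simp; omega

lemma eq_cons_of_first {R : W → W → Prop} (hr : RefOrder cs R) {i : B}
    (hf : ∀ {t}, cs.IsReflection t → t ≠ cs.simple i → R (cs.simple i) t) {L : List W}
    (hL : ∀ t ∈ L, cs.IsReflection t) (hp : L.Pairwise R) (hi : cs.simple i ∈ L) :
    ∃ L', L = cs.simple i :: L' ∧ cs.simple i ∉ L' := by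
  cases L with
  | nil => simp at hi
  | cons t L =>
    rw [List.pairwise_cons] at hp
    have ht := hL t List.mem_cons_self
    have hs := cs.isReflection_simple i
    by_cases hti : t = cs.simple i
    · subst hti
      exact ⟨L, rfl, fun h => hr.irrefl hs (hp.1 _ h)⟩
    · have h1 := hp.1 _ ((List.mem_cons.mp hi).resolve_left (Ne.symm hti))
      exact absurd (hf ht hti) (hr.asymm ht hs h1)

lemma eq_concat_of_last {R : W → W → Prop} (hr : RefOrder cs R) {i : B} {L : List W}
    (hf : ∀ t ∈ L, t ≠ cs.simple i → R t (cs.simple i))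
    (hL : ∀ t ∈ L, cs.IsReflection t) (hp : L.Pairwise R) (hi : cs.simple i ∈ L) :
    ∃ L', L = L' ++ [cs.simple i] ∧ cs.simple i ∉ L' := by
  have hs := cs.isReflection_simple i
  rcases L.eq_nil_or_concat' with rfl | ⟨L', t, rfl⟩
  · simp at hi
  · rw [List.pairwise_append] at hp
    by_cases hti : t = cs.simple i
    · subst hti
      exact ⟨L', rfl, fun h => hr.irrefl hs (hp.2.2 _ h _ (by simp))⟩
    · have h1 : cs.simple i ∈ L' := by simpa [Ne.symm hti] using hi
      have h2 := hp.2.2 _ h1 t (by simp)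
      exact absurd h2 (hr.asymm (hL t (by simp)) hs (hf t (by simp) hti))

lemma pairwise_map_conj {R R' : W → W → Prop} {i : B} {L : List W}
    (h : ∀ t ∈ L, ∀ u ∈ L, R t u →
      R' (cs.simple i * t * cs.simple i) (cs.simple i * u * cs.simple i))
    (hp : L.Pairwise R) : (L.map fun t => cs.simple i * t * cs.simple i).Pairwise R' :=
  List.pairwise_map.mpr (hp.imp_of_mem fun ha hb hab => h _ ha _ hb hab)

/-- Lifting of unique increasing chains when `s` comes first. -/
lemma uniq_of_first {r : W → W → Prop} (hr : RefOrder cs r) {i : B}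
    (hf : ∀ {t}, cs.IsReflection t → t ≠ cs.simple i → r (cs.simple i) t) {w : W}
    (hw : cs.IsLeftDescent w i) (ih : ∀ r', RefOrder cs r' → Uniq cs r' (cs.simple i * w)) :
    Uniq cs r w := by
  have hs := cs.isReflection_simple i
  have hwl := cs.isLeftDescent_iff.mp hw
  -- elements with `s` as a descent
  have key : ∀ u, Br cs u w → cs.IsLeftDescent u i → ∃! L, Inc cs r u L w := by
    intro u hu hd
    have hul := cs.isLeftDescent_iff.mp hd
    have hr' := hr.lowerConj i
    set r' := fun t u => upperConj (fun x y => r y x) (cs.simple i) u t with hr'def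
    have hbr : Br cs (cs.simple i * u) (cs.simple i * w) := by
      have := hu.mn i; rwa [mn_of hd, mn_of hw] at this
    have fwd : ∀ L, Inc cs r u L w →
        Inc cs r' (cs.simple i * u) (L.map fun t => cs.simple i * t * cs.simple i)
          (cs.simple i * w) := by
      intro L hL
      have hi : cs.simple i ∉ L := by
        intro hi
        obtain ⟨L', rfl, -⟩ := eq_cons_of_first hr hf hL.1.isReflection hL.2 hi
        exact (path_simple_cons hL.1).1 hd
      have hlen := hL.1.length_eq
      refine ⟨hL.1.conj hi (by omega), pairwise_map_conj ?_ hL.2⟩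
      intro t ht v hv htv
      have ht1 : t ≠ cs.simple i := by rintro rfl; exact hi ht
      have hv1 : v ≠ cs.simple i := by rintro rfl; exact hi hv
      have ht2 := hL.1.isReflection t ht
      have hv2 := hL.1.isReflection v hv
      refine Or.inr ⟨simple_conj_ne hv1, simple_conj_ne ht1, Or.inl
        ⟨hf (simple_conj_isReflection hv2 i) (simple_conj_ne hv1),
          hf (simple_conj_isReflection ht2 i) (simple_conj_ne ht1), ?_⟩⟩
      rwa [simple_conj_conj, simple_conj_conj]
    obtain ⟨L, hL, hLu⟩ := ih r' hr' _ hbr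
    have hi : cs.simple i ∉ L := by
      intro hi
      obtain ⟨L', rfl, -⟩ := eq_concat_of_last hr' (fun t _ h => Or.inl ⟨rfl, h⟩)
        hL.1.isReflection hL.2 hi
      exact not_isLeftDescent_simple_mul hw (path_concat_simple hL.1).2
    have hlen := hL.1.length_eq
    refine ⟨L.map fun t => cs.simple i * t * cs.simple i, ⟨?_, pairwise_map_conj ?_ hL.2⟩, ?_⟩
    · have := hL.1.conj hi (by simp; omega)
      simpa using this
    · intro t ht v hv htv
      have ht1 : t ≠ cs.simple i := by rintro rfl; exact hi ht
      have hv1 : v ≠ cs.simple i := by rintro rfl; exact hi hv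
      have ht2 := hL.1.isReflection t ht
      have hv2 := hL.1.isReflection v hv
      rcases htv with ⟨h, -⟩ | ⟨-, -, ⟨-, -, h⟩ | ⟨-, h⟩ | ⟨h, -, -⟩⟩
      · exact absurd h hv1
      · exact h
      · exact absurd (hf ht2 ht1) (hr.asymm ht2 hs h)
      · exact absurd (hf hv2 hv1) (hr.asymm hv2 hs h)
    · intro K hK
      have h1 := hLu _ (fwd K hK)
      rw [← h1, List.map_map]
      simp [Function.comp_def, mul_assoc]
  intro u hu
  by_cases hd : cs.IsLeftDescent u i
  · exact key u hu hd
  have hd' := isLeftDescent_simple_mul hd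
  have hbr : Br cs (cs.simple i * u) w := by
    have := hu.mx i; rwa [mx_of_not hd, mx_of hw] at this
  obtain ⟨L, hL, hLu⟩ := key _ hbr hd'
  have hi : cs.simple i ∉ L := by
    intro hi
    obtain ⟨L', rfl, -⟩ := eq_cons_of_first hr hf hL.1.isReflection hL.2 hi
    exact (path_simple_cons hL.1).1 hd'
  refine ⟨cs.simple i :: L, ⟨⟨hs, cs.not_isLeftDescent_iff.mp hd, hL.1⟩,
    List.pairwise_cons.mpr ⟨fun t ht => hf (hL.1.isReflection t ht) ?_, hL.2⟩⟩, ?_⟩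
  · rintro rfl; exact hi ht
  · intro K hK
    obtain ⟨K', rfl, -⟩ := eq_cons_of_first hr hf hK.1.isReflection hK.2 (hK.1.simple_mem hd hw)
    rw [hLu K' ⟨hK.1.2.2, (List.pairwise_cons.mp hK.2).2⟩]

variable (cs) in
/-- Comparison between increasing chains for `r` and its upper conjugate, with labels in the
initial segment ending in `s`. -/
def Compare (r : W → W → Prop) (s : W) (y : W) : Prop :=
  ∀ u, ((∃ L, Inc cs r u L y ∧ ∀ t ∈ L, ¬ r s t) ↔
      ∃ L, Inc cs (upperConj r s) u L y ∧ ∀ t ∈ L, ¬ r s t) ∧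
    ∀ L L', (Inc cs r u L y ∧ ∀ t ∈ L, ¬ r s t) → (Inc cs r u L' y ∧ ∀ t ∈ L', ¬ r s t) → L = L'

section
variable {r : W → W → Prop} (hr : RefOrder cs r) (i : B)
include hr

lemma not_lt_of_lt {t u : W} (ht : cs.IsReflection t) (hu : cs.IsReflection u) (h : r t u)
    (hp : ¬ r (cs.simple i) u) : ¬ r (cs.simple i) t :=
  fun h' => hp (hr.trans (cs.isReflection_simple i) ht hu h' h)

lemma not_lt_of_upperConj {t u : W} (ht : cs.IsReflection t)
    (h : upperConj r (cs.simple i) t u)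
    (hp : ¬ r (cs.simple i) u) : ¬ r (cs.simple i) t := by
  have hs := cs.isReflection_simple i
  rcases h with ⟨h, -⟩ | ⟨-, -, ⟨h, -, -⟩ | ⟨-, h⟩ | ⟨-, h, -⟩⟩
  · rw [h]; exact hr.irrefl hs
  · exact hr.asymm ht hs h
  · exact absurd h hp
  · exact absurd h hp

lemma lt_simple_of_not {t : W} (ht : cs.IsReflection t) (h1 : t ≠ cs.simple i)
    (h : ¬ r (cs.simple i) t) : r t (cs.simple i) :=
  (hr.total ht (cs.isReflection_simple i) h1).resolve_right h

lemma lt_of_cross {t u : W} (ht : cs.IsReflection t) (hu : cs.IsReflection u)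
    (h : ¬ r (cs.simple i) t) (h' : ¬ ¬ r (cs.simple i) u) : r t u := by
  rw [not_not] at h'
  by_cases h1 : t = cs.simple i
  · rwa [h1]
  · exact hr.trans ht (cs.isReflection_simple i) hu (lt_simple_of_not hr i ht h1 h) h'

lemma upperConj_of_cross {t u : W} (ht : cs.IsReflection t) (hu : cs.IsReflection u)
    (h : ¬ r (cs.simple i) t) (h' : ¬ ¬ r (cs.simple i) u) : upperConj r (cs.simple i) t u := by
  rw [not_not] at h'
  have h2 : u ≠ cs.simple i := by rintro rfl; exact hr.irrefl hu h'
  by_cases h1 : t = cs.simple i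
  · exact Or.inl ⟨h1, h2⟩
  · exact Or.inr ⟨h1, h2, Or.inr (Or.inl ⟨lt_simple_of_not hr i ht h1 h, h'⟩)⟩

lemma upperConj_iff_of_gt {t u : W} (ht : cs.IsReflection t) (hu : cs.IsReflection u)
    (h : ¬ ¬ r (cs.simple i) t) (h' : ¬ ¬ r (cs.simple i) u) :
    upperConj r (cs.simple i) t u ↔ r t u := by
  rw [not_not] at h h'
  have hs := cs.isReflection_simple i
  have h1 : t ≠ cs.simple i := by rintro rfl; exact hr.irrefl ht h
  have h2 : u ≠ cs.simple i := by rintro rfl; exact hr.irrefl hu h'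
  constructor
  · rintro (⟨h3, -⟩ | ⟨-, -, ⟨h3, -, -⟩ | ⟨h3, -⟩ | ⟨-, -, h3⟩⟩)
    · exact absurd h3 h1
    · exact absurd h3 (hr.asymm hs ht h)
    · exact absurd h3 (hr.asymm hs ht h)
    · exact h3
  · exact fun h3 => Or.inr ⟨h1, h2, Or.inr (Or.inr ⟨h, h', h3⟩)⟩

lemma upperConj_iff_of_lt {t u : W} (ht : cs.IsReflection t) (hu : cs.IsReflection u)
    (ht1 : t ≠ cs.simple i) (hu1 : u ≠ cs.simple i)
    (h : ¬ r (cs.simple i) t) (h' : ¬ r (cs.simple i) u) :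
    upperConj r (cs.simple i) t u ↔
      r (cs.simple i * t * cs.simple i) (cs.simple i * u * cs.simple i) := by
  constructor
  · rintro (⟨h3, -⟩ | ⟨-, -, ⟨-, -, h3⟩ | ⟨-, h3⟩ | ⟨h3, -, -⟩⟩)
    · exact absurd h3 ht1
    · exact h3
    · exact absurd h3 h'
    · exact absurd h3 h
  · exact fun h3 => Or.inr ⟨ht1, hu1, Or.inl ⟨lt_simple_of_not hr i ht ht1 h,
      lt_simple_of_not hr i hu hu1 h', h3⟩⟩

lemma not_lt_conj {t : W} (ht : cs.IsReflection t) (h : ¬ r (cs.simple i) t) :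
    ¬ r (cs.simple i) (cs.simple i * t * cs.simple i) := by
  intro h'
  have := hr.conj_gt (simple_conj_isReflection ht i) h'
  rw [simple_conj_conj] at this
  exact h this

lemma compare_of_uniq {y : W}
    (h : ∀ z, cs.length z ≤ cs.length y → Uniq cs r z ∧ Uniq cs (upperConj r (cs.simple i)) z) :
    Compare cs r (cs.simple i) y := by
  induction hn : cs.length y using Nat.strong_induction_on generalizing y with
  | _ n ih =>
    intro u
    have ih' : ∀ x, cs.length x < cs.length y → Compare cs r (cs.simple i) x :=
      fun x hx => ih _ (hn ▸ hx) (fun z hz => h z (by omega)) rfl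
    obtain ⟨h1, h2⟩ := h y le_rfl
    refine ⟨⟨?_, ?_⟩, fun L L' hL hL' => (h1 u hL.1.1.br).unique hL.1 hL'.1⟩
    · exact exists_of_agree (p := fun t => ¬ r (cs.simple i) t) (R := r)
        (R' := upperConj r (cs.simple i)) (fun ht _ => not_lt_of_upperConj hr i ht)
        (fun ht hu => lt_of_cross hr i ht hu)
        (fun ht hu ht' hu' => (upperConj_iff_of_gt hr i ht hu ht' hu').mp) h1 h2
        (fun x hx => (ih' x hx u).1.mpr)
    · exact exists_of_agree (p := fun t => ¬ r (cs.simple i) t)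
        (R := upperConj r (cs.simple i)) (R' := r) (fun ht hu => not_lt_of_lt hr i ht hu)
        (fun ht hu => upperConj_of_cross hr i ht hu)
        (fun ht hu ht' hu' => (upperConj_iff_of_gt hr i ht hu ht' hu').mpr) h2 h1
        (fun x hx => (ih' x hx u).1.mp)

/-- Conjugation exchanges the two kinds of increasing chains with labels before `s`. -/
lemma Inc.conj_upper {u w : W} {L : List W} (hL : Inc cs r u L w)
    (hLp : ∀ t ∈ L, ¬ r (cs.simple i) t) (hi : cs.simple i ∉ L)
    (hl : cs.length (cs.simple i * u) + L.length = cs.length (cs.simple i * w)) :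
    Inc cs (upperConj r (cs.simple i)) (cs.simple i * u)
      (L.map fun t => cs.simple i * t * cs.simple i) (cs.simple i * w) ∧
      ∀ t ∈ L.map (fun t => cs.simple i * t * cs.simple i), ¬ r (cs.simple i) t := by
  refine ⟨⟨hL.1.conj hi hl, pairwise_map_conj ?_ hL.2⟩, ?_⟩
  · intro t ht v hv htv
    have ht2 := hL.1.isReflection t ht
    have hv2 := hL.1.isReflection v hv
    rw [upperConj_iff_of_lt hr i (simple_conj_isReflection ht2 i) (simple_conj_isReflection hv2 i)
      (simple_conj_ne (ne_of_mem_of_not_mem ht hi)) (simple_conj_ne (ne_of_mem_of_not_mem hv hi))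
      (not_lt_conj hr i ht2 (hLp t ht)) (not_lt_conj hr i hv2 (hLp v hv)), simple_conj_conj,
      simple_conj_conj]
    exact htv
  · intro t ht
    obtain ⟨v, hv, rfl⟩ := List.mem_map.mp ht
    exact not_lt_conj hr i (hL.1.isReflection v hv) (hLp v hv)

lemma Inc.conj_upper' {u w : W} {L : List W} (hL : Inc cs (upperConj r (cs.simple i)) u L w)
    (hLp : ∀ t ∈ L, ¬ r (cs.simple i) t) (hi : cs.simple i ∉ L)
    (hl : cs.length (cs.simple i * u) + L.length = cs.length (cs.simple i * w)) :
    Inc cs r (cs.simple i * u)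
      (L.map fun t => cs.simple i * t * cs.simple i) (cs.simple i * w) ∧
      ∀ t ∈ L.map (fun t => cs.simple i * t * cs.simple i), ¬ r (cs.simple i) t := by
  refine ⟨⟨hL.1.conj hi hl, pairwise_map_conj ?_ hL.2⟩, ?_⟩
  · intro t ht v hv htv
    exact (upperConj_iff_of_lt hr i (hL.1.isReflection t ht) (hL.1.isReflection v hv)
      (ne_of_mem_of_not_mem ht hi) (ne_of_mem_of_not_mem hv hi) (hLp t ht) (hLp v hv)).mp htv
  · intro t ht
    obtain ⟨v, hv, rfl⟩ := List.mem_map.mp ht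
    exact not_lt_conj hr i (hL.1.isReflection v hv) (hLp v hv)

lemma Inc.eq_concat {u w : W} {L : List W} (hL : Inc cs r u L w)
    (hLp : ∀ t ∈ L, ¬ r (cs.simple i) t) (hi : cs.simple i ∈ L) :
    ∃ L', L = L' ++ [cs.simple i] ∧ cs.simple i ∉ L' ∧ Inc cs r u L' (cs.simple i * w) ∧
      ∀ t ∈ L', ¬ r (cs.simple i) t := by
  obtain ⟨L', rfl, h⟩ := eq_concat_of_last hr
    (fun t ht h1 => lt_simple_of_not hr i (hL.1.isReflection t ht) h1 (hLp t ht))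
    hL.1.isReflection hL.2 hi
  exact ⟨L', rfl, h, ⟨(path_concat_simple hL.1).1, (List.pairwise_append.mp hL.2).1⟩,
    fun t ht => hLp t (by simp [ht])⟩

lemma Inc.concat {u w : W} {L : List W} (hL : Inc cs r u L (cs.simple i * w))
    (hLp : ∀ t ∈ L, ¬ r (cs.simple i) t) (hi : cs.simple i ∉ L) (hw : cs.IsLeftDescent w i) :
    Inc cs r u (L ++ [cs.simple i]) w ∧ ∀ t ∈ L ++ [cs.simple i], ¬ r (cs.simple i) t := by
  refine ⟨⟨path_concat_simple_of hL.1 hw, List.pairwise_append.mpr ⟨hL.2, by simp, ?_⟩⟩, ?_⟩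
  · intro t ht v hv
    rw [List.mem_singleton.mp hv]
    exact lt_simple_of_not hr i (hL.1.isReflection t ht) (ne_of_mem_of_not_mem ht hi) (hLp t ht)
  · intro t ht
    rcases List.mem_append.mp ht with h | h
    · exact hLp t h
    · rw [List.mem_singleton.mp h]; exact hr.irrefl (cs.isReflection_simple i)

lemma Inc.not_mem_of_not_descent {u w : W} {L : List W} (hL : Inc cs r u L w)
    (hLp : ∀ t ∈ L, ¬ r (cs.simple i) t) (hw : ¬ cs.IsLeftDescent w i) : cs.simple i ∉ L := by
  intro hi
  obtain ⟨L', rfl, -⟩ := hL.eq_concat hr i hLp hi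
  exact hw (path_concat_simple hL.1).2

lemma Inc.eq_cons {u w : W} {L : List W} (hL : Inc cs (upperConj r (cs.simple i)) u L w)
    (hi : cs.simple i ∈ L) :
    ∃ L', L = cs.simple i :: L' ∧ cs.simple i ∉ L' ∧
      Inc cs (upperConj r (cs.simple i)) (cs.simple i * u) L' w := by
  obtain ⟨L', rfl, h⟩ := eq_cons_of_first (hr.upperConj i) (fun _ h => Or.inl ⟨rfl, h⟩)
    hL.1.isReflection hL.2 hi
  exact ⟨L', rfl, h, hL.1.2.2, (List.pairwise_cons.mp hL.2).2⟩

omit hr in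
lemma Inc.cons {u w : W} {L : List W}
    (hL : Inc cs (upperConj r (cs.simple i)) (cs.simple i * u) L w)
    (hi : cs.simple i ∉ L) (hu : ¬ cs.IsLeftDescent u i) :
    Inc cs (upperConj r (cs.simple i)) u (cs.simple i :: L) w :=
  ⟨⟨cs.isReflection_simple i, cs.not_isLeftDescent_iff.mp hu, hL.1⟩,
    List.pairwise_cons.mpr ⟨fun _ ht => Or.inl ⟨rfl, ne_of_mem_of_not_mem ht hi⟩, hL.2⟩⟩

lemma Inc.not_mem_of_descent {u w : W} {L : List W}
    (hL : Inc cs (upperConj r (cs.simple i)) u L w)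
    (hu : cs.IsLeftDescent u i) : cs.simple i ∉ L := by
  intro hi
  obtain ⟨L', rfl, -⟩ := hL.eq_cons hr i hi
  exact (path_simple_cons hL.1).1 hu

lemma compare_of_descent {w : W} (hw : cs.IsLeftDescent w i)
    (h : ∀ z, cs.length z < cs.length w → Uniq cs r z ∧ Uniq cs (upperConj r (cs.simple i)) z)
    (hU : Uniq cs (upperConj r (cs.simple i)) w) : Compare cs r (cs.simple i) w := by
  have hirr : ¬ r (cs.simple i) (cs.simple i) := hr.irrefl (cs.isReflection_simple i)
  have hwl := cs.isLeftDescent_iff.mp hw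
  have hw' := not_isLeftDescent_simple_mul hw
  have hC : Compare cs r (cs.simple i) (cs.simple i * w) :=
    compare_of_uniq hr i fun z hz => h z (by omega)
  obtain ⟨hUr, hUs⟩ := h (cs.simple i * w) (by omega)
  intro u
  by_cases hu : cs.IsLeftDescent u i
  · have hul := cs.isLeftDescent_iff.mp hu
    have hu' := not_isLeftDescent_simple_mul hu
    refine ⟨⟨?_, ?_⟩, ?_⟩
    · rintro ⟨L, hL, hLp⟩
      have hlen := hL.1.length_eq
      -- reduce to a chain from `su` to `sw` for the upper conjugate
      have hgoal : ∃ L, Inc cs (upperConj r (cs.simple i)) (cs.simple i * u) L (cs.simple i * w) ∧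
          ∀ t ∈ L, ¬ r (cs.simple i) t := by
        by_cases hi : cs.simple i ∈ L
        · obtain ⟨L', -, hi', hL', hLp'⟩ := hL.eq_concat hr i hLp hi
          obtain ⟨K, hK, hKp⟩ := (hC u).1.mp ⟨L', hL', hLp'⟩
          have hiK := hK.not_mem_of_descent hr i hu
          refine ⟨_, Inc.cons i (by simpa using hK) hiK hu', ?_⟩
          intro t ht
          rcases List.mem_cons.mp ht with rfl | ht
          · exact hirr
          · exact hKp t ht
        · exact ⟨_, hL.conj_upper hr i hLp hi (by omega)⟩
      obtain ⟨K, hK, hKp⟩ := (hC _).1.mpr hgoal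
      have hiK := hK.not_mem_of_not_descent hr i hKp hw'
      have hlenK := hK.1.length_eq
      have := hK.conj_upper hr i hKp hiK (by simp; omega)
      simp only [cs.simple_mul_simple_cancel_left] at this
      exact ⟨_, this⟩
    · rintro ⟨L, hL, hLp⟩
      have hlen := hL.1.length_eq
      have hi := hL.not_mem_of_descent hr i hu
      obtain ⟨K, hK, hKp⟩ := (hC _).1.mp ⟨_, hL.conj_upper' hr i hLp hi (by omega)⟩
      by_cases hiK : cs.simple i ∈ K
      · obtain ⟨K', rfl, -, hK'⟩ := hK.eq_cons hr i hiK
        rw [cs.simple_mul_simple_cancel_left] at hK'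
        obtain ⟨J, hJ, hJp⟩ := (hC u).1.mpr ⟨K', hK', fun t ht => hKp t (by simp [ht])⟩
        exact ⟨_, hJ.concat hr i hJp (hJ.not_mem_of_not_descent hr i hJp hw') hw⟩
      · have hlenK := hK.1.length_eq
        have := hK.conj_upper' hr i hKp hiK (by simp; omega)
        simp only [cs.simple_mul_simple_cancel_left] at this
        exact ⟨_, this⟩
    · -- both kinds of chains cannot coexist
      have hex : ∀ L L', (Inc cs r u L w ∧ ∀ t ∈ L, ¬ r (cs.simple i) t) →
          (Inc cs r u L' w ∧ ∀ t ∈ L', ¬ r (cs.simple i) t) →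
          cs.simple i ∈ L → cs.simple i ∉ L' → False := by
        rintro L L' ⟨hL, hLp⟩ ⟨hL', hLp'⟩ hi hi'
        have hlen := hL'.1.length_eq
        obtain ⟨L₀, -, -, hL₀, hLp₀⟩ := hL.eq_concat hr i hLp hi
        obtain ⟨K, hK, hKp⟩ := (hC u).1.mp ⟨L₀, hL₀, hLp₀⟩
        have hiK := hK.not_mem_of_descent hr i hu
        have h1 := Inc.cons i (u := cs.simple i * u) (by simpa using hK) hiK hu'
        have h2 := (hL'.conj_upper hr i hLp' hi' (by omega)).1
        have h3 := (hUs _ h1.1.br).unique h1 h2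
        exact not_mem_map_conj hi' (h3 ▸ List.mem_cons_self)
      intro L L' hL hL'
      have hlen := hL.1.1.length_eq
      have hlen' := hL'.1.1.length_eq
      by_cases hi : cs.simple i ∈ L <;> by_cases hi' : cs.simple i ∈ L'
      · obtain ⟨K, rfl, -, hK, hKp⟩ := hL.1.eq_concat hr i hL.2 hi
        obtain ⟨K', rfl, -, hK', hKp'⟩ := hL'.1.eq_concat hr i hL'.2 hi'
        rw [(hC u).2 K K' ⟨hK, hKp⟩ ⟨hK', hKp'⟩]
      · exact (hex L L' hL hL' hi hi').elim
      · exact (hex L' L hL' hL hi' hi).elim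
      · have h1 := (hL.1.conj_upper hr i hL.2 hi (by omega)).1
        have h2 := (hL'.1.conj_upper hr i hL'.2 hi' (by omega)).1
        exact map_conj_injective i ((hUs _ h1.1.br).unique h1 h2)
  · have hul := cs.not_isLeftDescent_iff.mp hu
    have fwd : ∀ L, Inc cs r u L w → (∀ t ∈ L, ¬ r (cs.simple i) t) →
        ∃ K, L = K ++ [cs.simple i] ∧ Inc cs (upperConj r (cs.simple i)) u
          (cs.simple i :: K.map fun t => cs.simple i * t * cs.simple i) w ∧
        ∀ t ∈ cs.simple i :: K.map (fun t => cs.simple i * t * cs.simple i),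
          ¬ r (cs.simple i) t := by
      intro L hL hLp
      obtain ⟨K, rfl, hi, hK, hKp⟩ := hL.eq_concat hr i hLp (hL.1.simple_mem hu hw)
      have hlen := hK.1.length_eq
      have h1 := hK.conj_upper hr i hKp hi (by simp; omega)
      rw [cs.simple_mul_simple_cancel_left] at h1
      refine ⟨K, rfl, h1.1.cons i (not_mem_map_conj hi) hu, ?_⟩
      intro t ht
      rcases List.mem_cons.mp ht with rfl | ht
      · exact hirr
      · exact h1.2 t ht
    refine ⟨⟨?_, ?_⟩, ?_⟩
    · rintro ⟨L, hL, hLp⟩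
      obtain ⟨K, -, hK⟩ := fwd L hL hLp
      exact ⟨_, hK⟩
    · rintro ⟨L, hL, hLp⟩
      obtain ⟨K, rfl, hi, hK⟩ := hL.eq_cons hr i (hL.1.simple_mem hu hw)
      have hlen := hK.1.length_eq
      have h1 := hK.conj_upper' hr i (fun t ht => hLp t (by simp [ht])) hi (by simp; omega)
      rw [cs.simple_mul_simple_cancel_left] at h1
      exact ⟨_, h1.1.concat hr i h1.2 (not_mem_map_conj hi) hw⟩
    · intro L L' hL hL'
      obtain ⟨K, rfl, hK, -⟩ := fwd L hL.1 hL.2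
      obtain ⟨K', rfl, hK', -⟩ := fwd L' hL'.1 hL'.2
      have := (hU u hK.1.br).unique hK hK'
      simp only [List.cons.injEq, true_and] at this
      rw [map_conj_injective i this]

lemma uniq_of_upperConj {w : W}
    (h : ∀ z, cs.length z < cs.length w → Uniq cs r z ∧ Uniq cs (upperConj r (cs.simple i)) z)
    (hU : Uniq cs (upperConj r (cs.simple i)) w) (hC : Compare cs r (cs.simple i) w) :
    Uniq cs r w := by
  have hCx : ∀ x, (x = w ∨ cs.length x < cs.length w) → Compare cs r (cs.simple i) x := by
    rintro x (rfl | hx)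
    · exact hC
    · exact compare_of_uniq hr i fun z hz => h z (by omega)
  have hend : ∀ {x : W} {L : List W}, Path cs x L w → x = w ∨ cs.length x < cs.length w := by
    intro x L hL
    by_cases hx : x = w
    · exact Or.inl hx
    · exact Or.inr (hL.br.length_lt hx)
  intro u hu
  obtain ⟨K, hK, hKu⟩ := hU u hu
  obtain ⟨K₁, K₂, rfl, k1, k2⟩ := exists_split (cs := cs) (p := fun t => ¬ r (cs.simple i) t)
    (fun ht _ => not_lt_of_upperConj hr i ht) hK.1.isReflection hK.2
  obtain ⟨x, hx1, hx2⟩ := path_append.mp hK.1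
  have hpw := List.pairwise_append.mp hK.2
  obtain ⟨J, hJ, hJp⟩ := (hCx x (hend hx2) u).1.mpr ⟨K₁, ⟨hx1, hpw.1⟩, k1⟩
  refine ⟨J ++ K₂, ⟨path_append.mpr ⟨x, hJ.1, hx2⟩, List.pairwise_append.mpr ⟨hJ.2, ?_, ?_⟩⟩, ?_⟩
  · exact hpw.2.1.imp_of_mem fun ha hb hab => (upperConj_iff_of_gt hr i (hx2.isReflection _ ha)
      (hx2.isReflection _ hb) (k2 _ ha) (k2 _ hb)).mp hab
  · exact fun a ha b hb => lt_of_cross hr i (hJ.1.isReflection _ ha) (hx2.isReflection _ hb)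
      (hJp a ha) (k2 b hb)
  · intro L hL
    obtain ⟨L₁, L₂, rfl, l1, l2⟩ := exists_split (cs := cs) (p := fun t => ¬ r (cs.simple i) t)
      (fun ht hu => not_lt_of_lt hr i ht hu) hL.1.isReflection hL.2
    obtain ⟨y, hy1, hy2⟩ := path_append.mp hL.1
    have hpl := List.pairwise_append.mp hL.2
    obtain ⟨I, hI, hIp⟩ := (hCx y (hend hy2) u).1.mp ⟨L₁, ⟨hy1, hpl.1⟩, l1⟩
    have hIL : Inc cs (upperConj r (cs.simple i)) u (I ++ L₂) w := by
      refine ⟨path_append.mpr ⟨y, hI.1, hy2⟩, List.pairwise_append.mpr ⟨hI.2, ?_, ?_⟩⟩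
      · exact hpl.2.1.imp_of_mem fun ha hb hab => (upperConj_iff_of_gt hr i
          (hy2.isReflection _ ha) (hy2.isReflection _ hb) (l2 _ ha) (l2 _ hb)).mpr hab
      · exact fun a ha b hb => upperConj_of_cross hr i (hI.1.isReflection _ ha)
          (hy2.isReflection _ hb) (hIp a ha) (l2 b hb)
    obtain ⟨rfl, rfl⟩ := split_unique (hKu _ hIL) hIp l2 k1 k2
    obtain rfl := hy2.left_unique hx2
    rw [(hCx y (hend hx2) u).2 L₁ J ⟨⟨hy1, hpl.1⟩, l1⟩ ⟨hJ, hJp⟩]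

end

/-- **Dyer's theorem**: for every reflection order, each Bruhat interval has a unique increasing
saturated chain. -/
theorem existsUnique_inc {r : W → W → Prop} (hr : RefOrder cs r) {u w : W} (h : Br cs u w) :
    ∃! L, Inc cs r u L w := by
  suffices H : ∀ n, ∀ w, cs.length w = n → ∀ r, RefOrder cs r → Uniq cs r w from
    H _ w rfl r hr u h
  clear hr h u w r
  intro n
  induction n using Nat.strong_induction_on with
  | _ n ih =>
    intro w hn r hr
    by_cases hw : w = 1
    · subst hw
      intro u hu
      obtain rfl := hu.antisymm (Br.one u)
      refine ⟨[], ⟨rfl, List.Pairwise.nil⟩, ?_⟩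
      intro L hL
      have := hL.1.length_eq
      exact List.eq_nil_of_length_eq_zero (by omega)
    obtain ⟨i, hi⟩ := cs.exists_leftDescent_of_ne_one hw
    have hlt : cs.length (cs.simple i * w) < n := hn ▸ hi
    have hU := uniq_of_first (hr.upperConj i) (fun _ h => Or.inl ⟨rfl, h⟩) hi
      (fun r' hr' => ih _ hlt _ rfl r' hr')
    have hz : ∀ z, cs.length z < cs.length w →
        Uniq cs r z ∧ Uniq cs (upperConj r (cs.simple i)) z :=
      fun z hz => ⟨ih _ (hn ▸ hz) z rfl r hr, ih _ (hn ▸ hz) z rfl _ (hr.upperConj i)⟩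
    exact uniq_of_upperConj hr i hz hU (compare_of_descent hr i hi hz hU)

end Uniqueness

section LexModule

variable {α : Type*} [LinearOrder α]

instance lexPosSMulStrictMono : PosSMulStrictMono ℝ (Lex (α →₀ ℝ)) where
  smul_lt_smul_of_pos_left c hc x y h := by
    obtain ⟨i, hi, hlt⟩ := Finsupp.Lex.lt_iff.mp h
    refine Finsupp.Lex.lt_iff.mpr ⟨i, fun j hj => ?_, ?_⟩
    · have := hi j hj
      exact congrArg (c * ·) this
    · exact mul_lt_mul_of_pos_left hlt hc

end LexModule

section Labels

variable {B W : Type} [Group W] {M : CoxeterMatrix B} (cs : CoxeterSystem M W)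

/-- The linear coordinates used to order roots: the first coordinate records the height of the
image under `p`. -/
def lblv (p : W) (v : Option B →₀ ℝ) : Option B →₀ ℝ :=
  Finsupp.single none (-hgt M (rep cs p v)) + v

/-- The key of a reflection in the reflection order attached to `p`. -/
def lbl (p t : W) : Lex (Option B →₀ ℝ) :=
  toLex ((hgt M (rt cs t))⁻¹ • lblv cs p (rt cs t))

variable {cs}

lemma lblv_add (p : W) (v w : Option B →₀ ℝ) : lblv cs p (v + w) = lblv cs p v + lblv cs p w := by
  simp only [lblv, map_add, hgt_add, neg_add, Finsupp.single_add]; abel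

lemma lblv_smul (p : W) (c : ℝ) (v : Option B →₀ ℝ) : lblv cs p (c • v) = c • lblv cs p v := by
  simp only [lblv, map_smul, hgt_smul, smul_add, Finsupp.smul_single, smul_eq_mul, mul_neg]

lemma lblv_some (p : W) (v : Option B →₀ ℝ) (b : B) : lblv cs p v (some b) = v (some b) := by
  simp [lblv]

lemma lblv_injOn {p : W} {v w : Option B →₀ ℝ} (hv : v none = 0) (hw : w none = 0)
    (h : lblv cs p v = lblv cs p w) : v = w := by
  ext a
  cases a with
  | none => rw [hv, hw]
  | some b => rw [← lblv_some (cs := cs) p v, h, lblv_some]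

lemma hgt_smul_lbl (p : W) {t : W} (ht : cs.IsReflection t) :
    hgt M (rt cs t) • lbl cs p t = toLex (lblv cs p (rt cs t)) := by
  change toLex (hgt M (rt cs t) • (hgt M (rt cs t))⁻¹ • lblv cs p (rt cs t)) = _
  rw [smul_inv_smul₀ (rt_hgt_pos ht).ne']

lemma lbl_injective {p t u : W} (ht : cs.IsReflection t) (hu : cs.IsReflection u)
    (h : lbl cs p t = lbl cs p u) : t = u := by
  have h1 : lblv cs p ((hgt M (rt cs t))⁻¹ • rt cs t) =
      lblv cs p ((hgt M (rt cs u))⁻¹ • rt cs u) := by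
    rw [lblv_smul, lblv_smul]; exact toLex_inj.mp h
  have h2 := lblv_injOn (by simp [(rt_isRoot ht).none_eq]) (by simp [(rt_isRoot hu).none_eq]) h1
  have h3 := congrArg (fun v => form M v v) h2
  simp only [map_smul, LinearMap.smul_apply, (rt_isRoot ht).form_self, (rt_isRoot hu).form_self,
    smul_eq_mul, mul_one] at h3
  have h4 : (hgt M (rt cs t))⁻¹ = (hgt M (rt cs u))⁻¹ :=
    (mul_self_inj (inv_pos.mpr (rt_hgt_pos ht)).le (inv_pos.mpr (rt_hgt_pos hu)).le).mp h3
  rw [h4] at h2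
  exact rt_injective ht hu (smul_right_injective _ (inv_pos.mpr (rt_hgt_pos hu)).ne' h2)

variable [LinearOrder (Option B)]

lemma combo_lt {E : Type*} [AddCommGroup E] [LinearOrder E] [IsOrderedAddMonoid E] [Module ℝ E]
    [PosSMulStrictMono ℝ E] {x y z : E} {a b c : ℝ} (ha : 0 < a) (hb : 0 < b) (hc : c = a + b)
    (h : x < y) (he : c • z = a • x + b • y) : x < z ∧ z < y := by
  have hc0 : 0 < c := by rw [hc]; exact add_pos ha hb
  constructor
  · refine lt_of_smul_lt_smul_of_nonneg_left (a := c) ?_ hc0.le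
    rw [he, hc, add_smul]
    gcongr
  · refine lt_of_smul_lt_smul_of_nonneg_left (a := c) ?_ hc0.le
    rw [he, hc, add_smul]
    gcongr

lemma combo_le {E : Type*} [AddCommGroup E] [LinearOrder E] [IsOrderedAddMonoid E] [Module ℝ E]
    [PosSMulStrictMono ℝ E] {x y z w : E} {a b c d : ℝ} (ha : 0 < a) (hb : 0 < b) (hc : 0 < c)
    (hd : 0 < d) (h : a + b = c + d) (he : a • x + b • y = c • z + d • w) (hxy : x < y)
    (hwz : w < z) : x ≤ z ∧ w ≤ y := by
  constructor
  · by_contra hn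
    rw [not_le] at hn
    have h1 : c • z + d • w < (c + d) • z := by rw [add_smul]; gcongr
    have h2 : (a + b) • x < a • x + b • y := by rw [add_smul]; gcongr
    have h3 : (c + d) • z < (a + b) • x := by
      rw [h]; exact smul_lt_smul_of_pos_left hn (by positivity)
    exact lt_irrefl _ (he ▸ h1.trans (h3.trans h2))
  · by_contra hn
    rw [not_le] at hn
    have h1 : (c + d) • w < c • z + d • w := by rw [add_smul]; gcongr
    have h2 : a • x + b • y < (a + b) • y := by rw [add_smul]; gcongr
    have h3 : (a + b) • y < (c + d) • w := by
      rw [h]; exact smul_lt_smul_of_pos_left hn (by positivity)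
    exact lt_irrefl _ (he ▸ h2.trans (h3.trans h1))

variable (cs) in
lemma refOrder_lbl (p : W) : RefOrder cs (fun t u => lbl cs p t < lbl cs p u) where
  irrefl _ := lt_irrefl _
  trans _ _ _ := lt_trans
  total ht hu hne := lt_or_gt_of_ne fun h => hne (lbl_injective ht hu h)
  conv {t u v} ht hu hv h a b ha hb he := by
    refine combo_lt (a := a * hgt M (rt cs t)) (b := b * hgt M (rt cs v)) (c := hgt M (rt cs u))
      (mul_pos ha (rt_hgt_pos ht)) (mul_pos hb (rt_hgt_pos hv)) ?_ h ?_
    · rw [he, hgt_add, hgt_smul, hgt_smul]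
    · rw [mul_smul, mul_smul, hgt_smul_lbl p ht, hgt_smul_lbl p hu, hgt_smul_lbl p hv, he,
        lblv_add, lblv_smul, lblv_smul]
      rfl

lemma lbl_lt_of_good_of_bad (hbot : ∀ b : Option B, none ≤ b) {p t u : W}
    (ht : cs.IsReflection t) (hu : cs.IsReflection u)
    (h1 : 0 ≤ rep cs p (rt cs t)) (h2 : rep cs p (rt cs u) ≤ 0) : lbl cs p t < lbl cs p u := by
  refine Finsupp.Lex.lt_iff.mpr ⟨none, fun j hj => absurd hj (hbot j).not_gt, ?_⟩
  have h3 := ((rt_isRoot ht).rep p).hgt_pos h1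
  have h4 := ((rt_isRoot hu).rep p).neg.hgt_pos (neg_nonneg.mpr h2)
  have e : ∀ {t : W}, cs.IsReflection t → ofLex (lbl cs p t) none =
      (hgt M (rt cs t))⁻¹ * (-hgt M (rep cs p (rt cs t))) := by
    intro t ht
    simp [lbl, lblv, (rt_isRoot ht).none_eq]
  rw [e ht, e hu, ← hgt_neg (rep cs p (rt cs u))]
  have h5 := mul_pos (inv_pos.mpr (rt_hgt_pos ht)) h3
  have h6 := mul_pos (inv_pos.mpr (rt_hgt_pos hu)) h4
  linarith

/-- On an interval of length two, the first label of the increasing chain is smaller than that of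
the decreasing one. -/
lemma lbl_lt_of_inc_of_dec {p u w a b c d : W} (h : Path cs u [a, b] w) (h' : Path cs u [c, d] w)
    (hab : lbl cs p a < lbl cs p b) (hdc : lbl cs p d < lbl cs p c) :
    lbl cs p a < lbl cs p c ∧ lbl cs p d < lbl cs p b := by
  obtain ⟨ha, hal, hb, hbl, rfl⟩ := h
  obtain ⟨hc, hcl, hd, hdl, he⟩ := h'
  have hA := ((rt_isRoot ha).rep u⁻¹).hgt_pos ((lt_length_refl_mul_iff ha).mp (by omega))
  have hB := ((rt_isRoot hb).rep (a * u)⁻¹).hgt_pos ((lt_length_refl_mul_iff hb).mp (by omega))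
  have hC := ((rt_isRoot hc).rep u⁻¹).hgt_pos ((lt_length_refl_mul_iff hc).mp (by omega))
  have hD := ((rt_isRoot hd).rep (c * u)⁻¹).hgt_pos ((lt_length_refl_mul_iff hd).mp (by omega))
  have e1 := rep_rho_sub ha u
  have e2 := rep_rho_sub hb (a * u)
  have e3 := rep_rho_sub hc u
  have e4 := rep_rho_sub hd (c * u)
  rw [he] at e4
  set A := hgt M (rep cs u⁻¹ (rt cs a))
  set B' := hgt M (rep cs (a * u)⁻¹ (rt cs b))
  set C := hgt M (rep cs u⁻¹ (rt cs c))
  set D := hgt M (rep cs (c * u)⁻¹ (rt cs d))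
  have e : A • rt cs a + B' • rt cs b = C • rt cs c + D • rt cs d := by
    rw [← e1, ← e2, ← e3, ← e4]; abel
  have eh := congrArg (hgt M) e
  simp only [hgt_add, hgt_smul] at eh
  have el : (A * hgt M (rt cs a)) • lbl cs p a + (B' * hgt M (rt cs b)) • lbl cs p b =
      (C * hgt M (rt cs c)) • lbl cs p c + (D * hgt M (rt cs d)) • lbl cs p d := by
    rw [mul_smul, mul_smul, mul_smul, mul_smul, hgt_smul_lbl p ha, hgt_smul_lbl p hb,
      hgt_smul_lbl p hc, hgt_smul_lbl p hd]
    have := congrArg (lblv cs p) e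
    simp only [lblv_add, lblv_smul] at this
    exact congrArg toLex this
  have hA' := mul_pos hA (rt_hgt_pos ha)
  have hB' := mul_pos hB (rt_hgt_pos hb)
  have hC' := mul_pos hC (rt_hgt_pos hc)
  have hD' := mul_pos hD (rt_hgt_pos hd)
  set a' := A * hgt M (rt cs a)
  set b' := B' * hgt M (rt cs b)
  set c' := C * hgt M (rt cs c)
  set d' := D * hgt M (rt cs d)
  have hne : a ≠ c := by
    rintro rfl
    have : d = b := mul_right_cancel he
    exact lt_asymm hab (this ▸ hdc)
  have hne2 : d ≠ b := by
    rintro rfl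
    exact hne (mul_right_cancel (mul_left_cancel he)).symm
  obtain ⟨h1, h2⟩ := combo_le hA' hB' hC' hD' eh el hab hdc
  exact ⟨lt_of_le_of_ne h1 fun h => hne (lbl_injective ha hc h),
    lt_of_le_of_ne h2 fun h => hne2 (lbl_injective hd hb h)⟩

end Labels

section Directed

variable {B W : Type} [Group W] {M : CoxeterMatrix B} (cs : CoxeterSystem M W)

/-- The Bruhat order or its dual. -/
def DBr : Bool → W → W → Prop
  | true, x, y => Br cs x y
  | false, x, y => Br cs y x

/-- The length, signed according to the direction. -/
def drk : Bool → W → ℤ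
  | true, x => cs.length x
  | false, x => -cs.length x

/-- A labelled cover of the Bruhat order or its dual. -/
def Dstep (b : Bool) (x t y : W) : Prop :=
  cs.IsReflection t ∧ y = t * x ∧ drk cs b y = drk cs b x + 1

/-- A labelled saturated chain in the Bruhat order or its dual. -/
def DPath (b : Bool) : W → List W → W → Prop
  | x, [], y => x = y
  | x, t :: L, y => Dstep cs b x t (t * x) ∧ DPath b (t * x) L y

variable {cs} {b : Bool} {x y z : W}

lemma DBr.refl (b : Bool) (x : W) : DBr cs b x x := by cases b <;> exact Br.refl _

lemma DBr.trans (h : DBr cs b x y) (h' : DBr cs b y z) : DBr cs b x z := by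
  cases b
  · exact Br.trans (cs := cs) h' h
  · exact Br.trans (cs := cs) h h'

lemma DBr.drk_le (h : DBr cs b x y) : drk cs b x ≤ drk cs b y := by
  cases b <;> have := Br.length_le h <;> simp [drk] <;> omega

lemma DBr.eq_of_drk_le (h : DBr cs b x y) (h' : drk cs b y ≤ drk cs b x) : x = y := by
  cases b <;> simp [drk] at h'
  · exact (Br.eq_of_length_le h (by omega)).symm
  · exact Br.eq_of_length_le h (by omega)

lemma Dstep.dbr {t : W} (h : Dstep cs b x t y) : DBr cs b x y := by
  obtain ⟨ht, rfl, hl⟩ := h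
  cases b <;> simp only [drk] at hl
  · have : Edge cs (t * x) (t * (t * x)) := ⟨t, ht, rfl, by rw [← mul_assoc, ht.mul_self]; simp; omega⟩
    rw [← mul_assoc, ht.mul_self, one_mul] at this
    exact this.br
  · exact Edge.br ⟨t, ht, rfl, by omega⟩

lemma Dstep.eq_mul {t : W} (h : Dstep cs b x t y) : x = t * y := by
  rw [h.2.1, ← mul_assoc, h.1.mul_self, one_mul]

lemma dstep_false_iff {t : W} : Dstep cs false x t y ↔ Dstep cs true y t x := by
  constructor
  · exact fun h => ⟨h.1, h.eq_mul, by have := h.2.2; simp only [drk] at this ⊢; omega⟩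
  · exact fun h => ⟨h.1, h.eq_mul, by have := h.2.2; simp only [drk] at this ⊢; omega⟩

lemma dstep_true_iff {t : W} : Dstep cs true x t y ↔ Path cs x [t] y := by
  simp only [Dstep, Path, drk]
  constructor
  · rintro ⟨h1, rfl, h2⟩; exact ⟨h1, by omega, rfl⟩
  · rintro ⟨h1, h2, rfl⟩; exact ⟨h1, rfl, by omega⟩

lemma dPath_cons {t : W} {L : List W} :
    DPath cs b x (t :: L) y ↔ ∃ z, Dstep cs b x t z ∧ DPath cs b z L y :=
  ⟨fun h => ⟨_, h⟩, fun ⟨z, h, h'⟩ => by obtain rfl := h.2.1; exact ⟨h, h'⟩⟩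

lemma path_cons {t : W} {L : List W} :
    Path cs x (t :: L) y ↔ ∃ z, Path cs x [t] z ∧ Path cs z L y := by
  rw [← path_append, List.singleton_append]

lemma dPath_true {L : List W} : DPath cs true x L y ↔ Path cs x L y := by
  induction L generalizing x with
  | nil => rfl
  | cons t L ih => rw [dPath_cons, path_cons]; simp only [dstep_true_iff, ih]

lemma dPath_false {L : List W} : DPath cs false x L y ↔ Path cs y L.reverse x := by
  induction L generalizing x with
  | nil => exact eq_comm
  | cons t L ih =>
    rw [dPath_cons, List.reverse_cons, path_append]
    simp only [dstep_false_iff, dstep_true_iff, ih]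
    exact ⟨fun ⟨z, h, h'⟩ => ⟨z, h', h⟩, fun ⟨z, h, h'⟩ => ⟨z, h', h⟩⟩

lemma DPath.dbr {L : List W} (h : DPath cs b x L y) : DBr cs b x y := by
  cases b
  · exact (dPath_false.mp h).br
  · exact (dPath_true.mp h).br

lemma finite_br (w : W) : {z | Br cs z w}.Finite := by
  obtain ⟨ω, hω, rfl⟩ := cs.exists_isReduced w
  refine (ω.sublists.finite_toSet.image cs.wordProd).subset ?_
  intro z hz
  obtain ⟨σ, hσ, -, rfl⟩ := Br.exists_sublist hω hz
  exact ⟨σ, List.mem_sublists.mpr hσ, rfl⟩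

lemma finite_dbr (x y : W) : {z | DBr cs b x z ∧ DBr cs b z y}.Finite := by
  cases b
  · exact (finite_br x).subset fun z hz => hz.1
  · exact (finite_br y).subset fun z hz => hz.2

variable [LinearOrder (Option B)]

lemma existsUnique_dPath (p : W) (h : DBr cs b x y) :
    ∃! L, DPath cs b x L y ∧ L.Pairwise fun t u => lbl cs p t < lbl cs p u := by
  cases b
  · obtain ⟨L, hL, hu⟩ := existsUnique_inc (refOrder_lbl cs p).swap h
    refine ⟨L.reverse, ⟨dPath_false.mpr (by simpa using hL.1), List.pairwise_reverse.mpr hL.2⟩, ?_⟩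
    rintro K ⟨hK, hp⟩
    rw [← hu K.reverse ⟨dPath_false.mp hK, List.pairwise_reverse.mpr hp⟩, List.reverse_reverse]
  · obtain ⟨L, hL, hu⟩ := existsUnique_inc (refOrder_lbl cs p) h
    exact ⟨L, ⟨dPath_true.mpr hL.1, hL.2⟩, fun K hK => hu K ⟨dPath_true.mp hK.1, hK.2⟩⟩

omit [LinearOrder (Option B)] in
lemma DBr.exists_dstep (h : DBr cs b x y) (hne : x ≠ y) :
    ∃ t z, Dstep cs b x t z ∧ DBr cs b z y := by
  classical
  let _ : LinearOrder (Option B) := IsWellOrder.linearOrder WellOrderingRel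
  obtain ⟨L, ⟨hL, -⟩, -⟩ := existsUnique_dPath (1 : W) h
  cases L with
  | nil => exact absurd hL hne
  | cons t L =>
    obtain ⟨z, h1, h2⟩ := dPath_cons.mp hL
    exact ⟨t, z, h1, h2.dbr⟩

/-- Intervals of length two in the Bruhat order have exactly two middle elements, and their labels
are exchanged in a controlled way. -/
lemma Path.exists_other {u w a b : W} (h : Path cs u [a, b] w) :
    ∃ c d, c ≠ a ∧ d ≠ b ∧ Path cs u [c, d] w ∧
      (∀ e f, Path cs u [e, f] w → (e = a ∧ f = b) ∨ (e = c ∧ f = d)) ∧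
      ∀ p, (lbl cs p b < lbl cs p a → lbl cs p c < lbl cs p a) ∧
        (lbl cs p a < lbl cs p b → lbl cs p d < lbl cs p b) := by
  have hne : ∀ p {e f}, Path cs u [e, f] w → lbl cs p e ≠ lbl cs p f := by
    intro p e f hef h'
    obtain rfl := lbl_injective hef.1 hef.2.2.1 h'
    have h1 := hef.2.2.2.2
    have h2 : e * (e * u) = w := h1
    rw [← mul_assoc, hef.1.mul_self, one_mul] at h2
    have := hef.length_eq
    simp [h2] at this
  have hI : ∀ p, ∃ c d, Path cs u [c, d] w ∧ lbl cs p c < lbl cs p d ∧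
      ∀ e f, Path cs u [e, f] w → lbl cs p e < lbl cs p f → e = c ∧ f = d := by
    intro p
    obtain ⟨L, hL, hu⟩ := existsUnique_inc (refOrder_lbl cs p) h.br
    have h1 := h.length_eq
    have h2 := hL.1.length_eq
    obtain ⟨c, d, rfl⟩ := List.length_eq_two.mp (show L.length = 2 by simp at h1; omega)
    refine ⟨c, d, hL.1, by simpa using hL.2, fun e f hef hlt => ?_⟩
    simpa using hu [e, f] ⟨hef, by simpa using hlt⟩
  have hD : ∀ p, ∃ c d, Path cs u [c, d] w ∧ lbl cs p d < lbl cs p c ∧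
      ∀ e f, Path cs u [e, f] w → lbl cs p f < lbl cs p e → e = c ∧ f = d := by
    intro p
    obtain ⟨L, hL, hu⟩ := existsUnique_inc (refOrder_lbl cs p).swap h.br
    have h1 := h.length_eq
    have h2 := hL.1.length_eq
    obtain ⟨c, d, rfl⟩ := List.length_eq_two.mp (show L.length = 2 by simp at h1; omega)
    refine ⟨c, d, hL.1, by simpa using hL.2, fun e f hef hlt => ?_⟩
    simpa using hu [e, f] ⟨hef, by simpa using hlt⟩
  have main : ∃ c d, Path cs u [c, d] w ∧ (c, d) ≠ (a, b) ∧
      (∀ e f, Path cs u [e, f] w → (e = a ∧ f = b) ∨ (e = c ∧ f = d)) := by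
    obtain ⟨c, d, h1, h2, h3⟩ := hI 1
    obtain ⟨c', d', k1, k2, k3⟩ := hD 1
    rcases lt_or_gt_of_ne (hne 1 h) with hab | hab
    · obtain ⟨rfl, rfl⟩ := h3 a b h hab
      refine ⟨c', d', k1, ?_, fun e f hef => ?_⟩
      · rintro ⟨rfl, rfl⟩; exact lt_asymm hab k2
      · rcases lt_or_gt_of_ne (hne 1 hef) with h' | h'
        · exact Or.inl (h3 e f hef h')
        · exact Or.inr (k3 e f hef h')
    · obtain ⟨rfl, rfl⟩ := k3 a b h hab
      refine ⟨c, d, h1, ?_, fun e f hef => ?_⟩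
      · rintro ⟨rfl, rfl⟩; exact lt_asymm hab h2
      · rcases lt_or_gt_of_ne (hne 1 hef) with h' | h'
        · exact Or.inr (h3 e f hef h')
        · exact Or.inl (k3 e f hef h')
  obtain ⟨c, d, hcd, hn, hun⟩ := main
  have e1 : b * (a * u) = w := h.2.2.2.2
  have e2 : d * (c * u) = w := hcd.2.2.2.2
  refine ⟨c, d, ?_, ?_, hcd, hun, fun p => ⟨fun hlt => ?_, fun hlt => ?_⟩⟩
  · rintro rfl
    exact hn (by rw [mul_right_cancel (e2.trans e1.symm)])
  · rintro rfl
    exact hn (by rw [mul_right_cancel (mul_left_cancel (e2.trans e1.symm))])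
  · obtain ⟨c', d', h1, h2, -⟩ := hI p
    rcases hun c' d' h1 with ⟨rfl, rfl⟩ | ⟨rfl, rfl⟩
    · exact absurd h2 (lt_asymm hlt)
    · exact (lbl_lt_of_inc_of_dec hcd h h2 hlt).1
  · obtain ⟨c', d', h1, h2, -⟩ := hD p
    rcases hun c' d' h1 with ⟨rfl, rfl⟩ | ⟨rfl, rfl⟩
    · exact absurd h2 (lt_asymm hlt)
    · exact (lbl_lt_of_inc_of_dec h hcd hlt h2).2

lemma Dstep.exists_other {t s m : W} (h : Dstep cs b x t m) (h' : Dstep cs b m s y) :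
    ∃ t' s' m', t' ≠ t ∧ Dstep cs b x t' m' ∧ Dstep cs b m' s' y ∧
      (∀ e f k, Dstep cs b x e k → Dstep cs b k f y → e = t ∨ e = t') ∧
      ∀ p, lbl cs p s < lbl cs p t → lbl cs p t' < lbl cs p t := by
  cases b
  · have key : ∀ e k f, Dstep cs false x e k → Dstep cs false k f y → Path cs y [f, e] x := by
      intro e k f h h'
      rw [dstep_false_iff, dstep_true_iff] at h h'
      exact path_cons.mpr ⟨k, h', h⟩
    obtain ⟨c, d, hc, hd, hp, hu, hl⟩ := (key t m s h h').exists_other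
    obtain ⟨k, h1, h2⟩ := path_cons.mp hp
    rw [← dstep_true_iff, ← dstep_false_iff] at h1 h2
    refine ⟨d, c, k, hd, h2, h1, fun e f k h3 h4 => ?_, fun p => (hl p).2⟩
    exact (hu f e (key e k f h3 h4)).imp And.right And.right
  · have key : ∀ e k f, Dstep cs true x e k → Dstep cs true k f y → Path cs x [e, f] y := by
      intro e k f h h'
      rw [dstep_true_iff] at h h'
      exact path_cons.mpr ⟨k, h, h'⟩
    obtain ⟨c, d, hc, hd, hp, hu, hl⟩ := (key t m s h h').exists_other
    obtain ⟨k, h1, h2⟩ := path_cons.mp hp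
    rw [← dstep_true_iff] at h1 h2
    refine ⟨c, d, k, hc, h1, h2, fun e f k h3 h4 => ?_, fun p => (hl p).1⟩
    exact (hu e f (key e k f h3 h4)).imp And.left And.left

omit [LinearOrder (Option B)] in
lemma Dstep.ne_of_dstep {t s m : W} (h : Dstep cs b x t m) (h' : Dstep cs b m s y) : t ≠ s := by
  rintro rfl
  have h1 : x = y := h.eq_mul.trans h'.2.1.symm
  have h2 := h.2.2
  have h3 := h'.2.2
  rw [← h1] at h3
  omega

/-- The increasing chain starts with the smallest available label. -/
lemma lbl_le_of_inc {p a c m : W} {L : List W} (h : DPath cs b x (a :: L) y)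
    (hp : (a :: L).Pairwise fun t u => lbl cs p t < lbl cs p u) (hc : Dstep cs b x c m)
    (hm : DBr cs b m y) : lbl cs p a ≤ lbl cs p c := by
  by_contra hlt
  rw [not_le] at hlt
  have hfin : {c | DBr cs b x (c * x) ∧ DBr cs b (c * x) y}.Finite :=
    (finite_dbr x y).preimage (mul_left_injective x).injOn
  have hS : {c | ∃ m, Dstep cs b x c m ∧ DBr cs b m y}.Finite := by
    refine hfin.subset ?_
    rintro c ⟨m, hc, hm⟩
    change DBr cs b x (c * x) ∧ DBr cs b (c * x) y
    rw [← hc.2.1]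
    exact ⟨hc.dbr, hm⟩
  obtain ⟨d, ⟨k, hd, hk⟩, hmin⟩ := Set.exists_min_image _ (lbl cs p) hS ⟨c, m, hc, hm⟩
  have hda : lbl cs p d < lbl cs p a := (hmin c ⟨m, hc, hm⟩).trans_lt hlt
  obtain ⟨K, ⟨hK, hKp⟩, -⟩ := existsUnique_dPath p hk
  have hcons : (d :: K).Pairwise (fun t u => lbl cs p t < lbl cs p u) → False := by
    intro hpw
    have := (existsUnique_dPath p h.dbr).unique ⟨h, hp⟩ ⟨dPath_cons.mpr ⟨k, hd, hK⟩, hpw⟩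
    simp only [List.cons.injEq] at this
    exact hda.ne (by rw [this.1])
  cases K with
  | nil => exact hcons (List.pairwise_singleton _ _)
  | cons e K =>
    obtain ⟨k', he, hk'⟩ := dPath_cons.mp hK
    rcases lt_trichotomy (lbl cs p d) (lbl cs p e) with h1 | h1 | h1
    · refine hcons (List.pairwise_cons.mpr ⟨fun f hf => ?_, hKp⟩)
      rcases List.mem_cons.mp hf with rfl | hf
      · exact h1
      · exact h1.trans ((List.pairwise_cons.mp hKp).1 f hf)
    · exact hd.ne_of_dstep he (lbl_injective hd.1 he.1 h1)
    · obtain ⟨t', s', m', -, h2, h3, -, h4⟩ := hd.exists_other he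
      exact (hmin t' ⟨m', h2, h3.dbr.trans hk'.dbr⟩).not_gt (h4 p h1)

end Directed

section Product

variable {B W ι : Type} [Group W] {M : CoxeterMatrix B} (cs : CoxeterSystem M W) (σ : ι → Bool)

/-- The product order of Bruhat orders and their duals. -/
def PLe (x y : ι → W) : Prop := ∀ c, DBr cs (σ c) (x c) (y c)

/-- A labelled cover in the product order. -/
def Pstep (x : ι → W) (c : ι) (t : W) (y : ι → W) : Prop :=
  Dstep cs (σ c) (x c) t (y c) ∧ ∀ d, d ≠ c → y d = x d

/-- The rank in the product order. -/
def prk [Fintype ι] (x : ι → W) : ℤ := ∑ c, drk cs (σ c) (x c)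

variable {cs σ} {x y z : ι → W}

lemma PLe.refl (x : ι → W) : PLe cs σ x x := fun _ => DBr.refl _ _

lemma PLe.trans (h : PLe cs σ x y) (h' : PLe cs σ y z) : PLe cs σ x z :=
  fun c => (h c).trans (h' c)

lemma Pstep.ple {c : ι} {t : W} (h : Pstep cs σ x c t y) : PLe cs σ x y := by
  intro c'
  by_cases hc : c' = c
  · subst hc; exact h.1.dbr
  · rw [h.2 c' hc]; exact DBr.refl _ _

lemma Pstep.eq {c : ι} {t : W} (h : Pstep cs σ x c t y) (h' : Pstep cs σ x c t z) : y = z := by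
  funext c'
  by_cases hc : c' = c
  · subst hc; rw [h.1.2.1, h'.1.2.1]
  · rw [h.2 c' hc, h'.2 c' hc]

lemma pstep_update [DecidableEq ι] {c : ι} {t a : W} (h : Dstep cs (σ c) (x c) t a) :
    Pstep cs σ x c t (Function.update x c a) :=
  ⟨by simpa using h, fun c' hc => by simp [hc]⟩

lemma PLe.exists_pstep (h : PLe cs σ x y) (hne : x ≠ y) :
    ∃ c t z, Pstep cs σ x c t z ∧ PLe cs σ z y := by
  classical
  obtain ⟨c, hc⟩ := Function.ne_iff.mp hne
  obtain ⟨t, a, h1, h2⟩ := (h c).exists_dstep hc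
  refine ⟨c, t, _, pstep_update h1, fun c' => ?_⟩
  by_cases hcc : c' = c
  · subst hcc; simpa using h2
  · simpa [hcc] using h c'

section
variable [Fintype ι]

lemma PLe.prk_le (h : PLe cs σ x y) : prk cs σ x ≤ prk cs σ y :=
  Finset.sum_le_sum fun c _ => (h c).drk_le

lemma PLe.eq_of_prk_le (h : PLe cs σ x y) (h' : prk cs σ y ≤ prk cs σ x) : x = y := by
  funext c
  refine (h c).eq_of_drk_le ?_
  have := (Finset.sum_eq_sum_iff_of_le fun c _ => (h c).drk_le).mp (le_antisymm h.prk_le h')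
  exact (this c (Finset.mem_univ c)).ge

lemma Pstep.prk_eq {c : ι} {t : W} (h : Pstep cs σ x c t y) : prk cs σ y = prk cs σ x + 1 := by
  classical
  rw [prk, prk, ← Finset.add_sum_erase _ _ (Finset.mem_univ c),
    ← Finset.add_sum_erase Finset.univ (fun c => drk cs (σ c) (x c)) (Finset.mem_univ c), h.1.2.2,
    Finset.sum_congr rfl fun c' hc' => by rw [h.2 c' (Finset.ne_of_mem_erase hc')]]
  ring

lemma PLe.prk_lt (h : PLe cs σ x y) (hne : x ≠ y) : prk cs σ x < prk cs σ y :=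
  lt_of_not_ge fun h' => hne (h.eq_of_prk_le h')

lemma PLe.exists_pstep_of_prk (h : PLe cs σ x y) (h' : prk cs σ y = prk cs σ x + 1) :
    ∃ c t, Pstep cs σ x c t y := by
  obtain ⟨c, t, z, h1, h2⟩ := h.exists_pstep (by rintro rfl; omega)
  have := h1.prk_eq
  obtain rfl := h2.eq_of_prk_le (by omega)
  exact ⟨c, t, h1⟩

end

/-- Edge labels on the product that restrict to root keys on every factor. -/
structure IsLab [LinearOrder (Option B)] (cs : CoxeterSystem M W) {Λ : Type} [LinearOrder Λ]
    (lab : ι → W → Λ) : Prop where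
  exists_lbl : ∀ c, ∃ p, ∀ t u, lab c t < lab c u ↔ lbl cs p t < lbl cs p u
  ne : ∀ {c c' t u}, c ≠ c' → lab c t ≠ lab c' u

variable [LinearOrder (Option B)] {Λ : Type} [LinearOrder Λ]

lemma IsLab.eq {lab : ι → W → Λ} (hl : IsLab cs lab) {c c' : ι} {t u : W}
    (ht : cs.IsReflection t) (hu : cs.IsReflection u) (h : lab c t = lab c' u) :
    c = c' ∧ t = u := by
  have hc : c = c' := by_contra fun hc => hl.ne hc h
  subst hc
  obtain ⟨p, hp⟩ := hl.exists_lbl c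
  refine ⟨rfl, by_contra fun hne => ?_⟩
  rcases (refOrder_lbl cs p).total ht hu hne with h' | h'
  · exact ((hp _ _).mpr h').ne h
  · exact ((hp _ _).mpr h').ne' h

lemma Pstep.lab_ne {lab : ι → W → Λ} (hl : IsLab cs lab) {c c' : ι} {t s : W}
    (h : Pstep cs σ x c t y) (h' : Pstep cs σ y c' s z) : lab c t ≠ lab c' s := by
  intro he
  obtain ⟨rfl, rfl⟩ := hl.eq h.1.1 h'.1.1 he
  exact h.1.ne_of_dstep h'.1 rfl

lemma Pstep.exists_other [Fintype ι] {c c' : ι} {t s : W} {m : ι → W} (h : Pstep cs σ x c t m)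
    (h' : Pstep cs σ m c' s y) :
    ∃ c₂ t₂ m₂, Pstep cs σ x c₂ t₂ m₂ ∧ PLe cs σ m₂ y ∧ m₂ ≠ m ∧
      (∀ e u k, Pstep cs σ x e u k → PLe cs σ k y → k = m ∨ k = m₂) ∧
      ∀ {Λ : Type} [LinearOrder Λ] {lab : ι → W → Λ}, IsLab cs lab → lab c' s < lab c t →
        lab c₂ t₂ < lab c t := by
  classical
  have hback : ∀ {e u k}, Pstep cs σ x e u k → PLe cs σ k y → x e ≠ y e := by
    intro e u k hk hky he
    have h1 := (hky e).drk_le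
    have h2 := hk.1.2.2
    rw [he] at h2
    omega
  by_cases hc : c' = c
  · subst hc
    obtain ⟨t', s', m', hne, h1, h2, hu, hl⟩ := h.1.exists_other h'.1
    have hxy : ∀ e, e ≠ c' → y e = x e := fun e he => (h'.2 e he).trans (h.2 e he)
    have hm' : PLe cs σ (Function.update x c' m') y := by
      intro e
      by_cases he : e = c'
      · subst he; simpa using h2.dbr
      · simpa [he, hxy e he] using DBr.refl _ _
    refine ⟨c', t', _, pstep_update h1, hm', ?_, ?_, ?_⟩
    · intro he
      have := congrFun he c'
      rw [Function.update_self, h1.2.1, h.1.2.1] at this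
      exact hne (mul_right_cancel this)
    · intro e u k hk hky
      have he : e = c' := by
        by_contra he
        exact hback hk hky (hxy e he).symm
      subst he
      obtain ⟨e', f, hf⟩ := hky.exists_pstep_of_prk (by
        rw [hk.prk_eq, h'.prk_eq, h.prk_eq])
      have he' : e' = e := by
        by_contra he'
        have h3 := hf.1.2.2
        rw [hxy e' he', hk.2 e' he'] at h3
        omega
      subst he'
      rcases hu u f _ hk.1 hf.1 with rfl | rfl
      · exact Or.inl (hk.eq h)
      · exact Or.inr (hk.eq (pstep_update h1))
    · intro Λ _ lab hlab hlt
      obtain ⟨p, hp⟩ := hlab.exists_lbl c'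
      exact (hp _ _).mpr (hl p ((hp _ _).mp hlt))
  · have hs : Dstep cs (σ c') (x c') s (y c') := by
      have := h'.1; rwa [h.2 c' hc] at this
    have hc2 := Ne.symm hc
    have hle : PLe cs σ (Function.update x c' (y c')) y := by
      intro e
      by_cases he : e = c'
      · subst he; simpa using DBr.refl _ _
      · simpa [he] using h.ple.trans h'.ple e
    refine ⟨c', s, _, pstep_update hs, hle, ?_, ?_, ?_⟩
    · intro he
      have := congrFun he c
      rw [Function.update_of_ne hc2] at this
      have h3 := h.1.2.2
      rw [← this] at h3
      omega
    · intro e u k hk hky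
      have hke := (hky e).eq_of_drk_le
      by_cases he : e = c
      · subst he
        left
        have h1 : k e = y e := hke (by rw [h'.2 e hc2, h.1.2.2, hk.1.2.2])
        funext e'
        by_cases hee : e' = e
        · subst hee; rw [h1, h'.2 _ hc2]
        · rw [hk.2 _ hee, h.2 _ hee]
      · by_cases he2 : e = c'
        · subst he2
          right
          have h1 : k e = y e := hke (by rw [hs.2.2, hk.1.2.2])
          funext e'
          by_cases hee : e' = e
          · subst hee; simp [h1]
          · simp [hee, hk.2 _ hee]
        · exact absurd (((h'.2 e he2).trans (h.2 e he)).symm) (hback hk hky)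
    · intro Λ _ lab hlab hlt
      exact hlt

lemma exists_dPath_of_pstep {lab : ι → W → Λ} (c : ι) {p : W}
    (hp : ∀ t u, lab c t < lab c u ↔ lbl cs p t < lbl cs p u) {f : ℕ → ι → W} {C : ℕ → ι}
    {T : ℕ → W} (d i : ℕ) (hf : ∀ k, i ≤ k → k < i + d → Pstep cs σ (f k) (C k) (T k) (f (k + 1)))
    (hlt : ∀ k k', i ≤ k → k < k' → k' < i + d → lab (C k) (T k) < lab (C k') (T k')) :
    ∃ L, DPath cs (σ c) (f i c) L (f (i + d) c) ∧
      (L.Pairwise fun t u => lbl cs p t < lbl cs p u) ∧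
      ∀ t ∈ L, ∃ k, i ≤ k ∧ k < i + d ∧ C k = c ∧ T k = t := by
  induction d generalizing i with
  | zero => exact ⟨[], rfl, List.Pairwise.nil, by simp⟩
  | succ d ih =>
    obtain ⟨L, h1, h2, h3⟩ := ih (i + 1) (fun k hk hk' => hf k (by omega) (by omega))
      (fun k k' hk hk' hk'' => hlt k k' (by omega) hk' (by omega))
    rw [show i + 1 + d = i + (d + 1) by omega] at h1 h3
    have h4 := hf i le_rfl (by omega)
    by_cases hc : C i = c
    · subst hc
      refine ⟨T i :: L, dPath_cons.mpr ⟨_, h4.1, h1⟩, List.pairwise_cons.mpr ⟨?_, h2⟩, ?_⟩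
      · intro t ht
        obtain ⟨k, hk1, hk2, hk3, rfl⟩ := h3 t ht
        have := hlt i k le_rfl (by omega) (by omega)
        rw [hk3] at this
        exact (hp _ _).mp this
      · intro t ht
        rcases List.mem_cons.mp ht with rfl | ht
        · exact ⟨i, le_rfl, by omega, rfl, rfl⟩
        · obtain ⟨k, hk1, hk2, hk3⟩ := h3 t ht
          exact ⟨k, by omega, hk2, hk3⟩
    · refine ⟨L, ?_, h2, fun t ht => ?_⟩
      · rwa [← h4.2 c (Ne.symm hc)]
      · obtain ⟨k, hk1, hk2, hk3⟩ := h3 t ht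
        exact ⟨k, by omega, hk2, hk3⟩

/-- A chain without descents starts with the smallest available label. -/
lemma lab_le_of_no_descent {lab : ι → W → Λ} (hl : IsLab cs lab) {f : ℕ → ι → W} {C : ℕ → ι}
    {T : ℕ → W} {i j : ℕ} (hij : i < j)
    (hf : ∀ k, i ≤ k → k < j → Pstep cs σ (f k) (C k) (T k) (f (k + 1)))
    (hnd : ∀ k, i ≤ k → k + 1 < j → lab (C k) (T k) ≤ lab (C (k + 1)) (T (k + 1)))
    {c : ι} {t : W} {m : ι → W} (hm : Pstep cs σ (f i) c t m) (hmj : PLe cs σ m (f j)) :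
    lab (C i) (T i) ≤ lab c t := by
  obtain ⟨d, rfl⟩ := Nat.exists_eq_add_of_lt hij
  have hlt : ∀ k k', i ≤ k → k < k' → k' < i + (d + 1) →
      lab (C k) (T k) < lab (C k') (T k') := by
    intro k k' hk hkk' hk'
    induction k', hkk' using Nat.le_induction with
    | base =>
      exact lt_of_le_of_ne (hnd k hk (by omega))
        ((hf k hk (by omega)).lab_ne hl (hf (k + 1) (by omega) (by omega)))
    | succ n hn ih =>
      refine (ih (by omega)).trans (lt_of_le_of_ne (hnd n (by omega) (by omega)) ?_)
      exact (hf n (by omega) (by omega)).lab_ne hl (hf (n + 1) (by omega) (by omega))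
  obtain ⟨p, hp⟩ := hl.exists_lbl c
  obtain ⟨L, h1, h2, h3⟩ := exists_dPath_of_pstep (cs := cs) (σ := σ) c hp (d + 1) i
    (fun k hk hk' => hf k hk (by omega)) hlt
  cases L with
  | nil =>
    exfalso
    have h4 := (hmj c).drk_le
    have h5 := hm.1.2.2
    have h6 : f i c = f (i + (d + 1)) c := h1
    rw [h6] at h5
    rw [show i + d + 1 = i + (d + 1) by omega] at h4
    omega
  | cons a L =>
    have h4 : lab c a ≤ lab c t := by
      rw [← not_lt, hp, not_lt]
      exact lbl_le_of_inc h1 h2 hm.1 (hmj c)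
    obtain ⟨k, hk1, hk2, hk3, hk4⟩ := h3 a List.mem_cons_self
    refine le_trans ?_ h4
    rw [← hk3, ← hk4]
    rcases hk1.eq_or_lt with rfl | hk1
    · exact le_rfl
    · exact (hlt i k le_rfl hk1 hk2).le

end Product

section Sequences

variable {B W : Type} [Group W] {M : CoxeterMatrix B} (cs : CoxeterSystem M W) (dem : W → W → W)

/-- Products of initial segments of a sequence. -/
def pp (u : ℕ → W) : ℕ → W
  | 0 => 1
  | k + 1 => pp u k * u k

/-- Demazure products of initial segments of a sequence. -/
def dpp (u : ℕ → W) : ℕ → W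
  | 0 => 1
  | k + 1 => dem (dpp u k) (u k)

/-- The sequence whose ordinary partial products are the Demazure partial products of `u`. -/
def cg (u : ℕ → W) (k : ℕ) : W := (dpp dem u k)⁻¹ * dpp dem u (k + 1)

/-- The sum of the lengths of an initial segment. -/
def lsum (u : ℕ → W) (n : ℕ) : ℕ := ∑ k ∈ Finset.range n, cs.length (u k)

/-- Lengths add in the product of the first `n` entries. -/
def Additive (u : ℕ → W) (n : ℕ) : Prop := cs.length (pp u n) = lsum cs u n

variable {cs dem}

lemma lsum_succ (u : ℕ → W) (n : ℕ) : lsum cs u (n + 1) = lsum cs u n + cs.length (u n) :=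
  Finset.sum_range_succ _ _

lemma pp_congr {u u' : ℕ → W} {n : ℕ} (h : ∀ k < n, u k = u' k) : pp u n = pp u' n := by
  induction n with
  | zero => rfl
  | succ n ih => rw [pp, pp, ih fun k hk => h k (by omega), h n (by omega)]

lemma dpp_congr {u u' : ℕ → W} {n : ℕ} (h : ∀ k < n, u k = u' k) : dpp dem u n = dpp dem u' n := by
  induction n with
  | zero => rfl
  | succ n ih => rw [dpp, dpp, ih fun k hk => h k (by omega), h n (by omega)]

lemma lsum_congr {u u' : ℕ → W} {n : ℕ} (h : ∀ k < n, u k = u' k) : lsum cs u n = lsum cs u' n :=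
  Finset.sum_congr rfl fun k hk => by rw [h k (Finset.mem_range.mp hk)]

lemma length_pp_le_of_le (u : ℕ → W) {k n : ℕ} (h : k ≤ n) :
    cs.length (pp u n) + lsum cs u k ≤ cs.length (pp u k) + lsum cs u n := by
  induction n, h using Nat.le_induction with
  | base => rfl
  | succ n hn ih =>
    have := cs.length_mul_le (pp u n) (u n)
    rw [pp, lsum_succ]
    omega

lemma length_pp_le (u : ℕ → W) (n : ℕ) : cs.length (pp u n) ≤ lsum cs u n := by
  simpa [pp, lsum] using length_pp_le_of_le (cs := cs) u (Nat.zero_le n)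

lemma Additive.of_le {u : ℕ → W} {k n : ℕ} (h : Additive cs u n) (hk : k ≤ n) :
    Additive cs u k := by
  have h1 := length_pp_le_of_le (cs := cs) u hk
  have h2 := length_pp_le (cs := cs) u k
  unfold Additive at *
  omega

lemma Additive.length_succ {u : ℕ → W} {k n : ℕ} (h : Additive cs u n) (hk : k < n) :
    cs.length (pp u k * u k) = cs.length (pp u k) + cs.length (u k) := by
  have h1 := h.of_le hk.le
  have h2 := h.of_le (Nat.succ_le_of_lt hk)
  unfold Additive at h1 h2
  rw [lsum_succ, pp] at h2
  omega

/-- In an additive sequence, a reflection that shortens an initial product shortens all later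
ones. -/
lemma Additive.shorten {u : ℕ → W} {k n : ℕ} (h : Additive cs u n) (hk : k ≤ n) {t : W}
    (ht : cs.length (t * pp u k) < cs.length (pp u k)) :
    cs.length (t * pp u n) < cs.length (pp u n) := by
  induction n, hk using Nat.le_induction with
  | base => exact ht
  | succ n hn ih =>
    have h1 := ih (h.of_le n.le_succ)
    have h2 := h.length_succ n.lt_succ_self
    have h3 := cs.length_mul_le (t * pp u n) (u n)
    rw [pp, ← mul_assoc]
    omega

variable (hd : IsDemazure cs dem)
include hd

lemma dpp_eq_pp {u : ℕ → W} {n : ℕ} (h : Additive cs u n) : dpp dem u n = pp u n := by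
  induction n with
  | zero => rfl
  | succ n ih =>
    rw [dpp, pp, ih (h.of_le n.le_succ), hd.eq_mul _ _ (h.length_succ n.lt_succ_self)]

lemma dpp_mono {u u' : ℕ → W} {n : ℕ} (h : ∀ k < n, Br cs (u k) (u' k)) :
    Br cs (dpp dem u n) (dpp dem u' n) := by
  induction n with
  | zero => exact Br.refl _
  | succ n ih => exact hd.mono (ih fun k hk => h k (by omega)) (h n (by omega))

lemma pp_br_dpp (u : ℕ → W) (n : ℕ) : Br cs (pp u n) (dpp dem u n) := by
  induction n with
  | zero => exact Br.refl _
  | succ n ih => exact (hd.mul_br_dem _ _).trans (hd.mono ih (Br.refl _))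

lemma cg_br (u : ℕ → W) (k : ℕ) : Br cs (cg dem u k) (u k) := by
  obtain ⟨y, h1, h2, -⟩ := hd.exists_right (dpp dem u k) (u k)
  rwa [cg, dpp, h2, inv_mul_cancel_left]

omit hd in
lemma pp_cg (u : ℕ → W) (n : ℕ) : pp (cg dem u) n = dpp dem u n := by
  induction n with
  | zero => rfl
  | succ n ih => rw [pp, ih, cg, mul_inv_cancel_left]

lemma length_dpp_succ (u : ℕ → W) (k : ℕ) :
    cs.length (dpp dem u (k + 1)) = cs.length (dpp dem u k) + cs.length (cg dem u k) := by
  obtain ⟨y, h1, h2, h3⟩ := hd.exists_right (dpp dem u k) (u k)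
  rw [cg, dpp, h3, h2, inv_mul_cancel_left]

lemma additive_cg (u : ℕ → W) (n : ℕ) : Additive cs (cg dem u) n := by
  unfold Additive
  rw [pp_cg]
  induction n with
  | zero => simp [dpp, lsum]
  | succ n ih => rw [length_dpp_succ hd, lsum_succ, ih]

lemma lsum_cg_le (u : ℕ → W) (n : ℕ) : lsum cs (cg dem u) n ≤ lsum cs u n :=
  Finset.sum_le_sum fun k _ => (cg_br hd u k).length_le

lemma length_dpp (u : ℕ → W) (n : ℕ) : cs.length (dpp dem u n) = lsum cs (cg dem u) n := by
  rw [← additive_cg hd u n, pp_cg]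

/-- If the Demazure product has the maximal possible length, the sequence is additive. -/
lemma additive_of_length_dpp {u : ℕ → W} {n : ℕ} (h : lsum cs u n ≤ cs.length (dpp dem u n)) :
    Additive cs u n := by
  rw [length_dpp hd] at h
  have h1 := (Finset.sum_eq_sum_iff_of_le fun k _ => (cg_br hd u k).length_le).mp
    (le_antisymm (lsum_cg_le hd u n) h)
  have h2 : ∀ k < n, cg dem u k = u k := fun k hk =>
    (cg_br hd u k).eq_of_length_le (h1 k (Finset.mem_range.mpr hk)).ge
  have h3 := additive_cg hd u n
  rwa [Additive, pp_congr h2, lsum_congr h2] at h3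

end Sequences

section Changes

variable {B W : Type} [Group W] {M : CoxeterMatrix B} {cs : CoxeterSystem M W}

lemma length_conj_mul_lt_iff {t : W} (ht : cs.IsReflection t) (x y : W) :
    cs.length (x⁻¹ * t * x * y) < cs.length y ↔
      ¬ (cs.length (t * x) < cs.length x ↔ cs.length (t * (x * y)) < cs.length (x * y)) := by
  have hs : cs.IsReflection (x⁻¹ * t * x) := by simpa using ht.conj x⁻¹
  rw [length_refl_mul_lt_iff hs, length_refl_mul_lt_iff ht, length_refl_mul_lt_iff ht]
  have hr := (rt_isRoot ht).rep x⁻¹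
  have hr' := hr.rep y⁻¹
  rcases hr.nonneg_or with h | h
  · have h1 := rt_conj_of_nonneg ht h
    rw [inv_inv] at h1
    rw [h1, ← rep_mul_apply, ← mul_inv_rev]
    simp [hr.not_nonpos h]
  · have h1 := rt_conj_of_nonpos ht h
    rw [inv_inv] at h1
    rw [h1, map_neg, ← rep_mul_apply, ← mul_inv_rev, neg_nonpos]
    simp [h, hr'.not_nonpos_iff]

/-- Left multiplication by `t` changes direction at the `i`-th factor of the product. -/
def Change (cs : CoxeterSystem M W) (u : ℕ → W) (t : W) (i : ℕ) : Prop :=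
  ¬ (cs.length (t * pp u i) < cs.length (pp u i) ↔
    cs.length (t * pp u (i + 1)) < cs.length (pp u (i + 1)))

lemma change_iff {t : W} (ht : cs.IsReflection t) (u : ℕ → W) (i : ℕ) :
    Change cs u t i ↔ cs.length ((pp u i)⁻¹ * t * pp u i * u i) < cs.length (u i) :=
  (length_conj_mul_lt_iff ht _ _).symm

lemma Additive.change_unique {u : ℕ → W} {n i j : ℕ} (h : Additive cs u n) {t : W}
    (hi : Change cs u t i) (hj : Change cs u t j) (hin : i < n) (hjn : j < n) : i = j := by
  wlog hij : i < j generalizing i j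
  · rcases (not_lt.mp hij).eq_or_lt with h' | h'
    · exact h'.symm
    · exact (this hj hi hjn hin h').symm
  exfalso
  have h1 : ∀ {a b}, a ≤ b → b ≤ n → cs.length (t * pp u a) < cs.length (pp u a) →
      cs.length (t * pp u b) < cs.length (pp u b) :=
    fun hab hb hl => (h.of_le hb).shorten hab hl
  unfold Change at hi hj
  by_cases h2 : cs.length (t * pp u i) < cs.length (pp u i)
  · exact hi (iff_of_true h2 (h1 (Nat.le_succ i) (by omega) h2))
  · have h3 : cs.length (t * pp u (i + 1)) < cs.length (pp u (i + 1)) := by tauto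
    exact hj (iff_of_true (h1 (by omega) (by omega) h3) (h1 (by omega) (by omega) h3))

lemma iff_of_no_change {u : ℕ → W} {t : W} {i j : ℕ} (hij : i ≤ j)
    (h : ∀ k, i ≤ k → k < j → ¬ Change cs u t k) :
    cs.length (t * pp u i) < cs.length (pp u i) ↔ cs.length (t * pp u j) < cs.length (pp u j) := by
  induction j, hij using Nat.le_induction with
  | base => rfl
  | succ j hj ih =>
    rw [ih fun k hk hk' => h k hk (by omega)]
    exact not_not.mp (h j hj (by omega))

/-- The sequence `u` with its `i`-th entry multiplied so that the product changes by `t`. -/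
def flipAt (u : ℕ → W) (t : W) (i : ℕ) : ℕ → W :=
  Function.update u i ((pp u i)⁻¹ * t * pp u i * u i)

lemma pp_flipAt_of_le {u : ℕ → W} {t : W} {i k : ℕ} (h : k ≤ i) :
    pp (flipAt u t i) k = pp u k :=
  pp_congr fun j hj => Function.update_of_ne (by omega) _ _

lemma pp_flipAt_of_lt {u : ℕ → W} {t : W} {i k : ℕ} (h : i < k) :
    pp (flipAt u t i) k = t * pp u k := by
  induction k, h using Nat.le_induction with
  | base =>
    rw [pp, pp_flipAt_of_le le_rfl, flipAt, Function.update_self, Nat.succ_eq_add_one, pp]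
    group
  | succ k hk ih => rw [pp, ih, flipAt, Function.update_of_ne (by omega), pp, mul_assoc]

lemma change_flipAt {u : ℕ → W} {t : W} (ht : cs.IsReflection t) {i j : ℕ} (hij : i ≠ j) :
    Change cs (flipAt u t i) t j ↔ Change cs u t j := by
  have key : ∀ x, cs.length x < cs.length (t * x) ↔ ¬ cs.length (t * x) < cs.length x := by
    intro x
    have := ht.length_mul_right_ne x
    omega
  rcases hij.lt_or_gt with h | h
  · unfold Change
    rw [pp_flipAt_of_lt h, pp_flipAt_of_lt (by omega), ← mul_assoc, ht.mul_self, one_mul,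
      ← mul_assoc, ht.mul_self, one_mul, key, key]
    tauto
  · unfold Change
    rw [pp_flipAt_of_le h.le, pp_flipAt_of_le (by omega)]

end Changes

section QPoset

variable {B W : Type} [Group W] {M : CoxeterMatrix B} (cs : CoxeterSystem M W) (dem : W → W → W)
  {n : ℕ}

/-- The entries of an element of `W × Wⁿ` indexed by `some`, extended by `1`. -/
def sq (z : Option (Fin n) → W) (k : ℕ) : W := if h : k < n then z (some ⟨k, h⟩) else 1

/-- The directions of the factors of `W × Wⁿ`: the first factor is reversed. -/
def sg (n : ℕ) : Option (Fin n) → Bool := Option.isSome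

/-- The elements of the poset, as functions. -/
def InQ (z : Option (Fin n) → W) : Prop := Br cs (z none) (dpp dem (sq z) n)

/-- The greatest lower bound, in a suitable order, of the minimal elements below `z`. -/
def gam (z : Option (Fin n) → W) : Option (Fin n) → W
  | none => dpp dem (sq z) n
  | some i => cg dem (sq z) i

variable {cs dem} {z z' : Option (Fin n) → W}

lemma sq_of_lt (z : Option (Fin n) → W) {k : ℕ} (h : k < n) : sq z k = z (some ⟨k, h⟩) :=
  dif_pos h

lemma sq_gam {k : ℕ} (h : k < n) : sq (gam dem z) k = cg dem (sq z) k := sq_of_lt _ h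

lemma prk_sg (z : Option (Fin n) → W) :
    prk cs (sg n) z = (lsum cs (sq z) n : ℤ) - cs.length (z none) := by
  have h : ∀ i : Fin n, drk cs (sg n (some i)) (z (some i)) = (cs.length (sq z i) : ℤ) := by
    intro i
    rw [sq_of_lt z i.2]
    rfl
  rw [prk, Fintype.sum_option, Finset.sum_congr rfl fun i _ => h i,
    Finset.sum_fin_eq_sum_range, lsum, Nat.cast_sum, sub_eq_neg_add]
  congr 1
  exact Finset.sum_congr rfl fun k hk => by simp [Finset.mem_range.mp hk]

lemma ple_sg : PLe cs (sg n) z z' ↔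
    Br cs (z' none) (z none) ∧ ∀ i : Fin n, Br cs (z (some i)) (z' (some i)) :=
  ⟨fun h => ⟨h none, fun i => h (some i)⟩, fun h c => by
    cases c with
    | none => exact h.1
    | some i => exact h.2 i⟩

lemma PLe.sq (h : PLe cs (sg n) z z') {k : ℕ} (hk : k < n) : Br cs (sq z k) (sq z' k) := by
  rw [sq_of_lt z hk, sq_of_lt z' hk]
  exact h (some ⟨k, hk⟩)

variable (hd : IsDemazure cs dem)
include hd

lemma InQ.mono (hz : InQ cs dem z) (h : PLe cs (sg n) z z') : InQ cs dem z' :=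
  ((ple_sg.mp h).1.trans hz).trans (dpp_mono hd fun _ hk => h.sq hk)

lemma InQ.prk_nonneg (hz : InQ cs dem z) : 0 ≤ prk cs (sg n) z := by
  have h1 := Br.length_le hz
  rw [length_dpp hd] at h1
  have h2 := lsum_cg_le hd (TotPos.sq z) n
  rw [prk_sg]
  omega

lemma InQ.atom (hz : InQ cs dem z) (h : prk cs (sg n) z = 0) :
    z none = pp (sq z) n ∧ Additive cs (sq z) n := by
  have h1 := Br.length_le hz
  rw [prk_sg] at h
  have ha : Additive cs (TotPos.sq z) n := additive_of_length_dpp hd (by omega)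
  have h2 := dpp_eq_pp hd ha
  refine ⟨?_, ha⟩
  rw [InQ, h2] at hz
  refine hz.eq_of_length_le ?_
  rw [ha]
  omega

omit hd in
lemma prk_of_atom (h : z none = pp (sq z) n) (ha : Additive cs (sq z) n) :
    prk cs (sg n) z = 0 := by
  rw [prk_sg, h, ha, sub_self]

lemma inQ_of_none_eq (h : z none = pp (sq z) n) : InQ cs dem z := by
  rw [InQ, h]
  exact pp_br_dpp hd _ _

omit hd in
lemma gam_none_eq : gam dem z none = pp (sq (gam dem z)) n := by
  rw [pp_congr fun k hk => sq_gam hk, pp_cg]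
  rfl

lemma gam_additive : Additive cs (sq (gam dem z)) n := by
  have h := additive_cg hd (sq z) n
  rwa [Additive, ← pp_congr fun k hk => sq_gam hk, ← lsum_congr fun k hk => sq_gam hk] at h

lemma gam_inQ : InQ cs dem (gam dem z) := inQ_of_none_eq hd (gam_none_eq)

lemma gam_prk : prk cs (sg n) (gam dem z) = 0 := prk_of_atom (gam_none_eq) (gam_additive hd)

lemma InQ.gam_ple (hz : InQ cs dem z) : PLe cs (sg n) (gam dem z) z := by
  refine ple_sg.mpr ⟨hz, fun i => ?_⟩
  have := cg_br hd (TotPos.sq z) i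
  rwa [sq_of_lt z i.2] at this

omit hd in
/-- Flipping one factor of the product. -/
lemma sq_update (t : W) {i : ℕ} (hi : i < n) :
    sq (Function.update z (some ⟨i, hi⟩) ((pp (sq z) i)⁻¹ * t * pp (sq z) i * sq z i)) =
      flipAt (sq z) t i := by
  funext k
  by_cases hk : k < n
  · rw [sq_of_lt _ hk]
    by_cases hki : k = i
    · subst hki; simp [flipAt]
    · rw [Function.update_of_ne (by simpa using hki), flipAt, Function.update_of_ne hki,
        sq_of_lt _ hk]
  · have hki : k ≠ i := by omega
    simp [sq, hk, flipAt, hki]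

omit hd in
lemma Pstep.flip {a : Option (Fin n) → W} {i : Fin n} {t : W} (h : Pstep cs (sg n) a (some i) t z)
    (ha : a none = pp (sq a) n) :
    cs.IsReflection (pp (sq z) i * t * (pp (sq z) i)⁻¹) ∧
    z none = pp (sq z) i * t * (pp (sq z) i)⁻¹ * pp (sq z) n ∧
    Change cs (sq z) (pp (sq z) i * t * (pp (sq z) i)⁻¹) i ∧
    a = Function.update z (some i) ((pp (sq z) i)⁻¹ *
      (pp (sq z) i * t * (pp (sq z) i)⁻¹) * pp (sq z) i * sq z i) := by
  obtain ⟨⟨ht, h1, h2⟩, h3⟩ := h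
  have ht' := ht.conj (pp (TotPos.sq z) i)
  have e : ∀ x : W, (pp (TotPos.sq z) i)⁻¹ * (pp (TotPos.sq z) i * t * (pp (TotPos.sq z) i)⁻¹) *
      pp (TotPos.sq z) i * x = t * x := fun x => by group
  have h4 : a = Function.update z (some i) ((pp (TotPos.sq z) i)⁻¹ *
      (pp (TotPos.sq z) i * t * (pp (TotPos.sq z) i)⁻¹) * pp (TotPos.sq z) i *
      TotPos.sq z i) := by
    rw [e, sq_of_lt z i.2]
    funext c
    by_cases hc : c = some i
    · subst hc
      rw [Function.update_self, h1, ← mul_assoc, ht.mul_self, one_mul]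
    · rw [Function.update_of_ne hc, h3 c hc]
  refine ⟨ht', ?_, ?_, h4⟩
  · rw [h3 none (by simp), ha]
    have h5 : TotPos.sq a = flipAt (TotPos.sq z)
        (pp (TotPos.sq z) i * t * (pp (TotPos.sq z) i)⁻¹) i := by
      rw [← sq_update _ i.2, ← h4]
    rw [h5, pp_flipAt_of_lt i.2]
  · rw [change_iff ht', e, sq_of_lt z i.2, h1, ← mul_assoc, ht.mul_self, one_mul]
    simp only [sg, Option.isSome_some, drk] at h2
    rw [h1] at h2
    omega

/-- A change of direction yields a minimal element. -/
lemma flip_atom (h1 : prk cs (sg n) z = 1) {t : W} (ht : cs.IsReflection t)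
    (hzt : z none = t * pp (sq z) n) {i : ℕ} (hi : i < n) (hc : Change cs (sq z) t i) :
    let a := Function.update z (some ⟨i, hi⟩) ((pp (sq z) i)⁻¹ * t * pp (sq z) i * sq z i)
    InQ cs dem a ∧ prk cs (sg n) a = 0 ∧ PLe cs (sg n) a z ∧ a none = z none ∧
      sq a = flipAt (sq z) t i ∧ a (some ⟨i, hi⟩) ≠ z (some ⟨i, hi⟩) ∧
      ∀ c, c ≠ some ⟨i, hi⟩ → a c = z c := by
  intro a
  have h2 : TotPos.sq a = flipAt (TotPos.sq z) t i := sq_update t hi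
  have h3 : a none = z none := Function.update_of_ne (by simp) _ _
  have hs : cs.IsReflection ((pp (TotPos.sq z) i)⁻¹ * t * pp (TotPos.sq z) i) := by
    simpa using ht.conj (pp (TotPos.sq z) i)⁻¹
  have hl := (change_iff ht _ _).mp hc
  have hai : a (some ⟨i, hi⟩) = (pp (TotPos.sq z) i)⁻¹ * t * pp (TotPos.sq z) i *
    TotPos.sq z i := Function.update_self _ _ _
  have hzi := sq_of_lt z hi
  have hoth : ∀ c, c ≠ some ⟨i, hi⟩ → a c = z c := fun c hc => Function.update_of_ne hc _ _
  have h4 : PLe cs (sg n) a z := by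
    refine ple_sg.mpr ⟨by rw [h3]; exact Br.refl _, fun j => ?_⟩
    by_cases hj : j = ⟨i, hi⟩
    · subst hj
      rw [hai, ← hzi]
      refine Edge.br ⟨_, hs, ?_, hl⟩
      rw [← mul_assoc, hs.mul_self, one_mul]
    · rw [hoth _ (by simpa using hj)]
      exact Br.refl _
  have hne : a (some ⟨i, hi⟩) ≠ z (some ⟨i, hi⟩) := by
    intro he
    rw [← hai, he, hzi] at hl
    exact lt_irrefl _ hl
  have h5 : InQ cs dem a := inQ_of_none_eq hd (by rw [h3, h2, pp_flipAt_of_lt hi, hzt])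
  have h6 := h5.prk_nonneg hd
  have h7 := h4.prk_lt (fun he => hne (congrFun he _))
  exact ⟨h5, by omega, h4, h3, h2, hne, hoth⟩

/-- Elements of rank one lie above exactly two minimal elements. -/
lemma InQ.exists_two_atoms (hz : InQ cs dem z) (h1 : prk cs (sg n) z = 1) :
    ∃ a b, a ≠ b ∧ ∀ c, (InQ cs dem c ∧ prk cs (sg n) c = 0 ∧ PLe cs (sg n) c z) ↔
      c = a ∨ c = b := by
  have hrank := prk_sg (cs := cs) z
  rw [h1] at hrank
  by_cases hadd : Additive cs (sq z) n
  · have hle : Br cs (z none) (pp (sq z) n) := by rw [← dpp_eq_pp hd hadd]; exact hz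
    obtain ⟨t, y, hty, hy⟩ := DBr.exists_dstep (b := true) hle (by
      intro he; rw [he, hadd] at hrank; omega)
    have hy' : y = pp (sq z) n := by
      refine Br.eq_of_length_le hy ?_
      have := hty.2.2
      simp only [drk] at this
      rw [hadd]; omega
    subst hy'
    have ht := hty.1
    have hzt := hty.eq_mul
    have hend : cs.length (t * pp (sq z) n) < cs.length (pp (sq z) n) := by
      rw [← hzt, hadd]; omega
    obtain ⟨i, hi, hc⟩ : ∃ i < n, Change cs (sq z) t i := by
      by_contra! hno
      have := (iff_of_no_change (u := sq z) (Nat.zero_le n) fun k _ hk => hno k hk).mpr hend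
      simp [pp] at this
    obtain ⟨g1, g2, g3, g4, g5, g6, g7⟩ := flip_atom hd h1 ht hzt hi hc
    set a := Function.update z (some ⟨i, hi⟩) ((pp (sq z) i)⁻¹ * t * pp (sq z) i * sq z i)
    set b := Function.update z none (pp (sq z) n) with hb
    have hsb : sq b = sq z := by
      funext k; by_cases hk : k < n <;> simp [sq, hk, hb]
    have hbn : b none = pp (sq b) n := by rw [hsb, hb, Function.update_self]
    refine ⟨a, b, ?_, fun c => ⟨?_, ?_⟩⟩
    · intro he
      have := congrFun he (some ⟨i, hi⟩)
      rw [hb, Function.update_of_ne (by simp)] at this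
      exact g6 this
    · rintro ⟨c1, c2, c3⟩
      obtain ⟨d, s, hs⟩ := c3.exists_pstep_of_prk (by rw [c2, h1, zero_add])
      have c4 := c1.atom hd c2
      cases d with
      | none =>
        right
        have : ∀ j, c (some j) = z (some j) := fun j => (hs.2 (some j) (by simp)).symm
        have hsc : sq c = sq z := by
          funext k; by_cases hk : k < n <;> simp [sq, hk, this]
        funext e
        cases e with
        | none => rw [c4.1, hbn, hsb, hsc]
        | some j => rw [this, hb, Function.update_of_ne (by simp)]
      | some j =>
        left
        obtain ⟨k1, k2, k3, k4⟩ := hs.flip c4.1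
        rw [hzt] at k2
        have k5 := (mul_right_cancel k2).symm
        rw [k5] at k3 k4
        obtain rfl : i = j := hadd.change_unique hc k3 hi j.2
        exact k4
    · rintro (rfl | rfl)
      · exact ⟨g1, g2, g3⟩
      · refine ⟨inQ_of_none_eq hd hbn, prk_of_atom hbn (hsb ▸ hadd), ple_sg.mpr ⟨?_, fun j => ?_⟩⟩
        · rw [hbn, hsb]; exact hle
        · rw [hb, Function.update_of_ne (by simp)]; exact Br.refl _
  · have hg := hz.gam_ple hd
    obtain ⟨d, s, hs⟩ := hg.exists_pstep_of_prk (by rw [gam_prk hd, h1, zero_add])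
    have hnone : ∀ {c : Option (Fin n) → W} {s d}, InQ cs dem c → prk cs (sg n) c = 0 →
        Pstep cs (sg n) c d s z → ∃ j, d = some j := by
      intro c s d c1 c2 hs
      cases d with
      | some j => exact ⟨j, rfl⟩
      | none =>
        have : ∀ j, c (some j) = z (some j) := fun j => (hs.2 (some j) (by simp)).symm
        have hsc : sq c = sq z := by
          funext k; by_cases hk : k < n <;> simp [sq, hk, this]
        exact absurd (hsc ▸ (c1.atom hd c2).2) hadd
    obtain ⟨i, rfl⟩ := hnone (gam_inQ hd) (gam_prk hd) hs
    obtain ⟨ht, hzt, hc, -⟩ := hs.flip (gam_none_eq)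
    set t := pp (sq z) i * s * (pp (sq z) i)⁻¹
    have hend : ¬ cs.length (t * pp (sq z) n) < cs.length (pp (sq z) n) := by
      have h2 := length_pp_le (cs := cs) (sq z) n
      have h3 : cs.length (pp (sq z) n) ≠ lsum cs (sq z) n := hadd
      rw [← hzt]; omega
    have hthree : ∀ {j k l : ℕ}, Change cs (sq z) t j → Change cs (sq z) t k →
        Change cs (sq z) t l → j < n → k < n → l < n → j ≠ k → j ≠ l → k = l := by
      intro j k l hj hk hl hjn hkn hln hjk hjl
      obtain ⟨g1, g2, g3, g4, g5, g6, g7⟩ := flip_atom hd h1 ht hzt hjn hj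
      have hA := (g1.atom hd g2).2
      rw [g5] at hA
      exact hA.change_unique ((change_flipAt ht hjk).mpr hk) ((change_flipAt ht hjl).mpr hl)
        hkn hln
    obtain ⟨j, hj, hij, hcj⟩ : ∃ j < n, j ≠ i ∧ Change cs (sq z) t j := by
      by_contra! hno
      have e1 := iff_of_no_change (cs := cs) (u := sq z) (t := t) (Nat.zero_le (i : ℕ))
        fun k _ hk => hno k (by omega) (by omega)
      have e2 := iff_of_no_change (cs := cs) (u := sq z) (t := t) (Nat.succ_le_of_lt i.2)
        fun k hk hk' => hno k hk' (by omega)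
      have e3 : ¬ cs.length (t * pp (sq z) 0) < cs.length (pp (sq z) 0) := by simp [pp]
      rw [e1] at e3
      rw [← e2] at hend
      exact hc (iff_of_false e3 hend)
    obtain ⟨g1, g2, g3, g4, g5, g6, g7⟩ := flip_atom hd h1 ht hzt i.2 hc
    obtain ⟨k1, k2, k3, k4, k5, k6, k7⟩ := flip_atom hd h1 ht hzt hj hcj
    refine ⟨Function.update z (some i) ((pp (sq z) i)⁻¹ * t * pp (sq z) i * sq z i),
      Function.update z (some ⟨j, hj⟩) ((pp (sq z) j)⁻¹ * t * pp (sq z) j * sq z j),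
      ?_, fun c => ⟨?_, ?_⟩⟩
    rotate_left 2
    · rintro (rfl | rfl)
      · exact ⟨g1, g2, g3⟩
      · exact ⟨k1, k2, k3⟩
    · intro he
      have := g7 (some ⟨j, hj⟩) (by simpa [Fin.ext_iff] using hij)
      rw [congrFun he] at this
      exact k6 this
    · rintro ⟨c1, c2, c3⟩
      obtain ⟨d, s', hs'⟩ := c3.exists_pstep_of_prk (by rw [c2, h1, zero_add])
      obtain ⟨l, rfl⟩ := hnone c1 c2 hs'
      obtain ⟨m1, m2, m3, m4⟩ := hs'.flip (c1.atom hd c2).1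
      rw [hzt] at m2
      have m5 := (mul_right_cancel m2).symm
      rw [m5] at m3 m4
      by_cases hl : (i : ℕ) = l
      · obtain rfl : i = l := Fin.ext hl
        exact Or.inl m4
      · obtain rfl : j = l := hthree hc hcj m3 i.2 hj l.2 (Ne.symm hij) hl
        exact Or.inr m4

end QPoset

section GradedPosets

variable {α : Type*} {r : α → α → Prop} {rk : α → ℕ}

/-- A partial order graded by a rank function. -/
structure Graded (r : α → α → Prop) (rk : α → ℕ) : Prop where
  refl : ∀ x, r x x
  trans : ∀ {x y z}, r x y → r y z → r x z
  rk_le : ∀ {x y}, r x y → rk x ≤ rk y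
  eq_of_rk_le : ∀ {x y}, r x y → rk y ≤ rk x → x = y
  exists_succ : ∀ {x y}, r x y → rk x < rk y → ∃ z, r x z ∧ r z y ∧ rk z = rk x + 1

lemma Graded.covR_iff (hg : Graded r rk) {x y : α} : CovR r x y ↔ r x y ∧ rk y = rk x + 1 := by
  constructor
  · rintro ⟨h1, h2, h3⟩
    refine ⟨h1, ?_⟩
    have h4 : rk x < rk y := by
      by_contra h
      exact h2 (hg.eq_of_rk_le h1 (not_lt.mp h))
    obtain ⟨z, h5, h6, h7⟩ := hg.exists_succ h1 h4
    rcases h3 z h5 h6 with rfl | rfl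
    · omega
    · exact h7
  · rintro ⟨h1, h2⟩
    refine ⟨h1, by rintro rfl; omega, fun z h3 h4 => ?_⟩
    have h5 := hg.rk_le h3
    have h6 := hg.rk_le h4
    rcases h5.eq_or_lt with h | h
    · exact Or.inl (hg.eq_of_rk_le h3 h.ge).symm
    · exact Or.inr (hg.eq_of_rk_le h4 (by omega))

lemma Graded.length_eq (hg : Graded r rk) {x y : α} {l : List α} (h : IsMaxChainList r x y l) :
    l.length + rk x = rk y + 1 := by
  obtain ⟨h1, h2, h3⟩ := h
  induction l generalizing x with
  | nil => simp at h2
  | cons a l ih =>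
    obtain rfl : a = x := by simpa using h2
    cases l with
    | nil =>
      obtain rfl : a = y := by simpa using h3
      simp [add_comm]
    | cons b l =>
      have h4 := (List.isChain_cons_cons.mp h1)
      have h5 := ih h4.2 rfl (by simpa using h3)
      have h6 := (hg.covR_iff.mp h4.1).2
      simp only [List.length_cons] at h5 ⊢
      omega

lemma Graded.pureR (hg : Graded r rk) : PureR r := by
  intro x y hxy
  refine ⟨?_, fun l l' hl hl' => ?_⟩
  · induction hn : rk y - rk x generalizing x with
    | zero =>
      obtain rfl := hg.eq_of_rk_le hxy (by omega)
      exact ⟨[x], List.isChain_singleton _, rfl, rfl⟩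
    | succ n ih =>
      obtain ⟨z, h1, h2, h3⟩ := hg.exists_succ hxy (by omega)
      obtain ⟨l, h4, h5, h6⟩ := ih z h2 (by omega)
      refine ⟨x :: l, List.isChain_cons.mpr ⟨fun a ha => ?_, h4⟩, rfl, ?_⟩
      · rw [h5] at ha
        obtain rfl : z = a := by simpa using ha
        exact hg.covR_iff.mpr ⟨h1, h3⟩
      · rw [List.getLast?_cons, h6]; rfl
  · have h1 := hg.length_eq hl
    have h2 := hg.length_eq hl'
    omega

lemma Graded.thinR (hg : Graded r rk)
    (h : ∀ x y, r x y → rk y = rk x + 2 → ∃ a b, a ≠ b ∧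
      ∀ z, (r x z ∧ r z y ∧ rk z = rk x + 1) ↔ z = a ∨ z = b) : ThinR r := by
  rintro x y ⟨z, hxz, hzy⟩
  obtain ⟨h1, h2⟩ := hg.covR_iff.mp hxz
  obtain ⟨h3, h4⟩ := hg.covR_iff.mp hzy
  have hxy := hg.trans h1 h3
  have hr : rk y = rk x + 2 := by omega
  obtain ⟨a, b, hab, hz⟩ := h x y hxy hr
  have ha := (hz a).mpr (Or.inl rfl)
  have hb := (hz b).mpr (Or.inr rfl)
  have hne : ∀ {u v : α}, rk u ≠ rk v → u ≠ v := fun h he => h (congrArg rk he)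
  have e : {z | r x z ∧ r z y} = {x, y, a, b} := by
    ext w
    simp only [Set.mem_ofPred_eq, Set.mem_insert_iff, Set.mem_singleton_iff]
    constructor
    · rintro ⟨k1, k2⟩
      have k3 := hg.rk_le k1
      have k4 := hg.rk_le k2
      by_cases k5 : rk w ≤ rk x
      · exact Or.inl (hg.eq_of_rk_le k1 k5).symm
      by_cases k6 : rk y ≤ rk w
      · exact Or.inr (Or.inl (hg.eq_of_rk_le k2 k6))
      · exact Or.inr (Or.inr ((hz w).mp ⟨k1, k2, by omega⟩))
    · rintro (rfl | rfl | rfl | rfl)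
      · exact ⟨hg.refl _, hxy⟩
      · exact ⟨hxy, hg.refl _⟩
      · exact ⟨ha.1, ha.2.1⟩
      · exact ⟨hb.1, hb.2.1⟩
  rw [e, Set.ncard_insert_of_notMem, Set.ncard_insert_of_notMem, Set.ncard_pair hab]
  · simp only [Set.mem_insert_iff, Set.mem_singleton_iff, not_or]
    exact ⟨hne (by omega), hne (by omega)⟩
  · simp only [Set.mem_insert_iff, Set.mem_singleton_iff, not_or]
    exact ⟨hne (by omega), hne (by omega), hne (by omega)⟩

/-- A saturated chain from the bottom to `x`, listed by rank. -/
def IsFlag (r : α → α → Prop) (rk : α → ℕ) (x : α) (f : ℕ → α) : Prop :=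
  (∀ k ≤ rk x, rk (f k) = k) ∧ (∀ k < rk x, r (f k) (f (k + 1))) ∧ ∀ k, rk x ≤ k → f k = x

open Classical in
/-- The elements of a flag. -/
def flagSet (rk : α → ℕ) (x : α) (f : ℕ → α) : Finset α := (Finset.range (rk x + 1)).image f

lemma mem_flagSet {x a : α} {f : ℕ → α} : a ∈ flagSet rk x f ↔ ∃ k ≤ rk x, f k = a := by
  simp [flagSet]

variable {x : α} {f g : ℕ → α}

lemma IsFlag.le (hg : Graded r rk) (hf : IsFlag r rk x f) {i j : ℕ} (hij : i ≤ j) :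
    r (f i) (f j) := by
  induction j, hij using Nat.le_induction with
  | base => exact hg.refl _
  | succ j hj ih =>
    by_cases h : j < rk x
    · exact hg.trans ih (hf.2.1 j h)
    · rw [hf.2.2 (j + 1) (by omega), ← hf.2.2 j (by omega)]; exact ih

lemma IsFlag.le_top (hg : Graded r rk) (hf : IsFlag r rk x f) (i : ℕ) : r (f i) x := by
  have := hf.le hg (le_max_left i (rk x))
  rwa [hf.2.2 _ (le_max_right _ _)] at this

lemma flagSet_injOn (hf : IsFlag r rk x f) (hf' : IsFlag r rk x g)
    (h : flagSet rk x f = flagSet rk x g) : f = g := by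
  funext k
  by_cases hk : k ≤ rk x
  · have h1 : f k ∈ flagSet rk x g := h ▸ mem_flagSet.mpr ⟨k, hk, rfl⟩
    obtain ⟨j, hj, he⟩ := mem_flagSet.mp h1
    have h2 := hf.1 k hk
    rw [← he, hf'.1 j hj] at h2
    rw [← he, h2]
  · rw [hf.2.2 k (by omega), hf'.2.2 k (by omega)]

lemma eq_of_rk_of_isChain (hg : Graded r rk) {c : Set α} (hc : IsChain r c) {a b : α} (ha : a ∈ c)
    (hb : b ∈ c) (h : rk a = rk b) : a = b := by
  by_contra hne
  rcases hc ha hb hne with h' | h'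
  · exact hne (hg.eq_of_rk_le h' h.ge)
  · exact hne (hg.eq_of_rk_le h' h.le).symm

lemma rel_of_rk_of_isChain (hg : Graded r rk) {c : Set α} (hc : IsChain r c) {a b : α} (ha : a ∈ c)
    (hb : b ∈ c) (h : rk a ≤ rk b) : r a b := by
  by_cases hab : a = b
  · rw [hab]; exact hg.refl _
  rcases hc ha hb hab with h' | h'
  · exact h'
  · exact absurd (hg.eq_of_rk_le h' h).symm hab

lemma IsMaxChainFinset.mem {s : Set α} {c : Finset α} (hc : IsMaxChainFinset r s c) {z : α}
    (hz : z ∈ s) (h : ∀ a ∈ c, r a z ∨ r z a) : z ∈ c := by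
  classical
  rw [hc.2.2 (insert z c) ?_ ?_ (Finset.subset_insert _ _)]
  · exact Finset.mem_insert_self _ _
  · rw [Finset.coe_insert]; exact Set.insert_subset hz hc.1
  · rw [Finset.coe_insert]
    exact hc.2.1.insert fun b hb _ => (h b hb).symm

lemma IsMaxChainFinset.exists_rk (hg : Graded r rk) {o : α} (ho : ∀ z, r o z) (ho' : rk o = 0)
    {c : Finset α} (hc : IsMaxChainFinset r {z | r z x} c) {k : ℕ} (hk : k ≤ rk x) :
    ∃ a ∈ c, rk a = k := by
  have hxc : x ∈ c := hc.mem (hg.refl x) fun a ha => Or.inl (hc.1 ha)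
  have hoc : o ∈ c := hc.mem (ho x) fun a _ => Or.inr (ho a)
  by_contra! hno
  obtain ⟨a, ha, hamax⟩ := (c.filter fun a => rk a < k).exists_max_image rk
    ⟨o, Finset.mem_filter.mpr ⟨hoc, by have := hno o hoc; omega⟩⟩
  obtain ⟨b, hb, hbmin⟩ := (c.filter fun a => k < rk a).exists_min_image rk
    ⟨x, Finset.mem_filter.mpr ⟨hxc, by have := hno x hxc; omega⟩⟩
  rw [Finset.mem_filter] at ha hb
  obtain ⟨z, h1, h2, h3⟩ := hg.exists_succ
    (rel_of_rk_of_isChain hg hc.2.1 ha.1 hb.1 (by omega)) (by omega : rk a < rk b)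
  have hz : z ∈ c := by
    refine hc.mem (hg.trans h2 (hc.1 hb.1)) fun e he => ?_
    rcases (hno e he).lt_or_gt with h | h
    · exact Or.inl (hg.trans (rel_of_rk_of_isChain hg hc.2.1 he ha.1
        (hamax e (Finset.mem_filter.mpr ⟨he, h⟩))) h1)
    · exact Or.inr (hg.trans h2 (rel_of_rk_of_isChain hg hc.2.1 hb.1 he
        (hbmin e (Finset.mem_filter.mpr ⟨he, h⟩))))
  have h4 := hamax z (Finset.mem_filter.mpr ⟨hz, by have := hno z hz; omega⟩)
  omega

lemma isMaxChainFinset_iff (hg : Graded r rk) {o : α} (ho : ∀ z, r o z) (ho' : rk o = 0)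
    {c : Finset α} :
    IsMaxChainFinset r {z | r z x} c ↔ ∃ f, IsFlag r rk x f ∧ flagSet rk x f = c := by
  classical
  constructor
  · intro hc
    have h := fun k (hk : k ≤ rk x) => hc.exists_rk hg ho ho' hk
    choose F hF hF' using h
    have hxc : x ∈ c := hc.mem (hg.refl x) fun a ha => Or.inl (hc.1 ha)
    have hf : IsFlag r rk x fun k => if hk : k ≤ rk x then F k hk else x := by
      refine ⟨fun k hk => ?_, fun k hk => ?_, fun k hk => ?_⟩
      · simp only [hk, dif_pos, hF']
      · dsimp only
        rw [dif_pos hk.le, dif_pos (Nat.succ_le_of_lt hk)]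
        exact rel_of_rk_of_isChain hg hc.2.1 (hF _ _) (hF _ _) (by rw [hF', hF']; omega)
      · dsimp only
        split_ifs with h
        · exact eq_of_rk_of_isChain hg hc.2.1 (hF _ _) hxc (by rw [hF']; omega)
        · rfl
    refine ⟨_, hf, ?_⟩
    ext a
    rw [mem_flagSet]
    constructor
    · rintro ⟨k, hk, rfl⟩
      rw [dif_pos hk]
      exact hF k hk
    · intro ha
      have h1 := hg.rk_le (hc.1 ha)
      refine ⟨rk a, h1, ?_⟩
      rw [dif_pos h1]
      exact eq_of_rk_of_isChain hg hc.2.1 (hF _ _) ha (hF' _ _)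
  · rintro ⟨f, hf, rfl⟩
    refine ⟨fun a ha => ?_, fun a ha b hb _ => ?_, fun c' h1 h2 h3 => ?_⟩
    · obtain ⟨k, hk, rfl⟩ := mem_flagSet.mp ha
      exact hf.le_top hg k
    · obtain ⟨k, hk, rfl⟩ := mem_flagSet.mp ha
      obtain ⟨j, hj, rfl⟩ := mem_flagSet.mp hb
      rcases le_total k j with h | h
      · exact Or.inl (hf.le hg h)
      · exact Or.inr (hf.le hg h)
    · refine h3.antisymm fun a ha => ?_
      have h4 := hg.rk_le (h1 ha)
      have h5 : f (rk a) ∈ flagSet rk x f := mem_flagSet.mpr ⟨_, h4, rfl⟩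
      rw [eq_of_rk_of_isChain hg h2 ha (h3 h5) (hf.1 _ h4).symm]
      exact h5

/-- An exchange property for the flags, ordered by a key, gives a shelling. -/
theorem Graded.shellableR (hg : Graded r rk) {o : α} (ho : ∀ z, r o z) (ho' : rk o = 0)
    (hfin : {z | r z x}.Finite) {K : Type*} [LinearOrder K] (key : (ℕ → α) → K)
    (hinj : ∀ f g, IsFlag r rk x f → IsFlag r rk x g → key f = key g → f = g)
    (hex : ∀ f g, IsFlag r rk x f → IsFlag r rk x g → key g < key f →
      ∃ m ≤ rk x, g m ≠ f m ∧ ∃ h, IsFlag r rk x h ∧ key h < key f ∧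
        ∀ k ≤ rk x, k ≠ m → h k = f k) :
    ShellableR r {z | r z x} := by
  classical
  have hflags : {f | IsFlag r rk x f}.Finite := by
    refine Set.Finite.of_finite_image (f := flagSet rk x) ?_ fun f hf g hf' h =>
      flagSet_injOn hf hf' h
    refine hfin.toFinset.powerset.finite_toSet.subset ?_
    rintro _ ⟨f, hf, rfl⟩
    refine Finset.mem_coe.mpr (Finset.mem_powerset.mpr fun a ha => ?_)
    obtain ⟨k, hk, rfl⟩ := mem_flagSet.mp ha
    exact hfin.mem_toFinset.mpr (IsFlag.le_top hg hf k)
  set T : Finset K := hflags.toFinset.image key with hT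
  let e := T.orderEmbOfFin rfl
  have he : ∀ k, ∃ f, IsFlag r rk x f ∧ key f = e k := by
    intro k
    obtain ⟨f, hf, h⟩ := Finset.mem_image.mp (Finset.orderEmbOfFin_mem T rfl k)
    exact ⟨f, hflags.mem_toFinset.mp hf, h⟩
  choose G hG hGe using he
  have hsurj : ∀ f, IsFlag r rk x f → ∃ k, G k = f := by
    intro f hf
    have h1 : key f ∈ Set.range e := by
      rw [Finset.range_orderEmbOfFin]
      simpa [hT] using ⟨f, hf, rfl⟩
    obtain ⟨k, hk⟩ := h1
    exact ⟨k, hinj _ _ (hG k) hf (by rw [hGe, hk])⟩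
  have hlt : ∀ {i k}, key (G i) < key (G k) ↔ i < k := by
    intro i k
    rw [hGe, hGe]
    exact e.lt_iff_lt
  refine ⟨T.card, fun k => flagSet rk x (G k), ?_, ?_, ?_⟩
  · intro i k h
    have h1 := flagSet_injOn (hG i) (hG k) h
    exact e.injective (by rw [← hGe, ← hGe, h1])
  · intro c
    rw [isMaxChainFinset_iff hg ho ho']
    constructor
    · rintro ⟨f, hf, rfl⟩
      obtain ⟨k, rfl⟩ := hsurj f hf
      exact ⟨k, rfl⟩
    · rintro ⟨k, rfl⟩
      exact ⟨G k, hG k, rfl⟩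
  · intro k hk
    have hex' : ∀ i, i < k → ∃ m ≤ rk x, G i m ≠ G k m ∧ ∃ h, IsFlag r rk x h ∧
        key h < key (G k) ∧ ∀ j ≤ rk x, j ≠ m → h j = G k j :=
      fun i hi => hex _ _ (hG k) (hG i) (hlt.mpr hi)
    refine ⟨(flagSet rk x (G k)).filter fun a => ∃ m ≤ rk x, G k m = a ∧
      ∃ h, IsFlag r rk x h ∧ key h < key (G k) ∧ ∀ j ≤ rk x, j ≠ m → h j = G k j, ?_,
      Finset.filter_subset _ _, fun c => ⟨?_, ?_⟩⟩
    · have h0 : (⟨0, hk.trans k.2⟩ : Fin T.card) < k := hk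
      obtain ⟨m, hm, -, h⟩ := hex' _ h0
      exact ⟨_, Finset.mem_filter.mpr ⟨mem_flagSet.mpr ⟨m, hm, rfl⟩, m, hm, rfl, h⟩⟩
    · rintro ⟨h1, i, hi, h2⟩
      obtain ⟨m, hm, hne, h⟩ := hex' i hi
      refine ⟨_, Finset.mem_filter.mpr ⟨mem_flagSet.mpr ⟨m, hm, rfl⟩, m, hm, rfl, h⟩,
        fun a ha => ⟨h1 ha, ?_⟩⟩
      rintro rfl
      obtain ⟨j, hj, he⟩ := mem_flagSet.mp (h2 ha)
      have h3 := (hG i).1 j hj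
      rw [he, (hG k).1 m hm] at h3
      subst h3
      exact hne he
    · rintro ⟨a, ha, hca⟩
      obtain ⟨-, m, hm, rfl, h, hh, hlt', hag⟩ := Finset.mem_filter.mp ha
      refine ⟨fun b hb => (hca hb).1, ?_⟩
      obtain ⟨i, rfl⟩ := hsurj h hh
      refine ⟨i, hlt.mp hlt', fun b hb => ?_⟩
      obtain ⟨h1, h2⟩ := hca hb
      obtain ⟨j, hj, rfl⟩ := mem_flagSet.mp h1
      refine mem_flagSet.mpr ⟨j, hj, hag j hj ?_⟩
      rintro rfl
      exact h2 rfl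

end GradedPosets

section GoodEdges

variable {B W : Type} [Group W] {M : CoxeterMatrix B} {cs : CoxeterSystem M W} {dem : W → W → W}
  {n : ℕ}

lemma Br.of_mul_left {p u y : W} (hu : cs.length (p * u) = cs.length p + cs.length u)
    (hy : cs.length (p * y) = cs.length p + cs.length y) (h : Br cs (p * u) (p * y)) :
    Br cs u y := by
  obtain ⟨ω, hω, rfl⟩ := cs.exists_isReduced p
  induction ω generalizing u y with
  | nil => simpa using h
  | cons i ω ih =>
    have hω' : cs.IsReduced ω := hω.drop 1
    have key : ∀ v, cs.length (cs.wordProd (i :: ω) * v) =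
        cs.length (cs.wordProd (i :: ω)) + cs.length v →
        cs.length (cs.wordProd ω * v) = cs.length (cs.wordProd ω) + cs.length v ∧
        ¬ cs.IsLeftDescent (cs.wordProd ω * v) i := by
      intro v hv
      have h1 := cs.length_mul_le (cs.wordProd ω) v
      have h2 : cs.length (cs.wordProd (i :: ω)) = ω.length + 1 := hω
      have h3 : cs.length (cs.wordProd ω) = ω.length := hω'
      rw [h2, cs.wordProd_cons, mul_assoc] at hv
      have h4 := cs.length_simple_mul (cs.wordProd ω * v) i
      rw [CoxeterSystem.IsLeftDescent]
      omega
    obtain ⟨h1, h2⟩ := key u hu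
    obtain ⟨h3, h4⟩ := key y hy
    refine ih hω' h1 h3 ?_
    have h5 := h.mn i
    rwa [cs.wordProd_cons, mul_assoc, mul_assoc, mn_simple_mul, mn_simple_mul, mn_of_not h2,
      mn_of_not h4] at h5

lemma hgt_rho_sub {t : W} (ht : cs.IsReflection t) (p x : W) :
    hgt M (rep cs (p * x) rhoVec) - hgt M (rep cs (p * (t * x)) rhoVec) =
      hgt M (rep cs x⁻¹ (rt cs t)) * hgt M (rep cs p (rt cs t)) := by
  have h := congrArg (fun v => hgt M (rep cs p v)) (rep_rho_sub ht x)
  rwa [map_smul, hgt_smul, map_sub, sub_eq_add_neg, hgt_add, hgt_neg, ← sub_eq_add_neg,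
    ← rep_mul_apply, ← rep_mul_apply] at h

lemma hgt_rep_inv_pos {t x : W} (ht : cs.IsReflection t) (h : cs.length x < cs.length (t * x)) :
    0 < hgt M (rep cs x⁻¹ (rt cs t)) :=
  ((rt_isRoot ht).rep _).hgt_pos ((lt_length_refl_mul_iff ht).mp h)

lemma Br.hgt_rho_le {x y : W} (h : Br cs x y) :
    hgt M (rep cs y rhoVec) ≤ hgt M (rep cs x rhoVec) := by
  induction h with
  | refl => exact le_rfl
  | @tail z _ _ h ih =>
    refine le_trans ?_ ih
    obtain ⟨t, ht, rfl, hl⟩ := h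
    have h1 := hgt_rho_sub ht 1 z
    rw [one_mul, one_mul, map_one, Module.End.one_apply] at h1
    have h2 := mul_pos (hgt_rep_inv_pos ht hl) (rt_hgt_pos ht)
    linarith

lemma Path.hgt_rho_le {p u y : W} {L : List W} (h : Path cs u L y)
    (hL : ∀ t ∈ L, ¬ 0 ≤ rep cs p (rt cs t)) :
    hgt M (rep cs (p * u) rhoVec) ≤ hgt M (rep cs (p * y) rhoVec) ∧
      (L ≠ [] → hgt M (rep cs (p * u) rhoVec) < hgt M (rep cs (p * y) rhoVec)) := by
  induction L generalizing u with
  | nil =>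
    obtain rfl : u = y := h
    exact ⟨le_rfl, fun h => absurd rfl h⟩
  | cons t L ih =>
    obtain ⟨ht, hl, h⟩ := h
    have h1 := hgt_rho_sub ht p u
    have h2 := hgt_rep_inv_pos (x := u) ht (by omega)
    have h3 : hgt M (rep cs p (rt cs t)) < 0 := by
      have hr := (rt_isRoot ht).rep p
      have := hr.neg.hgt_pos (neg_nonneg.mpr (hr.not_nonneg_iff.mp (hL t (by simp))))
      rw [hgt_neg] at this
      linarith
    have h4 := mul_neg_of_pos_of_neg h2 h3
    have h5 := (ih h fun s hs => hL s (by simp [hs])).1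
    exact ⟨by linarith, fun _ => by linarith⟩

lemma exists_linearOrder_option (B : Type) :
    ∃ o : LinearOrder (Option B), ∀ b : Option B, o.le none b := by
  classical
  let _ : LinearOrder B := IsWellOrder.linearOrder WellOrderingRel
  exact ⟨inferInstanceAs (LinearOrder (WithBot B)), fun b => bot_le (α := WithBot B) (a := b)⟩

lemma exists_good_step [LinearOrder (Option B)] (hbot : ∀ b : Option B, none ≤ b) {p u y : W}
    (hu : cs.length (p * u) = cs.length p + cs.length u)
    (hy : cs.length (p * y) = cs.length p + cs.length y) (h : Br cs (p * u) (p * y))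
    (hne : u ≠ y) : ∃ t, Dstep cs true u t (t * u) ∧ Br cs (t * u) y ∧
      0 ≤ rep cs p (rt cs t) := by
  obtain ⟨L, ⟨hL, hp⟩, -⟩ := existsUnique_dPath (b := true) p (Br.of_mul_left hu hy h)
  cases L with
  | nil => exact absurd hL hne
  | cons t L =>
    refine ⟨t, hL.1, hL.2.dbr, ?_⟩
    by_contra hbad
    have hr := (dPath_true.mp hL).isReflection
    have hbad' : ∀ s ∈ t :: L, ¬ 0 ≤ rep cs p (rt cs s) := by
      intro s hs hgood
      rcases List.mem_cons.mp hs with rfl | hs'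
      · exact hbad hgood
      have h1 := lbl_lt_of_good_of_bad hbot (hr s hs) (hr t (by simp)) hgood
        (((rt_isRoot (hr t (by simp))).rep p).not_nonneg_iff.mp hbad)
      exact h1.not_gt (List.rel_of_pairwise_cons hp hs')
    exact h.hgt_rho_le.not_gt (((dPath_true.mp hL).hgt_rho_le hbad').2 (by simp))

end GoodEdges

section Atoms

variable {B W : Type} [Group W] {M : CoxeterMatrix B} (cs : CoxeterSystem M W) {dem : W → W → W}
  {n : ℕ}

/-- The minimal elements of the poset. -/
def IsAtomQ (a : Option (Fin n) → W) : Prop := a none = pp (sq a) n ∧ Additive cs (sq a) n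

/-- The sum of the lengths of the partial products. -/
def ppSize (a : Option (Fin n) → W) : ℕ := ∑ k ∈ Finset.range n, cs.length (pp (sq a) (k + 1))

/-- A step changing one of the last `n` entries whose reflection moves the product of the previous
entries up. -/
def GoodStep (a : Option (Fin n) → W) (c : Option (Fin n)) (t : W) : Prop :=
  ∃ i : Fin n, c = some i ∧ 0 ≤ rep cs (pp (sq a) i) (rt cs t)

variable {cs} {a z e : Option (Fin n) → W} (hd : IsDemazure cs dem)
include hd

omit hd in
lemma pp_sq_gam {k : ℕ} (hk : k ≤ n) : pp (sq (gam dem z)) k = dpp dem (sq z) k := by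
  rw [pp_congr fun j hj => sq_gam (hj.trans_le hk), pp_cg]

lemma IsAtomQ.pp_br (ha : IsAtomQ cs a) (h : PLe cs (sg n) a z) {k : ℕ} (hk : k ≤ n) :
    Br cs (pp (sq a) k) (dpp dem (sq z) k) := by
  rw [← dpp_eq_pp hd (ha.2.of_le hk)]
  exact dpp_mono hd fun j hj => h.sq (hj.trans_le hk)

omit hd in
lemma IsAtomQ.eq_gam (ha : IsAtomQ cs a)
    (h : ∀ k < n, pp (sq a) (k + 1) = dpp dem (sq z) (k + 1)) : a = gam dem z := by
  have h' : ∀ k ≤ n, pp (sq a) k = dpp dem (sq z) k := by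
    rintro (_ | k) hk
    · rfl
    · exact h k hk
  funext c
  cases c with
  | none => exact ha.1.trans (h' n le_rfl)
  | some i =>
    have h1 : a (some i) = sq a i := (sq_of_lt a i.2).symm
    rw [h1, gam, cg, ← h i i.2, ← h' i i.2.le, pp, inv_mul_cancel_left]

lemma IsAtomQ.eq_gam_of_ppSize (ha : IsAtomQ cs a) (h : PLe cs (sg n) a z)
    (hs : ppSize cs (gam dem z) ≤ ppSize cs a) : a = gam dem z := by
  have hle : ∀ k ∈ Finset.range n,
      cs.length (pp (sq a) (k + 1)) ≤ cs.length (pp (sq (gam dem z)) (k + 1)) := by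
    intro k hk
    have hk := Finset.mem_range.mp hk
    rw [pp_sq_gam (by omega)]
    exact (ha.pp_br hd h (by omega)).length_le
  have he := (Finset.sum_eq_sum_iff_of_le hle).mp ((Finset.sum_le_sum hle).antisymm hs)
  refine ha.eq_gam fun k hk => (ha.pp_br hd h (by omega)).eq_of_length_le ?_
  rw [he k (Finset.mem_range.mpr hk), pp_sq_gam (by omega)]

lemma ppSize_lt_of_goodStep (ha : IsAtomQ cs a) {c : Option (Fin n)} {t : W}
    (h : Pstep cs (sg n) a c t e) (hg : GoodStep cs a c t) :
    ppSize cs a < ppSize cs (gam dem e) := by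
  obtain ⟨i, rfl, hg⟩ := hg
  refine Finset.sum_lt_sum (fun k hk => ?_) ⟨i, Finset.mem_range.mpr i.2, ?_⟩
  · have hk := Finset.mem_range.mp hk
    rw [pp_sq_gam (by omega)]
    exact (ha.pp_br hd h.ple (by omega)).length_le
  obtain ⟨ht, h1, h2⟩ := h.1
  have hsq : ∀ j : Fin n, j ≠ i → sq e j = sq a j := by
    intro j hj
    rw [sq_of_lt _ j.2, sq_of_lt _ j.2]
    exact h.2 (some j) (by simpa using hj)
  have h3 : dpp dem (sq e) i = pp (sq a) i := by
    rw [← dpp_eq_pp hd (ha.2.of_le i.2.le)]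
    exact dpp_congr fun j hj => hsq ⟨j, hj.trans i.2⟩ (by simp [Fin.ext_iff]; omega)
  have h4 : sq e i = t * sq a i := by
    rw [sq_of_lt _ i.2, sq_of_lt _ i.2]
    exact h1
  have h5 : cs.length (sq a i) < cs.length (t * sq a i) := by
    rw [← h4, sq_of_lt e i.2, sq_of_lt a i.2]
    have h2 : (cs.length (e (some i)) : ℤ) = cs.length (a (some i)) + 1 := h2
    change cs.length (a (some i)) < cs.length (e (some i))
    omega
  rw [pp_sq_gam (by omega), dpp, h3, h4, pp]
  refine lt_of_lt_of_le ?_ (hd.mul_br_dem (pp (sq a) i) (t * sq a i)).length_le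
  set p := pp (sq a) i
  have h6 : p * (t * sq a i) = p * t * p⁻¹ * (p * sq a i) := by group
  rw [h6, lt_length_refl_mul_iff (ht.conj p), rt_conj_of_nonneg ht hg, ← rep_mul_apply,
    mul_inv_rev, inv_mul_cancel_right]
  exact (lt_length_refl_mul_iff ht).mp h5

lemma IsAtomQ.exists_goodStep [LinearOrder (Option B)] (hbot : ∀ b : Option B, none ≤ b)
    (ha : IsAtomQ cs a) (h : PLe cs (sg n) a z) (hne : a ≠ gam dem z) :
    ∃ c t m, Pstep cs (sg n) a c t m ∧ PLe cs (sg n) m z ∧ GoodStep cs a c t := by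
  classical
  have hex : ∃ k, k < n ∧ pp (sq a) (k + 1) ≠ dpp dem (sq z) (k + 1) := by
    by_contra! hno
    exact hne (ha.eq_gam hno)
  obtain ⟨hk, hk'⟩ := Nat.find_spec hex
  have hmin : ∀ {j}, j < Nat.find hex → ¬ _ := fun hj => Nat.find_min hex hj
  set k := Nat.find hex
  have hp : pp (sq a) k = dpp dem (sq z) k := by
    rcases hk0 : k with _ | j
    · rfl
    · by_contra hj
      exact hmin (j := j) (by omega) ⟨by omega, hj⟩
  have hy : pp (sq a) k * cg dem (sq z) k = dpp dem (sq z) (k + 1) := by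
    rw [hp, cg, mul_inv_cancel_left]
  have hbr : Br cs (pp (sq a) k * sq a k) (pp (sq a) k * cg dem (sq z) k) := by
    rw [hy]
    exact ha.pp_br hd h (k := k + 1) hk
  obtain ⟨t, ht, htb, hg⟩ := exists_good_step hbot (ha.2.length_succ hk)
    (by rw [hy, length_dpp_succ hd, hp]) hbr fun he => hk' (by rw [← hy, ← he, pp])
  rw [sq_of_lt a hk] at ht htb
  refine ⟨some ⟨k, hk⟩, t, _, pstep_update (σ := sg n) ht, fun c => ?_, ⟨k, hk⟩, rfl, hg⟩
  by_cases hc : c = some ⟨k, hk⟩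
  · subst hc
    rw [Function.update_self]
    have h1 := htb.trans (cg_br hd (sq z) k)
    rwa [sq_of_lt z hk] at h1
  · rw [Function.update_of_ne hc]
    exact h c

end Atoms

section Labels

variable {B W : Type} [Group W] {M : CoxeterMatrix B} (cs : CoxeterSystem M W) {n : ℕ}
  [LinearOrder (Option B)]

open Classical in
/-- Whether a label is bounded by that of a reflection keeping its root positive. -/
def labSeg (p t : W) : ℕ :=
  if ∃ u, cs.IsReflection u ∧ 0 ≤ rep cs p (rt cs u) ∧ lbl cs p t ≤ lbl cs p u then 0 else 1

/-- The edge labelling attached to a minimal element. -/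
def atomLab (a : Option (Fin n) → W) :
    Option (Fin n) → W → ℕ ×ₗ (ℕ ×ₗ Lex (Option B →₀ ℝ))
  | none, t => toLex (2, toLex (0, lbl cs 1 t))
  | some i, t => toLex (labSeg cs (pp (sq a) i) t, toLex ((i : ℕ), lbl cs (pp (sq a) i) t))

variable {cs}

lemma labSeg_le_one (p t : W) : labSeg cs p t ≤ 1 := by
  unfold labSeg; split_ifs <;> simp

lemma labSeg_mono {p t u : W} (h : lbl cs p t ≤ lbl cs p u) : labSeg cs p t ≤ labSeg cs p u := by
  unfold labSeg
  split_ifs with h1 h2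
  · rfl
  · simp
  · obtain ⟨v, hv, hv', h3⟩ := ‹∃ _, _›
    exact absurd ⟨v, hv, hv', h.trans h3⟩ h1
  · rfl

lemma labSeg_eq_zero_iff (hbot : ∀ b : Option B, none ≤ b) {p t : W} (ht : cs.IsReflection t) :
    labSeg cs p t = 0 ↔ 0 ≤ rep cs p (rt cs t) := by
  unfold labSeg
  split_ifs with h
  · obtain ⟨u, hu, hu', hle⟩ := h
    refine ⟨fun _ => ?_, fun _ => rfl⟩
    by_contra hbad
    exact hle.not_gt (lbl_lt_of_good_of_bad hbot hu ht hu'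
      (((rt_isRoot ht).rep p).not_nonneg_iff.mp hbad))
  · exact iff_of_false id fun h0 => h ⟨t, ht, h0, le_rfl⟩

lemma isLab_atomLab (a : Option (Fin n) → W) : IsLab cs (atomLab cs a) where
  exists_lbl c := by
    cases c with
    | none =>
      refine ⟨1, fun t u => ?_⟩
      simp [atomLab, Prod.Lex.toLex_lt_toLex]
    | some i =>
      refine ⟨pp (sq a) i, fun t u => ?_⟩
      have h1 := labSeg_mono (cs := cs) (p := pp (sq a) i) (t := t) (u := u)
      have h2 := labSeg_mono (cs := cs) (p := pp (sq a) i) (t := u) (u := t)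
      simp only [atomLab, Prod.Lex.toLex_lt_toLex, lt_irrefl, true_and, false_or]
      constructor
      · rintro (h | h)
        · exact lt_of_not_ge fun h' => (h2 h').not_gt h
        · exact h.2
      · intro h
        rcases (h1 h.le).lt_or_eq with h' | h'
        · exact Or.inl h'
        · exact Or.inr ⟨h', h⟩
  ne {c c' t u} hc he := by
    cases c with
    | none =>
      cases c' with
      | none => exact hc rfl
      | some j =>
        have h1 : 2 = labSeg cs (pp (sq a) j) u := congrArg (fun x => (ofLex x).1) he
        have h2 := labSeg_le_one (cs := cs) (pp (sq a) j) u
        omega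
    | some i =>
      cases c' with
      | none =>
        have h1 : labSeg cs (pp (sq a) i) t = 2 := congrArg (fun x => (ofLex x).1) he
        have h2 := labSeg_le_one (cs := cs) (pp (sq a) i) t
        omega
      | some j =>
        have h1 : (i : ℕ) = j := congrArg (fun x => (ofLex (ofLex x).2).1) he
        exact hc (congrArg some (Fin.ext h1))

lemma GoodStep.of_le (hbot : ∀ b : Option B, none ≤ b) {a : Option (Fin n) → W}
    {c c' : Option (Fin n)} {t u : W} (ht : cs.IsReflection t) (hu : cs.IsReflection u)
    (h : GoodStep cs a c' u) (hle : atomLab cs a c t ≤ atomLab cs a c' u) :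
    GoodStep cs a c t := by
  obtain ⟨j, rfl, hj⟩ := h
  have h0 := (labSeg_eq_zero_iff hbot hu).mpr hj
  have h1 : (ofLex (atomLab cs a c t)).1 ≤ labSeg cs (pp (sq a) j) u :=
    Prod.Lex.monotone_fst _ _ hle
  rw [h0] at h1
  cases c with
  | none => exact absurd h1 (by simp [atomLab])
  | some i => exact ⟨i, rfl, (labSeg_eq_zero_iff hbot ht).mp (Nat.le_zero.mp h1)⟩

variable (cs) in
/-- The position and the reflection of a step. -/
def stp (x y : Option (Fin n) → W) : Option (Fin n) × W :=
  Classical.epsilon fun p : Option (Fin n) × W => Pstep cs (sg n) x p.1 p.2 y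

omit [LinearOrder (Option B)] in
lemma Pstep.unique {ι : Type} {σ : ι → Bool} {x y : ι → W} {c c' : ι} {t t' : W}
    (h : Pstep cs σ x c t y) (h' : Pstep cs σ x c' t' y) : c = c' ∧ t = t' := by
  have hc : c = c' := by
    by_contra hc
    have h1 := h.1.2.2
    rw [h'.2 c hc] at h1
    omega
  subst hc
  exact ⟨rfl, mul_right_cancel (h.1.2.1.symm.trans h'.1.2.1)⟩

omit [LinearOrder (Option B)] in
lemma Pstep.stp_spec {x y : Option (Fin n) → W} {c : Option (Fin n)} {t : W}
    (h : Pstep cs (sg n) x c t y) : Pstep cs (sg n) x (stp cs x y).1 (stp cs x y).2 y :=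
  Classical.epsilon_spec (p := fun p : Option (Fin n) × W => Pstep cs (sg n) x p.1 p.2 y) ⟨(c, t), h⟩

omit [LinearOrder (Option B)] in
lemma Pstep.stp_eq {x y : Option (Fin n) → W} {c : Option (Fin n)} {t : W}
    (h : Pstep cs (sg n) x c t y) : stp cs x y = (c, t) := by
  obtain ⟨h1, h2⟩ := h.stp_spec.unique h
  exact Prod.ext h1 h2

end Labels

section AugmentedPoset

variable {B W : Type} [Group W] {M : CoxeterMatrix B} (cs : CoxeterSystem M W) (dem : W → W → W)
  (n : ℕ)

/-- The augmented poset. -/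
abbrev Qhat : Type := Option {p : W × (Fin n → W) // BruhatLE cs p.1 (demProd dem p.2)}

variable {cs dem n}

/-- The entries of an element of the augmented poset. -/
def elt : Qhat cs dem n → Option (Fin n) → W
  | none, _ => 1
  | some p, none => p.1.1
  | some p, some i => p.1.2 i

/-- The rank function of the augmented poset. -/
def qrk : Qhat cs dem n → ℕ
  | none => 0
  | some p => (prk cs (sg n) (elt (some p))).toNat + 1

lemma foldr_dem_map_range (hd : IsDemazure cs dem) (u : ℕ → W) (k : ℕ) (b : W) :
    ((List.range k).map u).foldr dem b = dem (dpp dem u k) b := by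
  induction k generalizing b with
  | zero => simp [dpp, hd.one_left]
  | succ k ih =>
    rw [List.range_succ, List.map_append, List.foldr_append, ih, dpp, hd.assoc]
    rfl

lemma demProd_eq_dpp (hd : IsDemazure cs dem) (z : Option (Fin n) → W) :
    demProd dem (fun i => z (some i)) = dpp dem (sq z) n := by
  have h : List.ofFn (fun i => z (some i)) = (List.range n).map (sq z) := by
    refine List.ext_getElem (by simp) fun k h1 h2 => ?_
    rw [List.length_ofFn] at h1
    simp [sq_of_lt z h1]
  rw [demProd, h, foldr_dem_map_range hd, hd.one_right]

lemma inQ_iff (hd : IsDemazure cs dem) (z : Option (Fin n) → W) :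
    InQ cs dem z ↔ BruhatLE cs (z none) (demProd dem fun i => z (some i)) := by
  rw [demProd_eq_dpp hd, bruhatLE_iff, InQ]

lemma inQ_elt (hd : IsDemazure cs dem) (p) : InQ cs dem (elt (some p : Qhat cs dem n)) :=
  (inQ_iff hd _).mpr p.2

lemma exists_elt_eq (hd : IsDemazure cs dem) {z : Option (Fin n) → W} (hz : InQ cs dem z) :
    ∃ p, elt (some p : Qhat cs dem n) = z :=
  ⟨⟨(z none, fun i => z (some i)), (inQ_iff hd z).mp hz⟩, funext fun c => by cases c <;> rfl⟩

lemma elt_some_injective {p q} (h : elt (some p : Qhat cs dem n) = elt (some q)) : p = q :=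
  Subtype.ext (Prod.ext (congrFun h none) (funext fun i => congrFun h (some i)))

lemma qhatLE_none (x : Qhat cs dem n) : QhatLE cs dem none x := by cases x <;> trivial

lemma qhatLE_some {p q} : QhatLE cs dem (some p : Qhat cs dem n) (some q) ↔
    PLe cs (sg n) (elt (some p : Qhat cs dem n)) (elt (some q)) := by
  rw [ple_sg]
  simp only [QhatLE, seqLE, bruhatLE_iff]
  rfl

lemma qrk_some (hd : IsDemazure cs dem) (p) :
    (qrk (some p : Qhat cs dem n) : ℤ) = prk cs (sg n) (elt (some p)) + 1 := by
  have := (inQ_elt hd p).prk_nonneg hd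
  simp only [qrk]
  omega

lemma graded_qhat (hd : IsDemazure cs dem) : Graded (QhatLE cs dem (n := n)) qrk where
  refl x := by
    cases x with
    | none => trivial
    | some p => exact qhatLE_some.mpr (PLe.refl _)
  trans {x y z} h h' := by
    cases x with
    | none => exact qhatLE_none z
    | some p =>
      cases y with
      | none => exact h.elim
      | some q =>
        cases z with
        | none => exact h'.elim
        | some s => exact qhatLE_some.mpr ((qhatLE_some.mp h).trans (qhatLE_some.mp h'))
  rk_le {x y} h := by
    cases x with
    | none => exact Nat.zero_le _
    | some p =>
      cases y with
      | none => exact h.elim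
      | some q =>
        have := (qhatLE_some.mp h).prk_le
        have h1 := qrk_some hd p
        have h2 := qrk_some hd q
        omega
  eq_of_rk_le {x y} h h' := by
    cases x with
    | none =>
      cases y with
      | none => rfl
      | some q => exact absurd h' (by simp [qrk])
    | some p =>
      cases y with
      | none => exact h.elim
      | some q =>
        have h1 := qrk_some hd p
        have h2 := qrk_some hd q
        rw [elt_some_injective ((qhatLE_some.mp h).eq_of_prk_le (by omega))]
  exists_succ {x y} h h' := by
    cases y with
    | none => exact absurd h' (Nat.not_lt_zero _)
    | some q =>
      cases x with
      | none =>
        obtain ⟨p, hp⟩ := exists_elt_eq hd (gam_inQ hd (z := elt (some q)))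
        refine ⟨some p, qhatLE_none _, qhatLE_some.mpr ?_, ?_⟩
        · rw [hp]
          exact (inQ_elt hd q).gam_ple hd
        · simp only [qrk, hp, gam_prk hd, Int.toNat_zero]
      | some p =>
        have h1 := qrk_some hd p
        have h2 := qrk_some hd q
        obtain ⟨c, t, m, h3, h4⟩ := (qhatLE_some.mp h).exists_pstep fun he => by
          rw [elt_some_injective he] at h'; exact h'.false
        obtain ⟨s, rfl⟩ := exists_elt_eq hd ((inQ_elt hd p).mono hd h3.ple)
        have h5 := qrk_some hd s
        have h6 := h3.prk_eq
        exact ⟨some s, qhatLE_some.mpr h3.ple, qhatLE_some.mpr h4, by omega⟩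

lemma thinR_qhat (hd : IsDemazure cs dem) : ThinR (QhatLE cs dem (n := n)) := by
  obtain ⟨_, -⟩ := exists_linearOrder_option B
  refine (graded_qhat hd).thinR fun x y hxy hr => ?_
  cases y with
  | none => simp [qrk] at hr
  | some q =>
  have hq := qrk_some hd q
  cases x with
  | none =>
    rw [qrk] at hr
    obtain ⟨a, b, hab, h⟩ := (inQ_elt hd q).exists_two_atoms hd (by omega)
    obtain ⟨p, rfl⟩ := exists_elt_eq hd ((h a).mpr (Or.inl rfl)).1
    obtain ⟨s, rfl⟩ := exists_elt_eq hd ((h b).mpr (Or.inr rfl)).1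
    refine ⟨some p, some s, fun he => hab (congrArg elt he), fun z => ?_⟩
    cases z with
    | none => simp [qrk]
    | some z =>
      have hz := qrk_some hd z
      have h1 : qrk (none : Qhat cs dem n) = 0 := rfl
      have h2 := h (elt (some z))
      have h3 : ∀ {v}, elt (some z : Qhat cs dem n) = elt (some v) ↔
          (some z : Qhat cs dem n) = some v :=
        fun {v} => ⟨fun he => congrArg some (elt_some_injective he), congrArg elt⟩
      rw [h3, h3] at h2
      rw [← h2, qhatLE_some, h1]
      refine ⟨fun h => ⟨inQ_elt hd z, by omega, h.2.1⟩, fun h => ⟨trivial, h.2.2, by omega⟩⟩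
  | some p =>
    have hp := qrk_some hd p
    obtain ⟨c, t, m, h1, h2⟩ := (qhatLE_some.mp hxy).exists_pstep fun he => by
      rw [elt_some_injective he] at hr; omega
    have h3 := h1.prk_eq
    obtain ⟨c', t', h4⟩ := h2.exists_pstep_of_prk (by omega)
    obtain ⟨c₂, t₂, m₂, h5, h6, h7, h8, -⟩ := h1.exists_other h4
    have h9 := h5.prk_eq
    obtain ⟨k, rfl⟩ := exists_elt_eq hd ((inQ_elt hd p).mono hd h1.ple)
    obtain ⟨l, rfl⟩ := exists_elt_eq hd ((inQ_elt hd p).mono hd h5.ple)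
    have hk := qrk_some hd k
    have hl := qrk_some hd l
    refine ⟨some k, some l, fun he => h7 (congrArg elt he).symm, fun z => ⟨?_, ?_⟩⟩
    · rintro ⟨ha, hb, hc⟩
      cases z with
      | none => exact ha.elim
      | some z =>
        have hz := qrk_some hd z
        obtain ⟨e, u, hu⟩ := (qhatLE_some.mp ha).exists_pstep_of_prk (by omega)
        rcases h8 e u _ hu (qhatLE_some.mp hb) with he | he
        · exact Or.inl (congrArg some (elt_some_injective he))
        · exact Or.inr (congrArg some (elt_some_injective he))
    · rintro (rfl | rfl)
      · exact ⟨qhatLE_some.mpr h1.ple, qhatLE_some.mpr h2, by omega⟩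
      · exact ⟨qhatLE_some.mpr h5.ple, qhatLE_some.mpr h6, by omega⟩

lemma finite_qhatLE (hd : IsDemazure cs dem) (x : Qhat cs dem n) :
    {z | QhatLE cs dem z x}.Finite := by
  cases x with
  | none =>
    refine (Set.finite_singleton none).subset fun z hz => ?_
    cases z with
    | none => rfl
    | some z => exact hz.elim
  | some q =>
    have h1 : {p | QhatLE cs dem (some p) (some q)}.Finite := by
      refine Set.Finite.of_finite_image
        (f := fun p => elt (some p : Qhat cs dem n)) ?_ fun p _ p' _ h => elt_some_injective h
      refine (Set.Finite.pi' (t := fun c => {v | Br cs v (dpp dem (sq (elt (some q))) n)} ∪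
        {v | Br cs v (elt (some q) c)}) fun c => (finite_br _).union (finite_br _)).subset ?_
      rintro _ ⟨p, hp, rfl⟩ c
      have hp := qhatLE_some.mp hp
      cases c with
      | none => exact Or.inl ((inQ_elt hd p).trans (dpp_mono hd fun _ hk => hp.sq hk))
      | some i => exact Or.inr (hp (some i))
    refine ((h1.image some).insert none).subset fun z hz => ?_
    cases z with
    | none => exact Or.inl rfl
    | some p => exact Or.inr ⟨p, hz, rfl⟩

end AugmentedPoset

section Shelling

lemma IsFlag.update {α : Type*} {r : α → α → Prop} {rk : α → ℕ} {x b : α} {f : ℕ → α}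
    (hf : IsFlag r rk x f) {k : ℕ} (hk : k + 1 < rk x) (hb : rk b = k + 1) (h1 : r (f k) b)
    (h2 : r b (f (k + 2))) : IsFlag r rk x (Function.update f (k + 1) b) := by
  refine ⟨fun j hj => ?_, fun j hj => ?_, fun j hj => ?_⟩
  · by_cases h : j = k + 1
    · rw [h, Function.update_self, hb]
    · rw [Function.update_of_ne h, hf.1 j hj]
  · by_cases h : j = k + 1
    · rw [h, Function.update_self, Function.update_of_ne (by omega)]
      exact h2
    · rw [Function.update_of_ne h]
      by_cases h' : j = k
      · rw [h', Function.update_self]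
        exact h1
      · rw [Function.update_of_ne (by omega)]
        exact hf.2.1 j hj
  · rw [Function.update_of_ne (by omega), hf.2.2 j hj]

variable {B W : Type} [Group W] {M : CoxeterMatrix B} {cs : CoxeterSystem M W} {dem : W → W → W}
  {n : ℕ}

lemma eq_none_of_qrk {y : Qhat cs dem n} (h : qrk y = 0) : y = none := by
  cases y with
  | none => rfl
  | some p => simp [qrk] at h

lemma eq_of_elt_eq {y z : Qhat cs dem n} (hy : qrk y ≠ 0) (hz : qrk z ≠ 0) (h : elt y = elt z) :
    y = z := by
  cases y with
  | none => exact absurd rfl hy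
  | some p =>
    cases z with
    | none => exact absurd rfl hz
    | some q => rw [elt_some_injective h]

lemma exists_some_eq {y : Qhat cs dem n} (hy : qrk y ≠ 0) : ∃ p, y = some p := by
  cases y with
  | none => exact absurd rfl hy
  | some p => exact ⟨p, rfl⟩

lemma ple_elt {y z : Qhat cs dem n} (h : QhatLE cs dem y z) (hy : qrk y ≠ 0) :
    PLe cs (sg n) (elt y) (elt z) := by
  obtain ⟨p, rfl⟩ := exists_some_eq hy
  cases z with
  | none => exact h.elim
  | some q => exact qhatLE_some.mp h

section
variable (hd : IsDemazure cs dem) {x : Qhat cs dem n} {f g : ℕ → Qhat cs dem n}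
include hd

lemma isAtomQ_elt {y : Qhat cs dem n} (hy : qrk y = 1) : IsAtomQ cs (elt y) := by
  obtain ⟨p, rfl⟩ := exists_some_eq (y := y) (by omega)
  have := qrk_some hd p
  exact (inQ_elt hd p).atom hd (by omega)

lemma IsFlag.pstep (hf : IsFlag (QhatLE cs dem) qrk x f) {k : ℕ} (h1 : 1 ≤ k) (h2 : k < qrk x) :
    Pstep cs (sg n) (elt (f k)) (stp cs (elt (f k)) (elt (f (k + 1)))).1
      (stp cs (elt (f k)) (elt (f (k + 1)))).2 (elt (f (k + 1))) := by
  have h3 := hf.1 k h2.le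
  have h4 := hf.1 (k + 1) h2
  have h := ple_elt (hf.2.1 k h2) (by omega)
  obtain ⟨p, hp⟩ := exists_some_eq (y := f k) (by omega)
  obtain ⟨q, hq⟩ := exists_some_eq (y := f (k + 1)) (by omega)
  have h5 := qrk_some hd p
  have h6 := qrk_some hd q
  rw [← hp] at h5
  rw [← hq] at h6
  obtain ⟨c, t, h⟩ := h.exists_pstep_of_prk (by omega)
  exact h.stp_spec

end

variable [LinearOrder (Option B)]

/-- The labels of the steps of a flag. -/
def flagLab (f : ℕ → Qhat cs dem n) (k : ℕ) : ℕ ×ₗ (ℕ ×ₗ Lex (Option B →₀ ℝ)) :=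
  atomLab cs (elt (f 1)) (stp cs (elt (f k)) (elt (f (k + 1)))).1
    (stp cs (elt (f k)) (elt (f (k + 1)))).2

/-- The key by which flags are ordered in the shelling. -/
def flagKey [LinearOrder (Option (Fin n) → W)] (f : ℕ → Qhat cs dem n) :
    (ℕᵒᵈ ×ₗ (Option (Fin n) → W)) ×ₗ Lex (ℕ → ℕ ×ₗ (ℕ ×ₗ Lex (Option B →₀ ℝ))) :=
  toLex (toLex (OrderDual.toDual (ppSize cs (elt (f 1))), elt (f 1)), toLex (flagLab f))

variable {x : Qhat cs dem n} {f g : ℕ → Qhat cs dem n}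

lemma flagKey_lt_of_flagLab [LinearOrder (Option (Fin n) → W)] (h1 : f 1 = g 1) {i : ℕ}
    (h2 : ∀ j < i, flagLab f j = flagLab g j) (h3 : flagLab f i < flagLab g i) :
    flagKey f < flagKey g :=
  Prod.Lex.toLex_lt_toLex.mpr (Or.inr ⟨by rw [h1], i, h2, h3⟩)

lemma flagKey_lt_of_ppSize [LinearOrder (Option (Fin n) → W)]
    (h : ppSize cs (elt (g 1)) < ppSize cs (elt (f 1))) : flagKey f < flagKey g :=
  Prod.Lex.toLex_lt_toLex.mpr (Or.inl (Prod.Lex.toLex_lt_toLex.mpr (Or.inl h)))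

lemma of_flagKey_lt [LinearOrder (Option (Fin n) → W)] (h : flagKey g < flagKey f) :
    (elt (g 1) ≠ elt (f 1) ∧ ppSize cs (elt (f 1)) ≤ ppSize cs (elt (g 1))) ∨
    (elt (g 1) = elt (f 1) ∧ ∃ i, (∀ j < i, flagLab g j = flagLab f j) ∧
      flagLab g i < flagLab f i) := by
  rcases Prod.Lex.toLex_lt_toLex.mp h with h1 | ⟨h1, i, h2, h3⟩
  · rcases Prod.Lex.toLex_lt_toLex.mp h1 with h2 | ⟨h2, h3⟩
    · have h3 : ppSize cs (elt (f 1)) < ppSize cs (elt (g 1)) := h2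
      exact Or.inl ⟨fun h4 => by rw [h4] at h3; exact h3.false, h3.le⟩
    · exact Or.inl ⟨h3.ne, (OrderDual.toDual_inj.mp h2).ge⟩
  · exact Or.inr ⟨(Prod.ext_iff.mp (toLex_inj.mp h1)).2, i, h2, h3⟩

variable (hd : IsDemazure cs dem)
include hd

lemma IsFlag.eq_of_flagLab (hf : IsFlag (QhatLE cs dem) qrk x f)
    (hg : IsFlag (QhatLE cs dem) qrk x g) (h1 : elt (f 1) = elt (g 1)) {i : ℕ}
    (h2 : ∀ j < i, flagLab f j = flagLab g j) {k : ℕ} (hk : k ≤ i) : f k = g k := by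
  induction k with
  | zero =>
    rw [eq_none_of_qrk (hf.1 0 (Nat.zero_le _)), eq_none_of_qrk (hg.1 0 (Nat.zero_le _))]
  | succ k ih =>
    by_cases hkx : qrk x ≤ k + 1
    · rw [hf.2.2 _ hkx, hg.2.2 _ hkx]
    have hf' := hf.1 (k + 1) (by omega)
    have hg' := hg.1 (k + 1) (by omega)
    refine eq_of_elt_eq (by omega) (by omega) ?_
    rcases Nat.eq_zero_or_pos k with rfl | hk0
    · exact h1
    have h3 := hf.pstep hd hk0 (by omega)
    have h4 := hg.pstep hd hk0 (by omega)
    have h5 := h2 k (by omega)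
    rw [flagLab, flagLab, ← h1] at h5
    obtain ⟨h6, h7⟩ := (isLab_atomLab (cs := cs) _).eq h3.1.1 h4.1.1 h5
    rw [← h6, ← h7, ← ih (by omega)] at h4
    exact h3.eq h4

lemma IsFlag.exists_flip [LinearOrder (Option (Fin n) → W)]
    (hf : IsFlag (QhatLE cs dem) qrk x f) {k : ℕ} (hk : 1 ≤ k) (hkx : k + 1 < qrk x)
    (hlt : flagLab f (k + 1) < flagLab f k) :
    ∃ h, IsFlag (QhatLE cs dem) qrk x h ∧ flagKey h < flagKey f ∧ ∀ j, j ≠ k + 1 → h j = f j := by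
  have hs := hf.pstep hd hk (by omega)
  obtain ⟨c, t, m, h1, h2, h3, -, h4⟩ := hs.exists_other (hf.pstep hd (by omega) hkx)
  have h5 := h4 (isLab_atomLab (elt (f 1))) hlt
  have hk1 := hf.1 k (by omega)
  have hk2 := hf.1 (k + 2) (by omega)
  obtain ⟨p, hp⟩ := exists_some_eq (y := f k) (by omega)
  obtain ⟨q, hq⟩ := exists_some_eq (y := f (k + 2)) (by omega)
  have hp' := qrk_some hd p
  rw [← hp] at hp'
  obtain ⟨s, rfl⟩ := exists_elt_eq hd ((inQ_elt hd p).mono hd (hp ▸ h1.ple))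
  have hs' := qrk_some hd s
  have h6 := h1.prk_eq
  refine ⟨_, hf.update hkx (b := some s) (by omega) ?_ ?_, ?_,
    fun j hj => Function.update_of_ne hj _ _⟩
  · rw [hp]
    exact qhatLE_some.mpr (hp ▸ h1.ple)
  · rw [hq]
    exact qhatLE_some.mpr (hq ▸ h2)
  · refine flagKey_lt_of_flagLab (i := k) (Function.update_of_ne (by omega) _ _) (fun j hj => ?_) ?_
    · rw [flagLab, flagLab, Function.update_of_ne (by omega), Function.update_of_ne (by omega),
        Function.update_of_ne (by omega)]
    · rw [flagLab, Function.update_of_ne (by omega), Function.update_of_ne (by omega),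
        Function.update_self, h1.stp_eq]
      exact h5

lemma IsFlag.flagLab_le (hf : IsFlag (QhatLE cs dem) qrk x f) {i j : ℕ} (hi : 1 ≤ i) (hij : i < j)
    (hj : j ≤ qrk x) (hnd : ∀ k, i ≤ k → k + 1 < j → flagLab f k ≤ flagLab f (k + 1))
    {c : Option (Fin n)} {t : W} {m : Option (Fin n) → W} (hm : Pstep cs (sg n) (elt (f i)) c t m)
    (hmj : PLe cs (sg n) m (elt (f j))) : flagLab f i ≤ atomLab cs (elt (f 1)) c t :=
  lab_le_of_no_descent (isLab_atomLab (elt (f 1))) (f := fun k => elt (f k))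
    (C := fun k => (stp cs (elt (f k)) (elt (f (k + 1)))).1)
    (T := fun k => (stp cs (elt (f k)) (elt (f (k + 1)))).2) hij
    (fun k h1 h2 => hf.pstep hd (by omega) (by omega)) hnd hm hmj

end Shelling

section Exchange

variable {B W : Type} [Group W] {M : CoxeterMatrix B} {cs : CoxeterSystem M W} {dem : W → W → W}
  {n : ℕ} {x : Qhat cs dem n} {f g : ℕ → Qhat cs dem n}

lemma exists_first_meet {α : Type*} {f g : ℕ → α} {i l : ℕ} (hil : i ≤ l) (h : f l = g l) :
    ∃ j, i ≤ j ∧ j ≤ l ∧ f j = g j ∧ ∀ k, i ≤ k → k < j → f k ≠ g k := by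
  classical
  have hex : ∃ j, i ≤ j ∧ f j = g j := ⟨l, hil, h⟩
  obtain ⟨h1, h2⟩ := Nat.find_spec hex
  exact ⟨Nat.find hex, h1, Nat.find_min' hex ⟨hil, h⟩, h2,
    fun k hk hkj hkk => Nat.find_min hex hkj ⟨hk, hkk⟩⟩

variable (hd : IsDemazure cs dem)
include hd

lemma IsFlag.ple (hf : IsFlag (QhatLE cs dem) qrk x f) {i j : ℕ} (hi : 1 ≤ i) (hij : i ≤ j)
    (hix : i ≤ qrk x) : PLe cs (sg n) (elt (f i)) (elt (f j)) :=
  ple_elt (hf.le (graded_qhat hd) hij) (by rw [hf.1 i hix]; omega)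

variable [LinearOrder (Option B)] [LinearOrder (Option (Fin n) → W)]

/-- If two flags agree at `i` and `j` but not in between and `g` leaves `f` by a smaller label,
then `f` has a descent in between. -/
lemma IsFlag.exists_exchange_of_flagLab (hf : IsFlag (QhatLE cs dem) qrk x f)
    (hg : IsFlag (QhatLE cs dem) qrk x g) (h1 : elt (g 1) = elt (f 1)) {i : ℕ}
    (h2 : ∀ j < i, flagLab g j = flagLab f j) (h3 : flagLab g i < flagLab f i) :
    ∃ m ≤ qrk x, g m ≠ f m ∧ ∃ h, IsFlag (QhatLE cs dem) qrk x h ∧ flagKey h < flagKey f ∧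
        ∀ k ≤ qrk x, k ≠ m → h k = f k := by
  have heq : ∀ k ≤ i, g k = f k := fun k hk => hg.eq_of_flagLab hd hf h1 h2 hk
  have hne : ¬ (g i = f i ∧ g (i + 1) = f (i + 1)) := by
    rintro ⟨h4, h5⟩
    rw [flagLab, flagLab, h1, h4, h5] at h3
    exact h3.false
  have hi1 : i + 1 ≤ qrk x := by
    by_contra h
    exact hne ⟨by rw [hf.2.2 i (by omega), hg.2.2 i (by omega)],
      by rw [hf.2.2 (i + 1) (by omega), hg.2.2 (i + 1) (by omega)]⟩
  have hi0 : 1 ≤ i := by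
    by_contra h
    obtain rfl : i = 0 := by omega
    exact hne ⟨heq 0 le_rfl, eq_of_elt_eq (by rw [hg.1 _ hi1]; omega) (by rw [hf.1 _ hi1]; omega) h1⟩
  have hgi := heq i le_rfl
  obtain ⟨j, hj1, hj2, hj3, hj4⟩ := exists_first_meet (f := g) (g := f) hi1
    (by rw [hf.2.2 _ le_rfl, hg.2.2 _ le_rfl])
  by_cases hnd : ∀ k, i ≤ k → k + 1 < j → flagLab f k ≤ flagLab f (k + 1)
  · have h4 := hg.pstep hd hi0 (by omega)
    rw [hgi] at h4
    have h5 := hg.ple hd (i := i + 1) (by omega) hj1 hi1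
    rw [hj3] at h5
    have h6 := hf.flagLab_le hd hi0 (by omega) hj2 hnd h4 h5
    rw [← h1, ← hgi] at h6
    exact absurd h3 h6.not_gt
  · push Not at hnd
    obtain ⟨k, hk1, hk2, hk3⟩ := hnd
    obtain ⟨h, h4, h5, h6⟩ := hf.exists_flip hd (by omega) (by omega) hk3
    exact ⟨k + 1, by omega, hj4 _ (by omega) hk2, h, h4, h5, fun l _ => h6 l⟩

lemma IsFlag.exists_exchange_of_ppSize (hbot : ∀ b : Option B, none ≤ b)
    (hf : IsFlag (QhatLE cs dem) qrk x f) (hg : IsFlag (QhatLE cs dem) qrk x g)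
    (h1 : elt (g 1) ≠ elt (f 1)) (h2 : ppSize cs (elt (f 1)) ≤ ppSize cs (elt (g 1))) :
    ∃ m ≤ qrk x, g m ≠ f m ∧ ∃ h, IsFlag (QhatLE cs dem) qrk x h ∧ flagKey h < flagKey f ∧
        ∀ k ≤ qrk x, k ≠ m → h k = f k := by
  have h1' : g 1 ≠ f 1 := fun h => h1 (by rw [h])
  have hx : 2 ≤ qrk x := by
    by_contra h
    exact h1' (by rw [hf.2.2 1 (by omega), hg.2.2 1 (by omega)])
  obtain ⟨j, hj1, hj2, hj3, hj4⟩ := exists_first_meet (f := g) (g := f) hx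
    (by rw [hf.2.2 _ le_rfl, hg.2.2 _ le_rfl])
  by_cases hnd : ∀ k, 1 ≤ k → k + 1 < j → flagLab f k ≤ flagLab f (k + 1)
  · have haf := isAtomQ_elt hd (hf.1 1 (by omega))
    have hag := isAtomQ_elt hd (hg.1 1 (by omega))
    have hgj := hg.ple hd le_rfl (j := j) (by omega) (by omega)
    rw [hj3] at hgj
    have hne : elt (f 1) ≠ gam dem (elt (f j)) := by
      intro h
      rw [h] at h2
      exact h1 ((hag.eq_gam_of_ppSize hd hgj h2).trans h.symm)
    obtain ⟨c, t, m, h3, h4, h5⟩ := haf.exists_goodStep hd hbot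
      (hf.ple hd le_rfl (by omega) (by omega)) hne
    have h6 := hf.pstep hd le_rfl hx
    have h7 := ppSize_lt_of_goodStep hd haf h6 (h5.of_le hbot h6.1.1 h3.1.1
      (hf.flagLab_le hd le_rfl (by omega) hj2 hnd h3 h4))
    obtain ⟨p, hp⟩ := exists_some_eq (y := f 2) (by rw [hf.1 2 hx]; omega)
    obtain ⟨s, hs⟩ := exists_elt_eq hd (gam_inQ hd (z := elt (f 2)))
    have hs' := qrk_some hd s
    rw [hs, gam_prk hd] at hs'
    refine ⟨1, by omega, h1', _, hf.update (k := 0) (b := some s) (by omega) (by omega) ?_ ?_, ?_,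
      fun k _ hk => Function.update_of_ne hk _ _⟩
    · rw [eq_none_of_qrk (hf.1 0 (by omega))]
      exact qhatLE_none _
    · rw [zero_add, hp]
      refine qhatLE_some.mpr ?_
      rw [hs, hp]
      exact (inQ_elt hd p).gam_ple hd
    · refine flagKey_lt_of_ppSize ?_
      rw [Function.update_self, hs]
      exact h7
  · push Not at hnd
    obtain ⟨k, hk1, hk2, hk3⟩ := hnd
    obtain ⟨h, h4, h5, h6⟩ := hf.exists_flip hd hk1 (by omega) hk3
    exact ⟨k + 1, by omega, hj4 _ (by omega) hk2, h, h4, h5, fun l _ => h6 l⟩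

lemma IsFlag.eq_of_flagKey (hf : IsFlag (QhatLE cs dem) qrk x f)
    (hg : IsFlag (QhatLE cs dem) qrk x g) (h : flagKey f = flagKey g) : f = g := by
  have h1 := Prod.ext_iff.mp (toLex_inj.mp h)
  have h2 := (Prod.ext_iff.mp (toLex_inj.mp h1.1)).2
  exact funext fun k => hf.eq_of_flagLab hd hg h2 (fun j _ => congrFun (toLex_inj.mp h1.2) j) le_rfl

theorem shellableR_qhat (hbot : ∀ b : Option B, none ≤ b) (x : Qhat cs dem n) :
    ShellableR (QhatLE cs dem) {z | QhatLE cs dem z x} :=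
  (graded_qhat hd).shellableR qhatLE_none rfl (finite_qhatLE hd x) flagKey
    (fun _ _ hf hg => hf.eq_of_flagKey hd hg) fun _ _ hf hg h => by
      rcases of_flagKey_lt h with ⟨h1, h2⟩ | ⟨h1, i, h2, h3⟩
      · exact hf.exists_exchange_of_ppSize hd hbot hg h1 h2
      · exact hf.exists_exchange_of_flagLab hd hg h1 h2 h3

end Exchange

/-- **Bao–He, Theorem `thm:hatQ`**: the augmented poset `Q̂` is pure and thin, and
every interval `[0̂, x]` is shellable. -/
theorem statement_4
    {B W : Type} [Group W] {M : CoxeterMatrix B}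
    (cs : CoxeterSystem M W) (dem : W → W → W) (hdem : IsDemazure cs dem)
    (n : ℕ) :
    PureR (QhatLE cs dem (n := n)) ∧
    ThinR (QhatLE cs dem (n := n)) ∧
    ∀ x : Option {p : W × (Fin n → W) // BruhatLE cs p.1 (demProd dem p.2)},
      ShellableR (QhatLE cs dem) {z | QhatLE cs dem z x} := by
  classical
  obtain ⟨o, hbot⟩ := exists_linearOrder_option B
  let _ : LinearOrder (Option (Fin n) → W) := IsWellOrder.linearOrder WellOrderingRel
  exact ⟨(graded_qhat hdem).pureR, thinR_qhat hdem, shellableR_qhat hdem hbot⟩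

end TotPos
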